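/- arXiv:2009.07244 — 2 statements merged into one kernel-verified Lean document; each statement's English description precedes it below -/
import Mathlib

section
/- Let 1 ≤ d < n, let 𝐏 : ℝ^d → ℝ^{n−d} be a smooth map, and let ψ₀ be a smooth compactly supported function with ψ₀ = 1 on [0,1]^d and ψ₀ = 0 outside [−1,2]^d. Define E^S f(x', x'') = ∫_{[−1,2]^d} e^{2πi(x'·ξ + x''·𝐏(ξ))} f(ξ) ψ₀(ξ) dξ for x' ∈ ℝ^d, x'' ∈ ℝ^{n−d}. Let q ≥ p ≥ 2. Assume there exist ρ > 0 and a constant C₀ with |E^S 1(x)| ≤ C₀ (1 + |x|)^{−ρ} for all x ∈ ℝⁿ, and assume that for every 0 < α ≤ 1 there is a constant C_α such that ‖E^S f‖_{L^q(B_R)} ≤ C_α R^α ‖f‖_{L^p} for every R ≥ 1, every ball B_R ⊂ ℝⁿ of radius R, and every f. Then for every s > q there is a constant C such that ‖E^S f‖_{L^s(ℝⁿ)} ≤ C ‖f‖_{L^p} for every f. -/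
open MeasureTheory

noncomputable section

/-- The extension operator of the `d`-dimensional surface `{(ξ, P ξ)} ⊂ ℝ^{d+m}` with
smooth cutoff `ψ`, evaluated at `x ∈ ℝ^{d+m}` (the first `d` coordinates of `x` are `x'`,
the last `m` coordinates are `x''`). -/
def extGen (d m : ℕ) (P : (Fin d → ℝ) → (Fin m → ℝ)) (ψ : (Fin d → ℝ) → ℝ)
    (f : (Fin d → ℝ) → ℂ) (x : EuclideanSpace ℝ (Fin d ⊕ Fin m)) : ℂ :=
  ∫ ξ in Set.Icc (fun _ => (-1:ℝ)) (fun _ => 2),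
    Complex.exp (2 * (Real.pi : ℂ) * Complex.I *
        (((∑ i, x (Sum.inl i) * ξ i) + ∑ j, x (Sum.inr j) * P ξ j : ℝ) : ℂ)) *
      f ξ * (ψ ξ : ℂ)

abbrev erQ (d : ℕ) : Set (Fin d → ℝ) := Set.Icc (fun _ => (-1:ℝ)) (fun _ => 2)

abbrev erX (d m : ℕ) := EuclideanSpace ℝ (Fin d ⊕ Fin m)

def phs {d m : ℕ} (P : (Fin d → ℝ) → (Fin m → ℝ)) (x : erX d m) (ξ : Fin d → ℝ) : ℝ :=
  (∑ i, x (Sum.inl i) * ξ i) + ∑ j, x (Sum.inr j) * P ξ j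

def ee {d m : ℕ} (P : (Fin d → ℝ) → (Fin m → ℝ)) (x : erX d m) (ξ : Fin d → ℝ) : ℂ :=
  Complex.exp (2 * (Real.pi : ℂ) * Complex.I * (phs P x ξ : ℂ))

structure Good (d m : ℕ) (P : (Fin d → ℝ) → (Fin m → ℝ)) (ψ : (Fin d → ℝ) → ℝ) (K : ℝ) :
    Prop where
  hK : 1 ≤ K
  Pc : Continuous P
  PL : ∀ (x : erX d m) (ξ η : Fin d → ℝ), ξ ∈ erQ d → η ∈ erQ d →
    |phs P x ξ - phs P x η| ≤ K * ‖x‖ * ‖ξ - η‖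
  PB : ∀ (x : erX d m) (ξ : Fin d → ℝ), ξ ∈ erQ d → |phs P x ξ| ≤ K * ‖x‖
  ψc : Continuous ψ
  ψL : ∀ ξ η, |ψ ξ - ψ η| ≤ K * ‖ξ - η‖
  ψB : ∀ ξ, |ψ ξ| ≤ K
  ψ0 : ∀ ξ ∉ erQ d, ψ ξ = 0

section basic
variable {d m : ℕ} {P : (Fin d → ℝ) → (Fin m → ℝ)} {ψ : (Fin d → ℝ) → ℝ} {K : ℝ}

lemma phs_add (x y : erX d m) (ξ) : phs P (x + y) ξ = phs P x ξ + phs P y ξ := by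
  simp only [phs, PiLp.add_apply, add_mul, Finset.sum_add_distrib]; ring

lemma phs_neg (x : erX d m) (ξ) : phs P (-x) ξ = - phs P x ξ := by
  simp only [phs, PiLp.neg_apply, neg_mul, Finset.sum_neg_distrib]; ring

lemma ee_add (x y : erX d m) (ξ) : ee P (x + y) ξ = ee P x ξ * ee P y ξ := by
  simp only [ee, phs_add, ← Complex.exp_add]; congr 1; push_cast; ring

lemma norm_ee (x : erX d m) (ξ) : ‖ee P x ξ‖ = 1 := by
  have : 2 * (Real.pi : ℂ) * Complex.I * (phs P x ξ : ℂ)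
      = ((2 * Real.pi * phs P x ξ : ℝ) : ℂ) * Complex.I := by push_cast; ring
  rw [ee, this, Complex.norm_exp_ofReal_mul_I]

lemma ee_neg (x : erX d m) (ξ) : ee P (-x) ξ = (starRingEnd ℂ) (ee P x ξ) := by
  simp only [ee, phs_neg, ← Complex.exp_conj]; congr 1; simp; left; exact (map_ofNat (starRingEnd ℂ) 2).symm

lemma ee_neg_mul (x : erX d m) (ξ) : ee P (-x) ξ * ee P x ξ = 1 := by
  rw [← ee_add]; simp [ee, phs]

lemma ee_sub_one (x : erX d m) (ξ) : ‖ee P x ξ - 1‖ ≤ 2 * Real.pi * |phs P x ξ| := by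
  have : 2 * (Real.pi : ℂ) * Complex.I * (phs P x ξ : ℂ)
      = Complex.I * ((2 * Real.pi * phs P x ξ : ℝ) : ℂ) := by push_cast; ring
  rw [ee, this]
  refine (Real.norm_exp_I_mul_ofReal_sub_one_le).trans ?_
  rw [Real.norm_eq_abs, abs_mul, abs_of_pos (by positivity)]

lemma ee_sub (x : erX d m) (ξ η) :
    ‖ee P x ξ - ee P x η‖ ≤ 2 * Real.pi * |phs P x ξ - phs P x η| := by
  have h1 : ee P x ξ - ee P x η = ee P x η * (Complex.exp (Complex.I *
      ((2 * Real.pi * (phs P x ξ - phs P x η) : ℝ) : ℂ)) - 1) := by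
    rw [mul_sub, mul_one, ee, ee, ← Complex.exp_add]; congr 2; push_cast; ring
  rw [h1, norm_mul, norm_ee, one_mul]
  refine (Real.norm_exp_I_mul_ofReal_sub_one_le).trans ?_
  rw [Real.norm_eq_abs, abs_mul, abs_of_pos (by positivity)]

lemma continuous_phs (hP : Continuous P) :
    Continuous (fun z : erX d m × (Fin d → ℝ) => phs P z.1 z.2) := by
  unfold phs; fun_prop

lemma continuous_ee (hP : Continuous P) :
    Continuous (fun z : erX d m × (Fin d → ℝ) => ee P z.1 z.2) := by
  unfold ee
  have := continuous_phs (m := m) hP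
  fun_prop

lemma continuous_ee' (hP : Continuous P) (x : erX d m) : Continuous (ee P x) :=
  (continuous_ee hP).comp (by fun_prop : Continuous fun ξ => (x, ξ))

lemma extGen_eq (hψ : ∀ ξ ∉ erQ d, ψ ξ = 0) (f : (Fin d → ℝ) → ℂ) (x : erX d m) :
    extGen d m P ψ f x = ∫ ξ, ee P x ξ * f ξ * (ψ ξ : ℂ) := by
  rw [extGen]
  apply setIntegral_eq_integral_of_forall_compl_eq_zero
  intro ξ hξ
  simp [hψ ξ hξ]

lemma Good.extGen_continuous (H : Good d m P ψ K) {f : (Fin d → ℝ) → ℂ} (hf : Integrable f) :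
    Continuous (extGen d m P ψ f) := by
  have : extGen d m P ψ f = fun x => ∫ ξ, ee P x ξ * f ξ * (ψ ξ : ℂ) := by
    funext x; exact extGen_eq H.ψ0 f x
  rw [this]
  refine continuous_of_dominated (bound := fun ξ => ‖f ξ‖ * K) ?_ ?_ ?_ ?_
  · intro x
    exact ((continuous_ee' H.Pc x).aestronglyMeasurable.mul hf.1).mul
      (Complex.continuous_ofReal.comp H.ψc).aestronglyMeasurable
  · intro x
    refine Filter.Eventually.of_forall fun ξ => ?_
    rw [norm_mul, norm_mul, norm_ee, one_mul, Complex.norm_real, Real.norm_eq_abs]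
    exact mul_le_mul_of_nonneg_left (H.ψB ξ) (norm_nonneg _)
  · exact hf.norm.mul_const _
  · refine Filter.Eventually.of_forall fun ξ => ?_
    have : Continuous fun x : erX d m => ee P x ξ :=
      (continuous_ee H.Pc).comp (by fun_prop : Continuous fun x => (x, ξ))
    fun_prop

lemma Good.extGen_bound (H : Good d m P ψ K) {f : (Fin d → ℝ) → ℂ} (hf : Integrable f) (x) :
    ‖extGen d m P ψ f x‖ ≤ K * ∫ ξ, ‖f ξ‖ := by
  rw [extGen_eq H.ψ0, mul_comm K, ← integral_mul_const]
  refine norm_integral_le_of_norm_le (hf.norm.mul_const _) ?_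
  refine Filter.Eventually.of_forall fun ξ => ?_
  rw [norm_mul, norm_mul, norm_ee, one_mul, Complex.norm_real, Real.norm_eq_abs]
  exact mul_le_mul_of_nonneg_left (H.ψB ξ) (norm_nonneg _)

lemma exists_good (hP : ContDiff ℝ (⊤ : ℕ∞) P) (hψ : ContDiff ℝ (⊤ : ℕ∞) ψ)
    (hψc : HasCompactSupport ψ)
    (hψ0 : ∀ ξ ∉ Set.Icc (fun _ => (-1:ℝ)) (fun _ => 2), ψ ξ = 0) :
    ∃ K, Good d m P ψ K := by
  obtain ⟨K1, hK1⟩ : ∃ K1, LipschitzOnWith K1 P (erQ d) := by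
    apply ContDiffOn.exists_lipschitzOnWith (n := 1) (hP.contDiffOn.of_le (by simp)) (by simp)
      (convex_Icc _ _) isCompact_Icc
  obtain ⟨K2, hK2⟩ := hψ.lipschitzWith_of_hasCompactSupport hψc (by simp)
  obtain ⟨K3, hK3⟩ := hψ.continuous.bounded_above_of_compact_support hψc
  obtain ⟨K4, hK4⟩ := isCompact_Icc.exists_bound_of_continuousOn
    (s := erQ d) hP.continuous.continuousOn
  have hco : ∀ (x : erX d m) i, |x i| ≤ ‖x‖ := fun x i => by
    simpa using PiLp.norm_apply_le x i
  refine ⟨1 + (d + m * K1) + K2 + |K3| + (d * 2 + m * |K4|), ?_, hP.continuous, ?_, ?_,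
    hψ.continuous, ?_, ?_, hψ0⟩
  · have := K1.2; have := K2.2
    have : (0:ℝ) ≤ (d + m * K1) := by positivity
    have : (0:ℝ) ≤ (d * 2 + m * |K4|) := by positivity
    have := abs_nonneg K3
    linarith [K2.2]
  · intro x ξ η hξ hη
    have e1 : phs P x ξ - phs P x η = (∑ i, x (Sum.inl i) * (ξ i - η i))
        + ∑ j, x (Sum.inr j) * (P ξ j - P η j) := by
      simp only [phs, mul_sub, Finset.sum_sub_distrib]; ring
    have e2 : |∑ i, x (Sum.inl i) * (ξ i - η i)| ≤ d * (‖x‖ * ‖ξ - η‖) := by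
      refine (Finset.abs_sum_le_sum_abs _ _).trans ?_
      refine (Finset.sum_le_card_nsmul _ _ (‖x‖ * ‖ξ - η‖) ?_).trans (by simp)
      intro i _
      rw [abs_mul]
      exact mul_le_mul (hco _ _) (norm_le_pi_norm (ξ - η) i) (abs_nonneg _) (norm_nonneg _)
    have e3 : |∑ j, x (Sum.inr j) * (P ξ j - P η j)| ≤ m * (‖x‖ * (K1 * ‖ξ - η‖)) := by
      refine (Finset.abs_sum_le_sum_abs _ _).trans ?_
      refine (Finset.sum_le_card_nsmul _ _ (‖x‖ * (K1 * ‖ξ - η‖)) ?_).trans (by simp)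
      intro i _
      rw [abs_mul]
      refine mul_le_mul (hco _ _) ?_ (abs_nonneg _) (norm_nonneg _)
      exact (norm_le_pi_norm (P ξ - P η) i).trans (hK1.norm_sub_le hξ hη)
    rw [e1]
    refine (abs_add_le _ _).trans ((add_le_add e2 e3).trans ?_)
    have h0 : 0 ≤ ‖x‖ * ‖ξ - η‖ := by positivity
    have : (0:ℝ) ≤ (1 + K2 + |K3| + (d * 2 + m * |K4|)) * (‖x‖ * ‖ξ - η‖) := by
      have := K2.2; positivity
    nlinarith
  · intro x ξ hξ
    have e2 : |∑ i, x (Sum.inl i) * ξ i| ≤ d * (‖x‖ * 2) := by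
      refine (Finset.abs_sum_le_sum_abs _ _).trans ?_
      refine (Finset.sum_le_card_nsmul _ _ (‖x‖ * 2) ?_).trans (by simp)
      intro i _
      rw [abs_mul]
      refine mul_le_mul (hco _ _) ?_ (abs_nonneg _) (norm_nonneg _)
      rw [abs_le]
      have h1 := hξ.1 i; have h2 := hξ.2 i
      simp only at h1 h2
      constructor <;> linarith
    have e3 : |∑ j, x (Sum.inr j) * P ξ j| ≤ m * (‖x‖ * |K4|) := by
      refine (Finset.abs_sum_le_sum_abs _ _).trans ?_
      refine (Finset.sum_le_card_nsmul _ _ (‖x‖ * |K4|) ?_).trans (by simp)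
      intro i _
      rw [abs_mul]
      refine mul_le_mul (hco _ _) ?_ (abs_nonneg _) (norm_nonneg _)
      exact (norm_le_pi_norm (P ξ) i).trans ((hK4 ξ hξ).trans (le_abs_self _))
    refine (abs_add_le _ _).trans ((add_le_add e2 e3).trans ?_)
    have : (0:ℝ) ≤ (1 + (d + m * K1) + K2 + |K3|) * ‖x‖ := by
      have := K2.2; have := K1.2; positivity
    nlinarith
  · intro ξ η
    have := hK2.norm_sub_le ξ η
    rw [Real.norm_eq_abs] at this
    refine this.trans (mul_le_mul_of_nonneg_right ?_ (norm_nonneg _))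
    have : (0:ℝ) ≤ 1 + (d + m * K1) + |K3| + (d * 2 + m * |K4|) := by
      have := K1.2; positivity
    linarith
  · intro ξ
    refine (hK3 ξ).trans ((le_abs_self _).trans ?_)
    have : (0:ℝ) ≤ 1 + (d + m * K1) + K2 + (d * 2 + m * |K4|) := by
      have := K1.2; have := K2.2; positivity
    linarith
end basic

section decay
variable {d m : ℕ} {P : (Fin d → ℝ) → (Fin m → ℝ)} {ψ : (Fin d → ℝ) → ℝ} {K : ℝ}

def gau (z : Fin d → ℝ) : ℝ := Real.exp (-(Real.pi * ∑ i, z i ^ 2))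

def iot (m : ℕ) (η : Fin d → ℝ) : erX d m := WithLp.toLp 2 (Sum.elim η 0)

lemma continuous_ee_comp {T : Type*} [TopologicalSpace T] (hP : Continuous P)
    {f : T → erX d m} {g : T → (Fin d → ℝ)} (hf : Continuous f) (hg : Continuous g) :
    Continuous fun z => ee P (f z) (g z) :=
  (continuous_ee hP).comp (hf.prodMk hg)

lemma phs_iot (η ω : Fin d → ℝ) : phs P (iot m η) ω = ∑ i, η i * ω i := by
  simp [phs, iot]

lemma norm_iot (η : Fin d → ℝ) : ‖iot m η‖ ≤ d * ‖η‖ := by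
  rw [EuclideanSpace.norm_eq]
  apply Real.sqrt_le_iff.2
  refine ⟨by positivity, ?_⟩
  simp only [iot, Fintype.sum_sum_type, Sum.elim_inl, Sum.elim_inr, Pi.zero_apply, norm_zero]
  have : ∑ i : Fin d, ‖η i‖ ^ 2 ≤ d * ‖η‖ ^ 2 := by
    refine (Finset.sum_le_card_nsmul _ _ (‖η‖ ^ 2) ?_).trans (by simp)
    intro i _
    have := norm_le_pi_norm η i
    gcongr
  have h2 : (d:ℝ) ≤ (d:ℝ)^2 := by exact_mod_cast Nat.le_self_pow (by norm_num) d
  simp only [ne_eq, OfNat.ofNat_ne_zero, not_false_eq_true, zero_pow, Finset.sum_const_zero,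
    add_zero]
  nlinarith [sq_nonneg ‖η‖]

lemma continuous_iot : Continuous (iot m : (Fin d → ℝ) → erX d m) := by
  unfold iot
  refine (PiLp.continuous_toLp 2 _).comp ?_
  refine continuous_pi fun i => ?_
  rcases i with i | i
  · exact continuous_apply i
  · exact continuous_const

lemma gau_nonneg (z : Fin d → ℝ) : 0 ≤ gau z := (Real.exp_pos _).le

lemma gau_le_one (z : Fin d → ℝ) : gau z ≤ 1 := by
  apply Real.exp_le_one_iff.2
  have : 0 ≤ ∑ i, z i ^ 2 := Finset.sum_nonneg fun i _ => sq_nonneg _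
  have := Real.pi_pos
  nlinarith [mul_nonneg this.le ‹0 ≤ ∑ i, z i ^ 2›]

lemma continuous_gau : Continuous (gau : (Fin d → ℝ) → ℝ) := by unfold gau; fun_prop

lemma gau_fourier (z : Fin d → ℝ) :
    (gau z : ℂ) = ∫ η : Fin d → ℝ, (gau η : ℂ) *
      Complex.exp (2 * Real.pi * Complex.I * ((∑ i, z i * η i : ℝ) : ℂ)) := by
  have h := GaussianFourier.integral_cexp_neg_mul_sum_add (ι := Fin d) (b := (Real.pi : ℂ))
    (by simpa using Real.pi_pos) (fun i => 2 * Real.pi * Complex.I * z i)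
  have hpi : (Real.pi : ℂ) ≠ 0 := by exact_mod_cast Real.pi_ne_zero
  rw [div_self hpi, Complex.one_cpow, one_mul] at h
  have h2 : (gau z : ℂ) = Complex.exp
      ((∑ i, (2 * Real.pi * Complex.I * z i) ^ 2) / (4 * (Real.pi : ℂ))) := by
    rw [gau, Complex.ofReal_exp]; congr 1
    have : ∀ i, (2 * Real.pi * Complex.I * (z i : ℂ)) ^ 2 = -(4 * Real.pi ^2) * (z i : ℂ)^2 := by
      intro i; ring_nf; rw [Complex.I_sq]; ring
    simp_rw [this, ← Finset.mul_sum]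
    push_cast; field_simp
  rw [h2, ← h]
  congr 1; funext η
  rw [gau, Complex.ofReal_exp, ← Complex.exp_add]; congr 1
  push_cast
  simp only [Finset.mul_sum]
  congr 1
  · rw [← Finset.sum_neg_distrib]; exact Finset.sum_congr rfl fun i _ => by ring
  · exact Finset.sum_congr rfl fun i _ => by ring

lemma gau_weight (k : ℝ) (hk : 0 ≤ k) :
    Integrable (fun z : Fin d → ℝ => (1 + ‖z‖) ^ k * gau z) := by
  have h1 : Integrable (fun z : Fin d → ℝ => Real.exp (k ^ 2) * ∏ i, Real.exp (- 1 * z i ^ 2)) := by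
    apply Integrable.const_mul
    exact Integrable.fintype_prod (f := fun _ (x : ℝ) => Real.exp (- 1 * x ^ 2))
      (fun _ => integrable_exp_neg_mul_sq (by norm_num))
  refine h1.mono' ?_ ?_
  · apply Continuous.aestronglyMeasurable
    refine Continuous.mul ?_ continuous_gau
    refine Continuous.rpow_const (by fun_prop) ?_
    intro x; left; positivity
  · refine Filter.Eventually.of_forall fun z => ?_
    rw [Real.norm_of_nonneg (mul_nonneg (by positivity) (gau_nonneg z)), ← Real.exp_sum, gau]
    have h2 : (1 + ‖z‖) ^ k ≤ Real.exp (k ^ 2 + ‖z‖ ^ 2) := by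
      have : (1 + ‖z‖) ^ k ≤ (Real.exp ‖z‖) ^ k := by
        gcongr; linarith [Real.add_one_le_exp ‖z‖]
      refine this.trans ?_
      rw [← Real.exp_mul]
      apply Real.exp_le_exp.2
      nlinarith [sq_nonneg (k - ‖z‖), sq_nonneg k, sq_nonneg ‖z‖]
    have h3 : ‖z‖ ^ 2 ≤ ∑ i, z i ^ 2 := by
      have h0 : 0 ≤ ∑ i, z i ^ 2 := Finset.sum_nonneg fun i _ => sq_nonneg _
      have : ‖z‖ ≤ Real.sqrt (∑ i, z i ^ 2) := by
        refine (pi_norm_le_iff_of_nonneg (Real.sqrt_nonneg _)).2 fun i => ?_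
        apply Real.le_sqrt_of_sq_le
        rw [Real.norm_eq_abs, sq_abs]
        exact Finset.single_le_sum (f := fun i => z i ^ 2) (fun i _ => sq_nonneg _)
          (Finset.mem_univ i)
      calc ‖z‖ ^ 2 ≤ Real.sqrt (∑ i, z i ^ 2) ^ 2 := by gcongr
        _ = _ := Real.sq_sqrt h0
    refine (mul_le_mul_of_nonneg_right h2 (Real.exp_pos _).le).trans ?_
    rw [← Real.exp_add, ← Real.exp_add]
    apply Real.exp_le_exp.2
    have h0 : 0 ≤ ∑ i, z i ^ 2 := Finset.sum_nonneg fun i _ => sq_nonneg _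
    rw [← Finset.mul_sum]
    nlinarith [Real.pi_gt_three]

lemma gau_integrable : Integrable (gau : (Fin d → ℝ) → ℝ) := by
  simpa using gau_weight (d := d) 0 le_rfl

lemma gau_integral : ∫ z : Fin d → ℝ, gau z = 1 := by
  have h := gau_fourier (d := d) 0
  have h1 : gau (0 : Fin d → ℝ) = 1 := by simp [gau]
  simp only [h1, Pi.zero_apply, zero_mul, Finset.sum_const_zero, Complex.ofReal_zero, mul_zero,
    Complex.exp_zero, mul_one, Complex.ofReal_one] at h
  rw [integral_complex_ofReal] at h
  exact_mod_cast h.symm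

lemma Good.ψ_int (H : Good d m P ψ K) : Integrable (fun ω => (ψ ω : ℂ)) := by
  have : Integrable ψ := H.ψc.integrable_of_hasCompactSupport
    (HasCompactSupport.intro (K := erQ d) isCompact_Icc H.ψ0)
  exact this.ofReal

lemma Good.ψ_norm_int (H : Good d m P ψ K) : ∫ ω, |ψ ω| ≤ K * volume.real (erQ d) := by
  rw [← setIntegral_eq_integral_of_forall_compl_eq_zero (s := erQ d)
    (fun ω hω => by rw [H.ψ0 ω hω, abs_zero])]
  have := norm_setIntegral_le_of_norm_le_const (μ := volume) (s := erQ d) (C := K)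
    (f := fun ω => |ψ ω|) (isCompact_Icc.measure_lt_top) (fun ω _ => by simpa using H.ψB ω)
  exact (le_abs_self _).trans this

/-- Peetre -/
lemma peetre (y u : erX d m) (ρ : ℝ) (hρ : 0 < ρ) :
    (1 + ‖y + u‖) ^ (-ρ) ≤ (1 + ‖y‖) ^ (-ρ) * (1 + ‖u‖) ^ ρ := by
  rw [Real.rpow_neg (by positivity), Real.rpow_neg (by positivity), ← div_eq_inv_mul,
    le_div_iff₀ (by positivity), ← div_eq_inv_mul, div_le_iff₀ (by positivity),
    ← Real.mul_rpow (by positivity) (by positivity)]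
  apply Real.rpow_le_rpow (by positivity) _ hρ.le
  have : ‖y‖ ≤ ‖y + u‖ + ‖u‖ := by
    simpa using norm_sub_le (y + u) u
  nlinarith [norm_nonneg (y + u), norm_nonneg u]

lemma Good.inner_decay (H : Good d m P ψ K) {ρ C₀ : ℝ} (hρ : 0 < ρ) (hC0 : 0 ≤ C₀)
    (hdecay : ∀ x : erX d m,
      ‖extGen d m P ψ (fun _ => 1) x‖ ≤ C₀ * (1 + ‖x‖) ^ (-ρ))
    (ε : ℝ) (hε : 0 < ε) (hε1 : ε ≤ 1) (y : erX d m) (v : Fin d → ℝ) :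
    ‖∫ ω, ee P y ω * (ψ ω : ℂ) * (gau (ε⁻¹ • (ω - v)) : ℂ)‖ ≤
      C₀ * (1 + d) ^ ρ * (∫ η : Fin d → ℝ, (1 + ‖η‖) ^ ρ * gau η) *
        (ε ^ (-ρ) * (1 + ‖y‖) ^ (-ρ)) := by
  have hd : ∀ x : erX d m, ‖∫ ω, ee P x ω * (ψ ω : ℂ)‖ ≤ C₀ * (1 + ‖x‖) ^ (-ρ) := by
    intro x
    have := hdecay x
    rw [extGen_eq H.ψ0] at this
    simpa using this
  have e1 : ∀ ω, ee P y ω * (ψ ω : ℂ) * (gau (ε⁻¹ • (ω - v)) : ℂ) =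
      ∫ η : Fin d → ℝ, ((gau η : ℂ) * (starRingEnd ℂ) (ee P (iot m (ε⁻¹ • η)) v)) *
        (ee P (y + iot m (ε⁻¹ • η)) ω * (ψ ω : ℂ)) := by
    intro ω
    rw [gau_fourier, ← integral_const_mul]
    congr 1; funext η
    rw [ee_add, ← ee_neg]
    have : Complex.exp (2 * Real.pi * Complex.I * ((∑ i, (ε⁻¹ • (ω - v)) i * η i : ℝ) : ℂ))
        = ee P (-iot m (ε⁻¹ • η)) v * ee P (iot m (ε⁻¹ • η)) ω := by
      rw [ee, ee, ← Complex.exp_add, phs_neg, phs_iot, phs_iot, ← mul_add]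
      congr 2
      rw [← Complex.ofReal_add]
      congr 1
      rw [← Finset.sum_neg_distrib, ← Finset.sum_add_distrib]
      refine Finset.sum_congr rfl fun i _ => ?_
      simp; ring
    rw [this]; ring
  rw [integral_congr_ae (Filter.Eventually.of_forall e1)]
  have hsm : Continuous fun z : (Fin d → ℝ) × (Fin d → ℝ) => ε⁻¹ • z.2 :=
    continuous_snd.fun_const_smul _
  have hcont1 : Continuous fun z : (Fin d → ℝ) × (Fin d → ℝ) =>
      ee P (y + iot m (ε⁻¹ • z.2)) z.1 := by
    refine continuous_ee_comp H.Pc (continuous_const.add (continuous_iot.comp hsm)) continuous_fst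
  have hcont2 : Continuous fun z : (Fin d → ℝ) × (Fin d → ℝ) =>
      ee P (iot m (ε⁻¹ • z.2)) v := by
    refine continuous_ee_comp H.Pc (continuous_iot.comp hsm) continuous_const
  have hF : Integrable (Function.uncurry fun (ω η : Fin d → ℝ) =>
      ((gau η : ℂ) * (starRingEnd ℂ) (ee P (iot m (ε⁻¹ • η)) v)) *
        (ee P (y + iot m (ε⁻¹ • η)) ω * (ψ ω : ℂ))) (volume.prod volume) := by
    have hb := (H.ψ_int.norm).mul_prod (gau_integrable (d := d))
    refine hb.mono' ?_ ?_
    · apply Continuous.aestronglyMeasurable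
      have h3 := continuous_gau (d := d)
      have h4 := H.ψc
      exact (((Complex.continuous_ofReal.comp (h3.comp continuous_snd))).mul
        (Complex.continuous_conj.comp hcont2)).mul (hcont1.mul
          (Complex.continuous_ofReal.comp (h4.comp continuous_fst)))
    · refine Filter.Eventually.of_forall fun z => ?_
      simp only [Function.uncurry]
      rw [norm_mul, norm_mul, norm_mul, RCLike.norm_conj, norm_ee, norm_ee, Complex.norm_real,
        Real.norm_of_nonneg (gau_nonneg _)]
      exact le_of_eq (by ring)
  rw [integral_integral_swap hF]
  · simp_rw [integral_const_mul]
    have hw := gau_weight (d := d) ρ hρ.le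
    have : C₀ * (1 + d) ^ ρ * (∫ η : Fin d → ℝ, (1 + ‖η‖) ^ ρ * gau η) *
        (ε ^ (-ρ) * (1 + ‖y‖) ^ (-ρ)) = ∫ η : Fin d → ℝ, (C₀ * (1 + d) ^ ρ *
          (ε ^ (-ρ) * (1 + ‖y‖) ^ (-ρ))) * ((1 + ‖η‖) ^ ρ * gau η) := by
      rw [integral_const_mul]; ring
    rw [this]
    refine norm_integral_le_of_norm_le (hw.const_mul _) ?_
    refine Filter.Eventually.of_forall fun η => ?_
    rw [norm_mul, norm_mul, RCLike.norm_conj, norm_ee, mul_one, Complex.norm_real,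
      Real.norm_of_nonneg (gau_nonneg η)]
    refine (mul_le_mul_of_nonneg_left (hd _) (gau_nonneg η)).trans ?_
    have h1 := peetre y (iot m (ε⁻¹ • η)) ρ hρ
    have h2 : (1 + ‖iot m (ε⁻¹ • η)‖) ^ ρ ≤ (1 + d) ^ ρ * ε ^ (-ρ) * (1 + ‖η‖) ^ ρ := by
      rw [Real.rpow_neg hε.le, ← Real.inv_rpow hε.le, ← Real.mul_rpow (by positivity) (by positivity),
        ← Real.mul_rpow (by positivity) (by positivity)]
      apply Real.rpow_le_rpow (by positivity) _ hρ.le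
      have h3 := norm_iot (m := m) (ε⁻¹ • η)
      rw [norm_smul, Real.norm_of_nonneg (by positivity)] at h3
      have h4 : 1 ≤ ε⁻¹ := (one_le_inv₀ hε).2 hε1
      have h5 : (0:ℝ) ≤ d * ε⁻¹ := by positivity
      have h6 : 0 ≤ ε⁻¹ * ‖η‖ := by positivity
      nlinarith [norm_nonneg η]
    calc gau η * (C₀ * (1 + ‖y + iot m (ε⁻¹ • η)‖) ^ (-ρ))
        ≤ gau η * (C₀ * ((1 + ‖y‖) ^ (-ρ) * ((1 + d) ^ ρ * ε ^ (-ρ) * (1 + ‖η‖) ^ ρ))) := by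
          have := gau_nonneg η
          gcongr
          exact h1.trans (by gcongr)
      _ = _ := by ring

lemma Good.decay_lip (H : Good d m P ψ K) {ρ C₀ : ℝ} (hρ : 0 < ρ)
    (hdecay : ∀ x : erX d m,
      ‖extGen d m P ψ (fun _ => 1) x‖ ≤ C₀ * (1 + ‖x‖) ^ (-ρ)) :
    ∃ C : ℝ, 0 ≤ C ∧ ∀ (b : (Fin d → ℝ) → ℝ) (A : ℝ), 0 ≤ A → (∀ ω, |b ω| ≤ A) →
      (∀ ω v, |b ω - b v| ≤ A * ‖ω - v‖) → (∀ ω ∉ erQ d, b ω = 0) →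
      ∀ ε : ℝ, 0 < ε → ε ≤ 1 → ∀ y : erX d m,
        ‖∫ ω, ee P y ω * (ψ ω : ℂ) * (b ω : ℂ)‖ ≤
          C * A * (ε + ε ^ (-(d + ρ)) * (1 + ‖y‖) ^ (-ρ)) := by
  have hC0 : 0 ≤ C₀ := by
    have := (norm_nonneg _).trans (hdecay 0)
    simpa using this
  set W : ℝ := ∫ η : Fin d → ℝ, (1 + ‖η‖) ^ ρ * gau η with hW
  set W1 : ℝ := ∫ η : Fin d → ℝ, (1 + ‖η‖) ^ (1:ℝ) * gau η with hW1
  have hWn : 0 ≤ W := integral_nonneg fun η => mul_nonneg (by positivity) (gau_nonneg _)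
  have hW1n : 0 ≤ W1 := integral_nonneg fun η => mul_nonneg (by positivity) (gau_nonneg _)
  set q := volume.real (erQ d) with hq
  have hqn : 0 ≤ q := measureReal_nonneg
  have hKp : 0 ≤ K := zero_le_one.trans H.hK
  refine ⟨W1 * (K * q) + q * (C₀ * (1 + d) ^ ρ * W), by positivity, ?_⟩
  intro b A hA hbA hbL hb0 ε hε hε1 y
  have hbc : Continuous b := by
    have : LipschitzWith A.toNNReal b := LipschitzWith.of_dist_le_mul fun x y => by
      rw [Real.dist_eq, dist_eq_norm, Real.coe_toNNReal _ hA]; exact hbL x y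
    exact this.continuous
  have hbint : Integrable b := hbc.integrable_of_hasCompactSupport
    (HasCompactSupport.intro (K := erQ d) isCompact_Icc hb0)
  -- mollification
  set be : (Fin d → ℝ) → ℝ := fun ω => ∫ z, b (ω - ε • z) * gau z with hbe
  have hgint : ∀ ω, Integrable fun z => b (ω - ε • z) * gau z := by
    intro ω
    refine (gau_integrable.const_mul A).mono' ?_ ?_
    · have := continuous_gau (d := d)
      exact Continuous.aestronglyMeasurable (by fun_prop)
    · refine Filter.Eventually.of_forall fun z => ?_
      rw [norm_mul, Real.norm_eq_abs, Real.norm_of_nonneg (gau_nonneg z)]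
      exact mul_le_mul_of_nonneg_right (hbA _) (gau_nonneg z)
  have hclose : ∀ ω, |b ω - be ω| ≤ A * ε * W1 := by
    intro ω
    have : b ω - be ω = ∫ z, (b ω - b (ω - ε • z)) * gau z := by
      simp_rw [sub_mul]
      rw [integral_sub (gau_integrable.const_mul _) (hgint ω), integral_const_mul, gau_integral,
        mul_one]
    rw [this, hW1, ← integral_const_mul, ← Real.norm_eq_abs]
    refine norm_integral_le_of_norm_le ((gau_weight 1 zero_le_one).const_mul _) ?_
    refine Filter.Eventually.of_forall fun z => ?_
    rw [norm_mul, Real.norm_eq_abs, Real.norm_of_nonneg (gau_nonneg z), ← mul_assoc]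
    refine mul_le_mul_of_nonneg_right ?_ (gau_nonneg z)
    refine (hbL _ _).trans ?_
    rw [sub_sub_cancel, norm_smul, Real.norm_of_nonneg hε.le, Real.rpow_one, mul_assoc]
    gcongr
    linarith
  have hbe2 : ∀ ω, be ω = (ε ^ d)⁻¹ * ∫ v, b v * gau (ε⁻¹ • (ω - v)) := by
    intro ω
    have h1 := Measure.integral_comp_smul (volume : Measure (Fin d → ℝ))
      (fun u => b (ω - u) * gau (ε⁻¹ • u)) ε
    have h2 := integral_sub_left_eq_self (fun u => b u * gau (ε⁻¹ • (ω - u))) volume ω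
    simp only [sub_sub_cancel] at h2
    rw [h2] at h1
    simp only [smul_smul, inv_mul_cancel₀ hε.ne', one_smul, Module.finrank_fintype_fun_eq_card,
      Fintype.card_fin, smul_eq_mul] at h1
    rw [abs_of_pos (by positivity)] at h1
    exact h1
  have hF : Integrable (Function.uncurry fun (ω v : Fin d → ℝ) =>
      (b v : ℂ) * (ee P y ω * (ψ ω : ℂ) * (gau (ε⁻¹ • (ω - v)) : ℂ))) (volume.prod volume) := by
    have hb := (H.ψ_int.norm).mul_prod (hbint.norm)
    refine hb.mono' ?_ ?_
    · apply Continuous.aestronglyMeasurable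
      have h3 := continuous_gau (d := d)
      have h4 := H.ψc
      have h5 := continuous_ee' H.Pc y
      simp only [Function.uncurry_def]
      fun_prop
    · refine Filter.Eventually.of_forall fun z => ?_
      simp only [Function.uncurry]
      rw [norm_mul, norm_mul, norm_mul, norm_ee, Complex.norm_real, Complex.norm_real,
        Complex.norm_real,
        Real.norm_of_nonneg (gau_nonneg _)]
      have := gau_le_one (ε⁻¹ • (z.1 - z.2))
      have h1 : 0 ≤ ‖b z.2‖ * ‖ψ z.1‖ := by positivity
      nlinarith
  have hI2 : ‖∫ ω, ee P y ω * (ψ ω : ℂ) * (be ω : ℂ)‖ ≤ (ε ^ d)⁻¹ * (A * q *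
      (C₀ * (1 + d) ^ ρ * W * (ε ^ (-ρ) * (1 + ‖y‖) ^ (-ρ)))) := by
    have : ∀ ω, ee P y ω * (ψ ω : ℂ) * (be ω : ℂ) = (ε ^ d : ℂ)⁻¹ *
        ∫ v, (b v : ℂ) * (ee P y ω * (ψ ω : ℂ) * (gau (ε⁻¹ • (ω - v)) : ℂ)) := by
      intro ω
      rw [hbe2, Complex.ofReal_mul, ← integral_complex_ofReal]
      simp_rw [mul_left_comm _ (ee P y ω * (ψ ω : ℂ))]
      rw [integral_const_mul]
      push_cast; ring
    simp_rw [this]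
    rw [integral_const_mul, norm_mul, norm_inv, norm_pow, Complex.norm_real,
      Real.norm_of_nonneg hε.le, integral_integral_swap hF]
    refine mul_le_mul_of_nonneg_left ?_ (by positivity)
    simp_rw [integral_const_mul]
    set B := C₀ * (1 + d) ^ ρ * W * (ε ^ (-ρ) * (1 + ‖y‖) ^ (-ρ)) with hB
    have hBn : 0 ≤ B := by positivity
    rw [← setIntegral_eq_integral_of_forall_compl_eq_zero (s := erQ d)
      (fun ω hω => by rw [hb0 ω hω]; simp)]
    have := norm_setIntegral_le_of_norm_le_const (μ := volume) (s := erQ d) (C := A * B)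
      (f := fun v => (b v : ℂ) * ∫ ω, ee P y ω * (ψ ω : ℂ) * (gau (ε⁻¹ • (ω - v)) : ℂ))
      (isCompact_Icc.measure_lt_top) (fun v _ => by
        rw [norm_mul, Complex.norm_real]
        exact mul_le_mul (hbA v) (H.inner_decay hρ hC0 hdecay ε hε hε1 y v) (norm_nonneg _) hA)
    refine this.trans (le_of_eq ?_)
    ring
  have hbem : Continuous be := by
    refine continuous_of_dominated (bound := fun z => A * gau z) ?_ ?_
      (gau_integrable.const_mul A) ?_
    · intro ω; exact (hgint ω).1
    · intro ω
      refine Filter.Eventually.of_forall fun z => ?_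
      rw [norm_mul, Real.norm_eq_abs, Real.norm_of_nonneg (gau_nonneg z)]
      exact mul_le_mul_of_nonneg_right (hbA _) (gau_nonneg z)
    · refine Filter.Eventually.of_forall fun z => ?_
      fun_prop
  have hIc : ∀ c : (Fin d → ℝ) → ℝ, Continuous c →
      Integrable (fun ω => ee P y ω * (ψ ω : ℂ) * (c ω : ℂ)) := by
    intro c hc
    have h4 := H.ψc
    have h5 := continuous_ee' H.Pc y
    refine Continuous.integrable_of_hasCompactSupport (by fun_prop)
      (HasCompactSupport.intro (K := erQ d) isCompact_Icc fun ω hω => ?_)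
    rw [H.ψ0 ω hω]; simp
  have hI1 : ‖∫ ω, ee P y ω * (ψ ω : ℂ) * ((b ω - be ω : ℝ) : ℂ)‖ ≤ A * ε * W1 * (K * q) := by
    refine (norm_integral_le_of_norm_le (g := fun ω => A * ε * W1 * |ψ ω|) ?_ ?_).trans ?_
    · have := H.ψ_int.norm
      simp only [Complex.norm_real, Real.norm_eq_abs] at this
      exact this.const_mul _
    · refine Filter.Eventually.of_forall fun ω => ?_
      rw [norm_mul, norm_mul, norm_ee, one_mul, Complex.norm_real, Complex.norm_real,
        Real.norm_eq_abs, Real.norm_eq_abs, mul_comm]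
      exact mul_le_mul_of_nonneg_right (hclose ω) (abs_nonneg _)
    · rw [integral_const_mul]
      exact mul_le_mul_of_nonneg_left H.ψ_norm_int (by positivity)
  have hsplit : ∫ ω, ee P y ω * (ψ ω : ℂ) * (b ω : ℂ) =
      (∫ ω, ee P y ω * (ψ ω : ℂ) * ((b ω - be ω : ℝ) : ℂ)) +
      ∫ ω, ee P y ω * (ψ ω : ℂ) * (be ω : ℂ) := by
    rw [← integral_add (hIc (fun ω => b ω - be ω) (hbc.sub hbem)) (hIc be hbem)]
    congr 1; funext ω; push_cast; ring
  rw [hsplit]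
  refine (norm_add_le _ _).trans ((add_le_add hI1 hI2).trans ?_)
  have hpow : ε ^ (-(d + ρ)) = (ε ^ d)⁻¹ * ε ^ (-ρ) := by
    rw [neg_add, Real.rpow_add hε, Real.rpow_neg hε.le, Real.rpow_natCast]
  rw [hpow]
  have t1 : 0 ≤ W1 * (K * q) * A * ((ε ^ d)⁻¹ * ε ^ (-ρ) * (1 + ‖y‖) ^ (-ρ)) := by positivity
  have t2 : 0 ≤ q * (C₀ * (1 + d) ^ ρ * W) * A * ε := by positivity
  nlinarith
end decay

section bess
open Complex in
lemma bessel_two {α ι : Type*} [MeasurableSpace α] (μ : Measure α) [IsProbabilityMeasure μ]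
    (Y : Finset ι) (e : ι → α → ℂ) (he : ∀ i, AEStronglyMeasurable (e i) μ)
    (he1 : ∀ i a, ‖e i a‖ ≤ 1)
    (hgram : ∀ i ∈ Y, ∀ j ∈ Y, i ≠ j →
      ‖∫ a, e i a * (starRingEnd ℂ) (e j a) ∂μ‖ * (Y.card : ℝ) ≤ 1)
    (f : α → ℂ) (hf : MemLp f 2 μ) :
    ∑ i ∈ Y, ‖∫ a, e i a * f a ∂μ‖ ^ 2 ≤ 2 * ∫ a, ‖f a‖ ^ 2 ∂μ := by
  classical
  rcases Y.eq_empty_or_nonempty with rfl | hY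
  · simp; exact integral_nonneg fun a => by positivity
  have hN : (0:ℝ) < Y.card := by exact_mod_cast hY.card_pos
  have hfi : Integrable f μ := hf.integrable (by norm_num)
  have hfsq : Integrable (fun a => ‖f a‖ ^ 2) μ := hf.integrable_norm_pow (by norm_num)
  set c : ι → ℂ := fun i => ∫ a, e i a * f a ∂μ with hc
  have hei : ∀ i, Integrable (fun a => e i a * f a) μ := fun i =>
    hfi.bdd_mul (he i) (Filter.Eventually.of_forall (he1 i))
  have hee : ∀ i j, Integrable (fun a => e i a * (starRingEnd ℂ) (e j a)) μ := fun i j => by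
    refine Integrable.of_bound ((he i).mul (continuous_conj.comp_aestronglyMeasurable (he j))) 1
      (Filter.Eventually.of_forall fun a => ?_)
    rw [norm_mul, RCLike.norm_conj]
    exact mul_le_one₀ (he1 i a) (norm_nonneg _) (he1 j a)
  set S := ∑ i ∈ Y, ‖c i‖ ^ 2 with hS
  have hpt : ∀ a, 0 ≤ ‖f a‖ ^ 2 - (∑ i ∈ Y, (starRingEnd ℂ) (c i) * (e i a * f a)).re
      + (1/4) * (∑ i ∈ Y, ∑ j ∈ Y, (c j * (starRingEnd ℂ) (c i)) *
        (e i a * (starRingEnd ℂ) (e j a))).re := by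
    intro a
    set G := ∑ i ∈ Y, (starRingEnd ℂ) (c i) * e i a with hG
    have h1 : ∑ i ∈ Y, (starRingEnd ℂ) (c i) * (e i a * f a) = G * f a := by
      rw [hG, Finset.sum_mul]; exact Finset.sum_congr rfl fun i _ => by ring
    have h2 : ∑ i ∈ Y, ∑ j ∈ Y, (c j * (starRingEnd ℂ) (c i)) *
        (e i a * (starRingEnd ℂ) (e j a)) = G * (starRingEnd ℂ) G := by
      rw [hG, map_sum, Finset.sum_mul_sum]
      refine Finset.sum_congr rfl fun i _ => Finset.sum_congr rfl fun j _ => ?_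
      simp; ring
    rw [h1, h2, Complex.mul_conj, Complex.ofReal_re, Complex.sq_norm, Complex.normSq_apply,
      Complex.normSq_apply, Complex.mul_re]
    nlinarith [sq_nonneg ((f a).re - G.re / 2), sq_nonneg ((f a).im + G.im / 2)]
  have hI1 : Integrable (fun a => ∑ i ∈ Y, (starRingEnd ℂ) (c i) * (e i a * f a)) μ :=
    integrable_finsetSum _ fun i _ => (hei i).const_mul _
  have hI2 : Integrable (fun a => ∑ i ∈ Y, ∑ j ∈ Y, (c j * (starRingEnd ℂ) (c i)) *
        (e i a * (starRingEnd ℂ) (e j a))) μ :=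
    integrable_finsetSum _ fun i _ => integrable_finsetSum _ fun j _ => (hee i j).const_mul _
  have h0 := integral_nonneg_of_ae (μ := μ) (Filter.Eventually.of_forall hpt)
  have hI1r : Integrable (fun a => (∑ i ∈ Y, (starRingEnd ℂ) (c i) * (e i a * f a)).re) μ := hI1.re
  have hI2r : Integrable (fun a => (∑ i ∈ Y, ∑ j ∈ Y, (c j * (starRingEnd ℂ) (c i)) *
        (e i a * (starRingEnd ℂ) (e j a))).re) μ := hI2.re
  rw [integral_add (hfsq.sub' hI1r) (hI2r.const_mul _), integral_sub hfsq hI1r,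
    integral_const_mul] at h0
  have r1 : ∫ a, (∑ i ∈ Y, (starRingEnd ℂ) (c i) * (e i a * f a)).re ∂μ = S := by
    have := integral_re hI1
    simp only [RCLike.re_to_complex] at this
    rw [this, integral_finsetSum _ fun i _ => (hei i).const_mul _, Complex.re_sum]
    refine Finset.sum_congr rfl fun i _ => ?_
    rw [integral_const_mul]
    change ((starRingEnd ℂ) (c i) * c i).re = _
    rw [← Complex.normSq_eq_conj_mul_self, Complex.ofReal_re, Complex.sq_norm]
  have r2 : ∫ a, (∑ i ∈ Y, ∑ j ∈ Y, (c j * (starRingEnd ℂ) (c i)) *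
        (e i a * (starRingEnd ℂ) (e j a))).re ∂μ ≤ 2 * S := by
    have := integral_re hI2
    simp only [RCLike.re_to_complex] at this
    rw [this, integral_finsetSum _ fun i _ => integrable_finsetSum _ fun j _ =>
      (hee i j).const_mul _]
    refine (Complex.re_le_norm _).trans ((norm_sum_le _ _).trans ?_)
    have hg : ∀ i ∈ Y, ∀ j ∈ Y, ‖∫ a, e i a * (starRingEnd ℂ) (e j a) ∂μ‖ ≤
        (if i = j then 1 else 0) + 1 / (Y.card : ℝ) := by
      intro i hi j hj
      split_ifs with hij
      · have : ‖∫ a, e i a * (starRingEnd ℂ) (e j a) ∂μ‖ ≤ 1 := by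
          have := norm_integral_le_of_norm_le_const (μ := μ) (C := 1)
            (f := fun a => e i a * (starRingEnd ℂ) (e j a)) (Filter.Eventually.of_forall fun a => by
            rw [norm_mul, RCLike.norm_conj]
            exact mul_le_one₀ (he1 i a) (norm_nonneg _) (he1 j a))
          simpa using this
        have h2 : 0 ≤ 1 / (Y.card : ℝ) := by positivity
        linarith
      · rw [zero_add, le_div_iff₀ hN]
        exact hgram i hi j hj hij
    have : ∀ i ∈ Y, ‖∫ a, ∑ j ∈ Y, (c j * (starRingEnd ℂ) (c i)) *
        (e i a * (starRingEnd ℂ) (e j a)) ∂μ‖ ≤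
        ‖c i‖ ^ 2 + ∑ j ∈ Y, ‖c i‖ * ‖c j‖ * (1 / (Y.card : ℝ)) := by
      intro i hi
      rw [integral_finsetSum _ fun j _ => (hee i j).const_mul _]
      refine (norm_sum_le _ _).trans ?_
      have e1 : ‖c i‖ ^ 2 = ∑ j ∈ Y, ‖c i‖ * ‖c j‖ * (if i = j then 1 else 0) := by
        simp [hi, sq]
      rw [e1, ← Finset.sum_add_distrib]
      refine Finset.sum_le_sum fun j hj => ?_
      rw [integral_const_mul, norm_mul, norm_mul, RCLike.norm_conj, ← mul_add, mul_comm ‖c j‖]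
      exact mul_le_mul_of_nonneg_left (hg i hi j hj) (by positivity)
    refine (Finset.sum_le_sum this).trans ?_
    rw [Finset.sum_add_distrib]
    have e2 : ∑ i ∈ Y, ∑ j ∈ Y, ‖c i‖ * ‖c j‖ * (1 / (Y.card : ℝ)) =
        (∑ i ∈ Y, ‖c i‖) ^ 2 * (1 / (Y.card : ℝ)) := by
      rw [sq, Finset.sum_mul_sum, Finset.sum_mul]
      exact Finset.sum_congr rfl fun i _ => by rw [Finset.sum_mul]
    rw [e2]
    have e3 := sq_sum_le_card_mul_sum_sq (s := Y) (f := fun i => ‖c i‖)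
    have e4 : (∑ i ∈ Y, ‖c i‖) ^ 2 * (1 / (Y.card : ℝ)) ≤ S := by
      rw [mul_one_div, div_le_iff₀ hN, mul_comm]; exact e3
    linarith
  rw [r1] at h0
  linarith

lemma bessel_p {α ι : Type*} [MeasurableSpace α] (μ : Measure α) [IsProbabilityMeasure μ]
    (Y : Finset ι) (e : ι → α → ℂ) (he : ∀ i, AEStronglyMeasurable (e i) μ)
    (he1 : ∀ i a, ‖e i a‖ ≤ 1)
    (hgram : ∀ i ∈ Y, ∀ j ∈ Y, i ≠ j →
      ‖∫ a, e i a * (starRingEnd ℂ) (e j a) ∂μ‖ * (Y.card : ℝ) ≤ 1)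
    (f : α → ℂ) (hf : AEStronglyMeasurable f μ) (p : ℝ) (hp : 2 ≤ p) :
    ∑ i ∈ Y, ‖∫ a, e i a * f a ∂μ‖ₑ ^ p ≤ 2 * ∫⁻ a, ‖f a‖ₑ ^ p ∂μ := by
  have hp0 : 0 < p := by linarith
  by_cases htop : ∫⁻ a, ‖f a‖ₑ ^ p ∂μ = ⊤
  · rw [htop]; simp
  have hpE : ENNReal.ofReal p ≠ 0 := by simpa using hp0
  have hnorm : ∫⁻ a, ‖f a‖ₑ ^ p ∂μ = eLpNorm f (ENNReal.ofReal p) μ ^ p := by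
    rw [eLpNorm_eq_lintegral_rpow_enorm_toReal hpE ENNReal.ofReal_ne_top,
      ENNReal.toReal_ofReal hp0.le, ← ENNReal.rpow_mul, one_div, inv_mul_cancel₀ hp0.ne',
      ENNReal.rpow_one]
  set A := eLpNorm f (ENNReal.ofReal p) μ with hA
  have hAtop : A ≠ ⊤ := by
    intro h; rw [hnorm, h, ENNReal.top_rpow_of_pos hp0] at htop; exact htop rfl
  have hmem : MemLp f (ENNReal.ofReal p) μ := ⟨hf, lt_top_iff_ne_top.2 hAtop⟩
  have h2p : (2 : ENNReal) ≤ ENNReal.ofReal p := by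
    rw [show (2:ENNReal) = ENNReal.ofReal 2 by simp]; exact ENNReal.ofReal_le_ofReal hp
  have hmem2 : MemLp f 2 μ := hmem.mono_exponent h2p
  have h1 : ∀ i, ‖∫ a, e i a * f a ∂μ‖ₑ ≤ A := by
    intro i
    refine (enorm_integral_le_lintegral_enorm _).trans ?_
    calc ∫⁻ a, ‖e i a * f a‖ₑ ∂μ ≤ ∫⁻ a, ‖f a‖ₑ ∂μ := by
          refine lintegral_mono fun a => ?_
          rw [enorm_mul]
          refine mul_le_of_le_one_left' ?_
          rw [← ofReal_norm]; exact ENNReal.ofReal_le_one.2 (he1 i a)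
      _ = eLpNorm f 1 μ := eLpNorm_one_eq_lintegral_enorm.symm
      _ ≤ A := eLpNorm_le_eLpNorm_of_exponent_le (by
          refine le_trans ?_ h2p; norm_num) hf
  have h2 : ∑ i ∈ Y, ‖∫ a, e i a * f a ∂μ‖ₑ ^ (2:ℝ) ≤ 2 * A ^ (2:ℝ) := by
    have hb := bessel_two μ Y e he he1 hgram f hmem2
    have hb2 := ENNReal.ofReal_le_ofReal hb
    rw [ENNReal.ofReal_sum_of_nonneg (fun i _ => by positivity),
      ENNReal.ofReal_mul (by norm_num)] at hb2
    have e1 : ENNReal.ofReal (∫ a, ‖f a‖ ^ 2 ∂μ) = eLpNorm f 2 μ ^ (2:ℝ) := by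
      rw [ofReal_integral_eq_lintegral_ofReal (hmem2.integrable_norm_pow (by norm_num))
        (Filter.Eventually.of_forall fun a => by positivity),
        eLpNorm_eq_lintegral_rpow_enorm_toReal (by norm_num) (by norm_num), ← ENNReal.rpow_mul]
      simp
    rw [e1] at hb2
    refine le_trans (le_of_eq ?_) (hb2.trans ?_)
    · refine Finset.sum_congr rfl fun i _ => ?_
      rw [ENNReal.ofReal_pow (norm_nonneg _), ofReal_norm]; norm_cast
    · rw [show ENNReal.ofReal 2 = 2 by simp]
      gcongr
      exact eLpNorm_le_eLpNorm_of_exponent_le h2p hf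
  have h3 : ∀ i, ‖∫ a, e i a * f a ∂μ‖ₑ ^ p ≤ A ^ (p - 2) * ‖∫ a, e i a * f a ∂μ‖ₑ ^ (2:ℝ) := by
    intro i
    calc ‖∫ a, e i a * f a ∂μ‖ₑ ^ p
        = ‖∫ a, e i a * f a ∂μ‖ₑ ^ (p - 2) * ‖∫ a, e i a * f a ∂μ‖ₑ ^ (2:ℝ) := by
          rw [← ENNReal.rpow_add_of_nonneg _ _ (by linarith) (by norm_num)]; congr 1; ring
      _ ≤ _ := by gcongr; exact h1 i
  calc ∑ i ∈ Y, ‖∫ a, e i a * f a ∂μ‖ₑ ^ p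
      ≤ ∑ i ∈ Y, A ^ (p - 2) * ‖∫ a, e i a * f a ∂μ‖ₑ ^ (2:ℝ) := Finset.sum_le_sum fun i _ => h3 i
    _ = A ^ (p - 2) * ∑ i ∈ Y, ‖∫ a, e i a * f a ∂μ‖ₑ ^ (2:ℝ) := by rw [Finset.mul_sum]
    _ ≤ A ^ (p - 2) * (2 * A ^ (2:ℝ)) := by gcongr
    _ = 2 * ∫⁻ a, ‖f a‖ₑ ^ p ∂μ := by
        rw [hnorm, mul_left_comm, ← ENNReal.rpow_add_of_nonneg _ _ (by linarith) (by norm_num)]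
        congr 2; ring
end bess

section kern
variable {d m : ℕ} {P : (Fin d → ℝ) → (Fin m → ℝ)} {ψ : (Fin d → ℝ) → ℝ} {K : ℝ}

def tent (Λ : ℝ) (z : Fin d → ℝ) : ℝ := max 0 (1 - Λ * ‖z‖)

def ker (Λ : ℝ) (z : Fin d → ℝ) : ℝ := tent Λ z / ∫ y : Fin d → ℝ, tent Λ y

lemma tent_nonneg (Λ : ℝ) (z : Fin d → ℝ) : 0 ≤ tent Λ z := le_max_left _ _

lemma tent_le_one (Λ : ℝ) (hΛ : 1 ≤ Λ) (z : Fin d → ℝ) : tent Λ z ≤ 1 := by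
  apply max_le zero_le_one
  have : 0 ≤ Λ * ‖z‖ := by positivity
  linarith

lemma tent_lip (Λ : ℝ) (hΛ : 1 ≤ Λ) (z z' : Fin d → ℝ) :
    |tent Λ z - tent Λ z'| ≤ Λ * ‖z - z'‖ := by
  unfold tent
  rw [max_comm 0, max_comm 0]
  refine (abs_max_sub_max_le_abs (1 - Λ * ‖z‖) (1 - Λ * ‖z'‖) 0).trans ?_
  have : 1 - Λ * ‖z‖ - (1 - Λ * ‖z'‖) = Λ * (‖z'‖ - ‖z‖) := by ring
  rw [this, abs_mul, abs_of_nonneg (by linarith), abs_sub_comm]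
  gcongr
  exact abs_norm_sub_norm_le z z'

lemma tent_zero (Λ : ℝ) (hΛ : 1 ≤ Λ) (z : Fin d → ℝ) (hz : 1 / Λ < ‖z‖) : tent Λ z = 0 := by
  apply max_eq_left
  rw [div_lt_iff₀ (by linarith)] at hz
  linarith

lemma continuous_tent (Λ : ℝ) : Continuous (tent Λ : (Fin d → ℝ) → ℝ) := by
  unfold tent; fun_prop

lemma tent_int (Λ : ℝ) (hΛ : 1 ≤ Λ) : Integrable (tent Λ : (Fin d → ℝ) → ℝ) := by
  refine (continuous_tent Λ).integrable_of_hasCompactSupport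
    (HasCompactSupport.intro (K := Metric.closedBall 0 (1 / Λ)) (isCompact_closedBall _ _) ?_)
  intro z hz
  apply tent_zero Λ hΛ
  simpa using hz

lemma tent_mass (Λ : ℝ) (hΛ : 1 ≤ Λ) :
    1 / (2 * Λ ^ d) ≤ ∫ y : Fin d → ℝ, tent Λ y := by
  have hΛ0 : 0 < Λ := by linarith
  have h1 : ∫ y in Metric.closedBall (0 : Fin d → ℝ) (1 / (2 * Λ)), (1/2 : ℝ) ≤
      ∫ y : Fin d → ℝ, tent Λ y := by
    refine le_trans ?_ (setIntegral_le_integral (s := Metric.closedBall (0 : Fin d → ℝ) (1 / (2 * Λ)))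
      (tent_int Λ hΛ) (Filter.Eventually.of_forall (tent_nonneg Λ)))
    refine setIntegral_mono_on ?_ (tent_int Λ hΛ).integrableOn Metric.isClosed_closedBall.measurableSet ?_
    · exact integrableOn_const (isCompact_closedBall _ _).measure_lt_top.ne
    · intro y hy
      have hy' : ‖y‖ ≤ 1 / (2 * Λ) := by simpa using hy
      refine le_trans ?_ (le_max_right _ _)
      have : Λ * ‖y‖ ≤ Λ * (1 / (2 * Λ)) := by gcongr
      have h2 : Λ * (1 / (2 * Λ)) = 1 / 2 := by field_simp
      linarith
  refine le_trans (le_of_eq ?_) h1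
  rw [setIntegral_const, Measure.real, Real.volume_pi_closedBall _ (by positivity), smul_eq_mul,
    ENNReal.toReal_ofReal (by positivity), Fintype.card_fin]
  have : 2 * (1 / (2 * Λ)) = 1 / Λ := by field_simp
  rw [this, div_pow, one_pow]
  field_simp

lemma tent_mass_pos (Λ : ℝ) (hΛ : 1 ≤ Λ) : 0 < ∫ y : Fin d → ℝ, tent Λ y :=
  lt_of_lt_of_le (by positivity) (tent_mass Λ hΛ)

lemma tent_mass_inv (Λ : ℝ) (hΛ : 1 ≤ Λ) : (∫ y : Fin d → ℝ, tent Λ y)⁻¹ ≤ 2 * Λ ^ d := by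
  have := tent_mass (d := d) Λ hΛ
  rw [one_div] at this
  exact inv_le_of_inv_le₀ (by positivity) this

lemma ker_nonneg (Λ : ℝ) (hΛ : 1 ≤ Λ) (z : Fin d → ℝ) : 0 ≤ ker Λ z :=
  div_nonneg (tent_nonneg _ _) (tent_mass_pos Λ hΛ).le

lemma ker_le (Λ : ℝ) (hΛ : 1 ≤ Λ) (z : Fin d → ℝ) : ker Λ z ≤ 2 * Λ ^ d := by
  rw [ker, div_eq_mul_inv]
  have h := tent_mass_pos (d := d) Λ hΛ
  calc _ ≤ 1 * (∫ y : Fin d → ℝ, tent Λ y)⁻¹ := by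
        gcongr; exact tent_le_one Λ hΛ z
    _ ≤ _ := by rw [one_mul]; exact tent_mass_inv Λ hΛ

lemma ker_lip (Λ : ℝ) (hΛ : 1 ≤ Λ) (z z' : Fin d → ℝ) :
    |ker Λ z - ker Λ z'| ≤ 2 * Λ ^ d * Λ * ‖z - z'‖ := by
  have h := tent_mass_pos (d := d) Λ hΛ
  rw [ker, ker, ← sub_div, abs_div, abs_of_pos h, div_eq_mul_inv]
  calc _ ≤ (Λ * ‖z - z'‖) * (2 * Λ ^ d) :=
        mul_le_mul (tent_lip Λ hΛ z z') (tent_mass_inv Λ hΛ) (by positivity) (by positivity)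
    _ = _ := by ring

lemma ker_zero (Λ : ℝ) (hΛ : 1 ≤ Λ) (z : Fin d → ℝ) (hz : 1 / Λ < ‖z‖) : ker Λ z = 0 := by
  rw [ker, tent_zero Λ hΛ z hz, zero_div]

lemma continuous_ker (Λ : ℝ) : Continuous (ker Λ : (Fin d → ℝ) → ℝ) := by
  have := continuous_tent (d := d) Λ
  unfold ker; fun_prop

lemma ker_int (Λ : ℝ) (hΛ : 1 ≤ Λ) : Integrable (ker Λ : (Fin d → ℝ) → ℝ) :=
  (tent_int Λ hΛ).div_const _

lemma ker_integral (Λ : ℝ) (hΛ : 1 ≤ Λ) : ∫ z : Fin d → ℝ, ker Λ z = 1 := by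
  unfold ker
  rw [integral_div, div_self (tent_mass_pos Λ hΛ).ne']

def wbt (ψ : (Fin d → ℝ) → ℝ) (Λ : ℝ) (ω : Fin d → ℝ) : ℝ := ψ ω / (ψ ω ^ 2 + (1 / Λ) ^ 2)

def wwt (ψ : (Fin d → ℝ) → ℝ) (Λ : ℝ) (ω : Fin d → ℝ) : ℝ := Real.sqrt (ψ ω * wbt ψ Λ ω)

lemma wbt_mul (Λ : ℝ) (ω : Fin d → ℝ) :
    ψ ω * wbt ψ Λ ω = ψ ω ^ 2 / (ψ ω ^ 2 + (1 / Λ) ^ 2) := by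
  rw [wbt]; ring

lemma wwt_sq (Λ : ℝ) (ω : Fin d → ℝ) : wwt ψ Λ ω ^ 2 = ψ ω * wbt ψ Λ ω := by
  rw [wwt, Real.sq_sqrt]
  rw [wbt_mul]; positivity

lemma wwt_nonneg (Λ : ℝ) (ω : Fin d → ℝ) : 0 ≤ wwt ψ Λ ω := Real.sqrt_nonneg _

lemma wwt_le_one (Λ : ℝ) (hΛ : 1 ≤ Λ) (ω : Fin d → ℝ) : wwt ψ Λ ω ≤ 1 := by
  have h : wwt ψ Λ ω ^ 2 ≤ 1 := by
    rw [wwt_sq, wbt_mul, div_le_one (by positivity)]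
    have : (0:ℝ) ≤ (1 / Λ) ^ 2 := by positivity
    linarith
  have := wwt_nonneg (ψ := ψ) Λ ω
  nlinarith

lemma wwt_err (Λ : ℝ) (hΛ : 1 ≤ Λ) (ω : Fin d → ℝ) :
    |ψ ω| * (1 - wwt ψ Λ ω) ≤ 1 / Λ := by
  have hΛ0 : 0 < 1 / Λ := by positivity
  have h1 : 1 - wwt ψ Λ ω ≤ (1 / Λ) ^ 2 / (ψ ω ^ 2 + (1 / Λ) ^ 2) := by
    have h2 : (1 / Λ) ^ 2 / (ψ ω ^ 2 + (1 / Λ) ^ 2) = 1 - wwt ψ Λ ω ^ 2 := by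
      rw [wwt_sq, wbt_mul]; field_simp; ring
    rw [h2]
    nlinarith [wwt_nonneg (ψ := ψ) Λ ω, wwt_le_one (ψ := ψ) Λ hΛ ω]
  refine (mul_le_mul_of_nonneg_left h1 (abs_nonneg _)).trans ?_
  rw [← mul_div_assoc, div_le_iff₀ (by positivity)]
  have h3 : ψ ω ^ 2 = |ψ ω| ^ 2 := (sq_abs _).symm
  rw [h3]
  set t := |ψ ω|
  set δ := 1 / Λ
  have : t * δ ≤ t ^ 2 + δ ^ 2 := by nlinarith [sq_nonneg (t - δ), sq_nonneg t, sq_nonneg δ]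
  nlinarith

lemma wbt_abs (Λ : ℝ) (hΛ : 1 ≤ Λ) (ω : Fin d → ℝ) : |wbt ψ Λ ω| ≤ Λ := by
  have hΛ0 : 0 < Λ := by linarith
  rw [wbt, abs_div, abs_of_pos (show 0 < ψ ω ^ 2 + (1 / Λ) ^ 2 by positivity),
    div_le_iff₀ (by positivity), ← sq_abs (ψ ω)]
  set t := |ψ ω|
  have h : Λ * (t ^ 2 + (1 / Λ) ^ 2) - t = Λ * ((t - 1 / (2 * Λ)) ^ 2 + 3 / (4 * Λ ^ 2)) := by
    field_simp; ring
  have : 0 ≤ Λ * ((t - 1 / (2 * Λ)) ^ 2 + 3 / (4 * Λ ^ 2)) := by positivity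
  linarith

lemma frac_lip (δ : ℝ) (hδ : 0 < δ) (a c : ℝ) :
    |a / (a ^ 2 + δ ^ 2) - c / (c ^ 2 + δ ^ 2)| ≤ |a - c| * (1 / δ) ^ 2 := by
  have ha : 0 < a ^ 2 + δ ^ 2 := by positivity
  have hc : 0 < c ^ 2 + δ ^ 2 := by positivity
  have h : a / (a ^ 2 + δ ^ 2) - c / (c ^ 2 + δ ^ 2) =
      (a - c) * ((δ ^ 2 - a * c) / ((a ^ 2 + δ ^ 2) * (c ^ 2 + δ ^ 2))) := by
    field_simp; ring
  rw [h, abs_mul]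
  refine mul_le_mul_of_nonneg_left ?_ (abs_nonneg _)
  rw [abs_div, abs_of_pos (mul_pos ha hc), div_pow, one_pow, div_le_div_iff₀ (by positivity) (by positivity), one_mul]
  have h2 : |δ ^ 2 - a * c| ≤ δ ^ 2 + (a ^ 2 + c ^ 2) := by
    rw [abs_le]; constructor <;> nlinarith [sq_nonneg (a - c), sq_nonneg (a + c), sq_nonneg δ]
  have h3 : 0 ≤ a ^ 2 * c ^ 2 := by positivity
  nlinarith [sq_nonneg δ]

lemma Good.wbt_lip (H : Good d m P ψ K) (Λ : ℝ) (hΛ : 1 ≤ Λ) (ω v : Fin d → ℝ) :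
    |wbt ψ Λ ω - wbt ψ Λ v| ≤ K * Λ ^ 2 * ‖ω - v‖ := by
  unfold wbt
  refine (frac_lip (1 / Λ) (by positivity) _ _).trans ?_
  rw [one_div_one_div]
  have := H.ψL ω v
  calc _ ≤ K * ‖ω - v‖ * Λ ^ 2 := by gcongr
    _ = _ := by ring

lemma Good.continuous_wwt (H : Good d m P ψ K) (Λ : ℝ) (hΛ : 1 ≤ Λ) : Continuous (wwt ψ Λ) := by
  unfold wwt wbt
  have := H.ψc
  refine Real.continuous_sqrt.comp (this.mul (this.div (by fun_prop) ?_))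
  intro ω; positivity

/-- local averaging measure -/
def avg (Λ : ℝ) (ξ : Fin d → ℝ) : Measure (Fin d → ℝ) :=
  volume.withDensity fun ω => ENNReal.ofReal (ker Λ (ξ - ω))

lemma measurable_kd (Λ : ℝ) (ξ : Fin d → ℝ) :
    Measurable fun ω => ENNReal.ofReal (ker Λ (ξ - ω)) := by
  have := continuous_ker (d := d) Λ
  exact ENNReal.measurable_ofReal.comp (by fun_prop : Continuous fun ω => ker Λ (ξ - ω)).measurable

lemma avg_prob (Λ : ℝ) (hΛ : 1 ≤ Λ) (ξ : Fin d → ℝ) : IsProbabilityMeasure (avg Λ ξ) := by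
  constructor
  rw [avg, withDensity_apply _ MeasurableSet.univ, Measure.restrict_univ,
    ← ofReal_integral_eq_lintegral_ofReal ((ker_int Λ hΛ).comp_sub_left ξ)
      (Filter.Eventually.of_forall fun ω => ker_nonneg Λ hΛ _),
    integral_sub_left_eq_self (ker Λ) volume ξ, ker_integral Λ hΛ, ENNReal.ofReal_one]

lemma avg_integral (Λ : ℝ) (hΛ : 1 ≤ Λ) (ξ : Fin d → ℝ) (g : (Fin d → ℝ) → ℂ) :
    ∫ ω, g ω ∂(avg Λ ξ) = ∫ ω, (ker Λ (ξ - ω) : ℂ) * g ω := by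
  rw [avg, integral_withDensity_eq_integral_toReal_smul (measurable_kd Λ ξ)
    (Filter.Eventually.of_forall fun _ => ENNReal.ofReal_lt_top)]
  congr 1; funext ω
  rw [ENNReal.toReal_ofReal (ker_nonneg Λ hΛ _)]; simp

lemma Good.gram (H : Good d m P ψ K) {ρ C : ℝ}
    (hC : ∀ (b : (Fin d → ℝ) → ℝ) (A : ℝ), 0 ≤ A → (∀ ω, |b ω| ≤ A) →
      (∀ ω v, |b ω - b v| ≤ A * ‖ω - v‖) → (∀ ω ∉ erQ d, b ω = 0) →
      ∀ ε : ℝ, 0 < ε → ε ≤ 1 → ∀ y : erX d m,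
        ‖∫ ω, ee P y ω * (ψ ω : ℂ) * (b ω : ℂ)‖ ≤
          C * A * (ε + ε ^ (-(d + ρ)) * (1 + ‖y‖) ^ (-ρ)))
    (Λ : ℝ) (hΛ : 1 ≤ Λ) (ε : ℝ) (hε : 0 < ε) (hε1 : ε ≤ 1) (x y : erX d m) (ξ : Fin d → ℝ) :
    ‖∫ ω, (ee P x ω * (wwt ψ Λ ω : ℂ)) * (starRingEnd ℂ) (ee P y ω * (wwt ψ Λ ω : ℂ))
      ∂(avg Λ ξ)‖ ≤
        C * (4 * K * Λ ^ (d + 2)) * (ε + ε ^ (-(d + ρ)) * (1 + ‖x - y‖) ^ (-ρ)) := by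
  have hK := H.hK
  rw [avg_integral Λ hΛ]
  have : ∀ ω, (ker Λ (ξ - ω) : ℂ) * ((ee P x ω * (wwt ψ Λ ω : ℂ)) *
      (starRingEnd ℂ) (ee P y ω * (wwt ψ Λ ω : ℂ))) =
      ee P (x - y) ω * (ψ ω : ℂ) * ((ker Λ (ξ - ω) * wbt ψ Λ ω : ℝ) : ℂ) := by
    intro ω
    rw [map_mul, ← ee_neg, Complex.conj_ofReal, sub_eq_add_neg x y, ee_add]
    have h := wwt_sq (ψ := ψ) Λ ω
    have h' : (wwt ψ Λ ω : ℂ) * (wwt ψ Λ ω : ℂ) = (ψ ω : ℂ) * (wbt ψ Λ ω : ℂ) := by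
      rw [← sq]; exact_mod_cast h
    push_cast
    linear_combination (ker Λ (ξ - ω) : ℂ) * ee P x ω * ee P (-y) ω * h'
  rw [integral_congr_ae (Filter.Eventually.of_forall this)]
  have hk0 := fun z => ker_nonneg (d := d) Λ hΛ z
  have hk1 := fun z => ker_le (d := d) Λ hΛ z
  have hΛp : 0 ≤ Λ ^ d := by positivity
  have hΛd : Λ ^ (d + 2) = Λ ^ d * Λ ^ 2 := pow_add _ _ _
  have hΛ2 : Λ ≤ Λ ^ 2 := by nlinarith
  refine hC _ _ (by positivity) ?_ ?_ ?_ ε hε hε1 (x - y)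
  · intro ω
    rw [abs_mul, abs_of_nonneg (hk0 _)]
    calc _ ≤ (2 * Λ ^ d) * Λ := mul_le_mul (hk1 _) (wbt_abs Λ hΛ ω) (abs_nonneg _) (by positivity)
      _ ≤ 4 * K * Λ ^ (d + 2) := by
        rw [hΛd]
        have : Λ ^ d * Λ ≤ Λ ^ d * Λ ^ 2 := by gcongr
        have h2 : 0 ≤ Λ ^ d * Λ ^ 2 := by positivity
        nlinarith
  · intro ω v
    have e : ker Λ (ξ - ω) * wbt ψ Λ ω - ker Λ (ξ - v) * wbt ψ Λ v =
      ker Λ (ξ - ω) * (wbt ψ Λ ω - wbt ψ Λ v) + (ker Λ (ξ - ω) - ker Λ (ξ - v)) * wbt ψ Λ v := by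
      ring
    rw [e]
    refine (abs_add_le _ _).trans ?_
    rw [abs_mul, abs_mul, abs_of_nonneg (hk0 _)]
    have h1 := ker_lip (d := d) Λ hΛ (ξ - ω) (ξ - v)
    rw [sub_sub_sub_cancel_left, norm_sub_rev] at h1
    have h2 : ker Λ (ξ - ω) * |wbt ψ Λ ω - wbt ψ Λ v| ≤ 2 * Λ ^ d * (K * Λ ^ 2 * ‖ω - v‖) :=
      mul_le_mul (hk1 _) (H.wbt_lip Λ hΛ ω v) (abs_nonneg _) (by positivity)
    have h3 : |ker Λ (ξ - ω) - ker Λ (ξ - v)| * |wbt ψ Λ v| ≤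
        (2 * Λ ^ d * Λ * ‖ω - v‖) * Λ :=
      mul_le_mul h1 (wbt_abs Λ hΛ v) (abs_nonneg _) (by positivity)
    refine (add_le_add h2 h3).trans ?_
    rw [hΛd]
    have h4 : 0 ≤ Λ ^ d * Λ ^ 2 * ‖ω - v‖ := by positivity
    nlinarith
  · intro ω hω
    rw [wbt, H.ψ0 ω hω]; simp
end kern

section sparse
variable {d m : ℕ} {P : (Fin d → ℝ) → (Fin m → ℝ)} {ψ : (Fin d → ℝ) → ℝ} {K : ℝ}

def locT (P : (Fin d → ℝ) → (Fin m → ℝ)) (ψ : (Fin d → ℝ) → ℝ) (Λ : ℝ) (x₀ : erX d m)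
    (f : (Fin d → ℝ) → ℂ) (ξ : Fin d → ℝ) : ℂ :=
  ee P (-x₀) ξ * ∫ ω, (ee P x₀ ω * (wwt ψ Λ ω : ℂ)) * f ω ∂(avg Λ ξ)

lemma Good.u_lip (H : Good d m P ψ K) (z : erX d m) (R : ℝ) (hR : 1 ≤ R) (hz : ‖z‖ ≤ R)
    (ω ξ : Fin d → ℝ) :
    ‖ee P z ω * (ψ ω : ℂ) - ee P z ξ * (ψ ξ : ℂ)‖ ≤ 8 * K ^ 2 * R * ‖ω - ξ‖ := by
  have hK := H.hK
  have hL := H.ψL ω ξ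
  have hKK : K ≤ 8 * K ^ 2 * R := by nlinarith [mul_nonneg (sub_nonneg.2 hR) (sq_nonneg K)]
  have hK8 : K * ‖ω - ξ‖ ≤ 8 * K ^ 2 * R * ‖ω - ξ‖ := by gcongr
  by_cases hω : ω ∈ erQ d
  · by_cases hξ : ξ ∈ erQ d
    · have e : ee P z ω * (ψ ω : ℂ) - ee P z ξ * (ψ ξ : ℂ) =
        ee P z ω * ((ψ ω - ψ ξ : ℝ) : ℂ) + (ee P z ω - ee P z ξ) * (ψ ξ : ℂ) := by
        push_cast; ring
      rw [e]
      refine (norm_add_le _ _).trans ?_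
      rw [norm_mul, norm_mul, norm_ee, one_mul, Complex.norm_real, Complex.norm_real,
        Real.norm_eq_abs, Real.norm_eq_abs]
      have h1 := ee_sub (P := P) z ω ξ
      have h2 := H.PL z ω ξ hω hξ
      have h3 := H.ψB ξ
      have hpi := Real.pi_lt_d2
      have h4 : ‖ee P z ω - ee P z ξ‖ ≤ 7 * K * R * ‖ω - ξ‖ := by
        calc _ ≤ 2 * Real.pi * |phs P z ω - phs P z ξ| := h1
          _ ≤ 7 * (K * ‖z‖ * ‖ω - ξ‖) := by gcongr; linarith
          _ ≤ 7 * (K * R * ‖ω - ξ‖) := by gcongr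
          _ = _ := by ring
      have h5 : ‖ee P z ω - ee P z ξ‖ * |ψ ξ| ≤ 7 * K * R * ‖ω - ξ‖ * K := by gcongr
      have h6 : K * ‖ω - ξ‖ ≤ K ^ 2 * R * ‖ω - ξ‖ := by
        gcongr; nlinarith [mul_nonneg (sub_nonneg.2 hR) (sq_nonneg K)]
      nlinarith
    · rw [H.ψ0 ξ hξ] at hL ⊢
      simp only [Complex.ofReal_zero, mul_zero, sub_zero] at hL ⊢
      rw [norm_mul, norm_ee, one_mul, Complex.norm_real, Real.norm_eq_abs]
      linarith
  · rw [H.ψ0 ω hω] at hL ⊢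
    simp only [Complex.ofReal_zero, mul_zero, zero_sub, abs_neg, norm_neg] at hL ⊢
    rw [norm_mul, norm_ee, one_mul, Complex.norm_real, Real.norm_eq_abs]
    linarith

lemma Good.approx (H : Good d m P ψ K) (Λ : ℝ) (hΛ : 1 ≤ Λ) {f : (Fin d → ℝ) → ℂ}
    (hf : Integrable f) (x₀ x : erX d m) (R : ℝ) (hR : 1 ≤ R) (hx : ‖x - x₀‖ ≤ R) :
    ‖extGen d m P ψ f x - extGen d m P ψ (locT P ψ Λ x₀ f) x‖ ≤
      9 * K ^ 2 * R / Λ * ∫ ω, ‖f ω‖ := by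
  have hK := H.hK
  set u : (Fin d → ℝ) → ℂ := fun ξ => ee P (x - x₀) ξ * (ψ ξ : ℂ) with hu
  set h : (Fin d → ℝ) → ℂ := fun ω => (ee P x₀ ω * (wwt ψ Λ ω : ℂ)) * f ω with hh
  have hec := fun y => continuous_ee' (m := m) H.Pc y
  have hψc := H.ψc
  have hwc := H.continuous_wwt Λ hΛ
  have huc : Continuous u := by
    have := hec (x - x₀); fun_prop
  have hkc := continuous_ker (d := d) Λ
  have hui : Integrable u := by
    refine (H.ψ_int.norm).mono' huc.aestronglyMeasurable (Filter.Eventually.of_forall fun ξ => ?_)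
    simp [hu, norm_ee]
  have hhi : Integrable h := by
    refine hf.norm.mono' ?_ (Filter.Eventually.of_forall fun ξ => ?_)
    · refine AEStronglyMeasurable.mul ?_ hf.1
      have := hec x₀
      exact (by fun_prop : Continuous fun ω => ee P x₀ ω * (wwt ψ Λ ω : ℂ)).aestronglyMeasurable
    · rw [hh]
      simp only [norm_mul, norm_ee, one_mul, Complex.norm_real, Real.norm_eq_abs]
      rw [abs_of_nonneg (wwt_nonneg Λ ξ)]
      exact mul_le_of_le_one_left (norm_nonneg _) (wwt_le_one Λ hΛ ξ)
  have e1 : extGen d m P ψ (locT P ψ Λ x₀ f) x =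
      ∫ ξ, ∫ ω, u ξ * (ker Λ (ξ - ω) : ℂ) * h ω := by
    rw [extGen_eq H.ψ0]
    congr 1; funext ξ
    rw [locT, avg_integral Λ hΛ]
    have : ∀ I : ℂ, ee P x ξ * (ee P (-x₀) ξ * I) * (ψ ξ : ℂ) = u ξ * I := by
      intro I
      simp only [hu, sub_eq_add_neg, ee_add]; ring
    rw [this, ← integral_const_mul]
    congr 1; funext ω
    simp only [hh]; ring
  have hF : Integrable (Function.uncurry fun (ξ ω : Fin d → ℝ) => u ξ * (ker Λ (ξ - ω) : ℂ) * h ω)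
      (volume.prod volume) := by
    have h1 := (hui.mul_prod hhi).bdd_mul (c := 2 * Λ ^ d)
      (f := fun z : (Fin d → ℝ) × (Fin d → ℝ) => (ker Λ (z.1 - z.2) : ℂ))
      (by fun_prop : Continuous fun z : (Fin d → ℝ) × (Fin d → ℝ) =>
        (ker Λ (z.1 - z.2) : ℂ)).aestronglyMeasurable
      (Filter.Eventually.of_forall fun z => by
        rw [Complex.norm_real, Real.norm_eq_abs, abs_of_nonneg (ker_nonneg Λ hΛ _)]
        exact ker_le Λ hΛ _)
    refine h1.congr (Filter.Eventually.of_forall fun z => ?_)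
    simp only [Function.uncurry]; ring
  rw [e1, integral_integral_swap hF, extGen_eq H.ψ0]
  have hki : ∀ ω : Fin d → ℝ, Integrable fun ξ => (ker Λ (ξ - ω) : ℂ) := fun ω =>
    ((ker_int Λ hΛ).comp_sub_right ω).ofReal
  have hkui : ∀ ω : Fin d → ℝ, Integrable fun ξ => (ker Λ (ξ - ω) : ℂ) * u ξ := fun ω => by
    refine hui.bdd_mul (c := 2 * Λ ^ d)
      (by fun_prop : Continuous fun z : (Fin d → ℝ) => (ker Λ (z - ω) : ℂ)).aestronglyMeasurable
      (Filter.Eventually.of_forall fun z => ?_)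
    rw [Complex.norm_real, Real.norm_eq_abs, abs_of_nonneg (ker_nonneg Λ hΛ _)]
    exact ker_le Λ hΛ _
  have hk1 : ∀ ω : Fin d → ℝ, ∫ ξ, (ker Λ (ξ - ω) : ℂ) = 1 := fun ω => by
    rw [integral_complex_ofReal, integral_sub_right_eq_self (ker Λ), ker_integral Λ hΛ]; simp
  have i1 : Integrable fun ω => ee P x ω * f ω * (ψ ω : ℂ) := by
    have := (hf.bdd_mul (c := K) (f := fun ω => ee P x ω * (ψ ω : ℂ))
      (by have := hec x; exact (by fun_prop : Continuous fun ω => ee P x ω * (ψ ω : ℂ)).aestronglyMeasurable)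
      (Filter.Eventually.of_forall fun z => by
        rw [norm_mul, norm_ee, one_mul, Complex.norm_real, Real.norm_eq_abs]; exact H.ψB z))
    refine this.congr (Filter.Eventually.of_forall fun z => ?_)
    simp only; ring
  have i2 : Integrable fun ω => ∫ ξ, u ξ * (ker Λ (ξ - ω) : ℂ) * h ω := hF.integral_prod_right
  rw [← integral_sub i1 i2, mul_comm, ← integral_mul_const]
  refine norm_integral_le_of_norm_le (hf.norm.mul_const _) (Filter.Eventually.of_forall fun ω => ?_)
  have e2 : ee P x ω * f ω * (ψ ω : ℂ) - ∫ ξ, u ξ * (ker Λ (ξ - ω) : ℂ) * h ω =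
      (ee P x₀ ω * f ω) * (u ω * (1 - (wwt ψ Λ ω : ℂ)) + (wwt ψ Λ ω : ℂ) *
        ∫ ξ, (ker Λ (ξ - ω) : ℂ) * (u ω - u ξ)) := by
    have e3 : ∫ ξ, (ker Λ (ξ - ω) : ℂ) * (u ω - u ξ) =
        u ω - ∫ ξ, (ker Λ (ξ - ω) : ℂ) * u ξ := by
      have : (fun ξ => (ker Λ (ξ - ω) : ℂ) * (u ω - u ξ)) =
        fun ξ => (ker Λ (ξ - ω) : ℂ) * u ω - (ker Λ (ξ - ω) : ℂ) * u ξ := by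
        funext ξ; ring
      rw [this, integral_sub ((hki ω).mul_const _) (hkui ω), integral_mul_const, hk1, one_mul]
    have e4 : ∫ ξ, u ξ * (ker Λ (ξ - ω) : ℂ) * h ω =
        (∫ ξ, (ker Λ (ξ - ω) : ℂ) * u ξ) * h ω := by
      rw [← integral_mul_const]; congr 1; funext ξ; ring
    have e5 : ee P x ω = ee P (x - x₀) ω * ee P x₀ ω := by rw [← ee_add]; simp
    rw [e3, e4, e5]
    simp only [hu, hh]; ring
  rw [e2, norm_mul, norm_mul, norm_ee, one_mul]
  refine mul_le_mul_of_nonneg_left ?_ (norm_nonneg _)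
  have b1 : ‖u ω * (1 - (wwt ψ Λ ω : ℂ))‖ ≤ 1 / Λ := by
    have : (1 - (wwt ψ Λ ω : ℂ)) = ((1 - wwt ψ Λ ω : ℝ) : ℂ) := by push_cast; ring
    rw [this, hu]
    simp only [norm_mul, norm_ee, one_mul, Complex.norm_real, Real.norm_eq_abs]
    rw [abs_of_nonneg (sub_nonneg.2 (wwt_le_one Λ hΛ ω))]
    exact wwt_err Λ hΛ ω
  have b2 : ‖∫ ξ, (ker Λ (ξ - ω) : ℂ) * (u ω - u ξ)‖ ≤ 8 * K ^ 2 * R * (1 / Λ) := by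
    have : ∫ ξ, ker Λ (ξ - ω) * (8 * K ^ 2 * R * (1 / Λ)) = 8 * K ^ 2 * R * (1 / Λ) := by
      rw [integral_mul_const, integral_sub_right_eq_self (ker Λ), ker_integral Λ hΛ, one_mul]
    rw [← this]
    refine norm_integral_le_of_norm_le (((ker_int Λ hΛ).comp_sub_right ω).mul_const _)
      (Filter.Eventually.of_forall fun ξ => ?_)
    rw [norm_mul, Complex.norm_real, Real.norm_eq_abs, abs_of_nonneg (ker_nonneg Λ hΛ _)]
    by_cases hz : 1 / Λ < ‖ξ - ω‖
    · rw [ker_zero Λ hΛ _ hz]; simp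
    · refine mul_le_mul_of_nonneg_left ?_ (ker_nonneg Λ hΛ _)
      refine (H.u_lip (x - x₀) R hR hx ω ξ).trans ?_
      rw [norm_sub_rev]
      gcongr
      exact not_lt.1 hz
  refine (norm_add_le _ _).trans ?_
  have b3 : ‖(wwt ψ Λ ω : ℂ) * ∫ ξ, (ker Λ (ξ - ω) : ℂ) * (u ω - u ξ)‖ ≤
      8 * K ^ 2 * R * (1 / Λ) := by
    rw [norm_mul, Complex.norm_real, Real.norm_eq_abs, abs_of_nonneg (wwt_nonneg Λ ω)]
    exact (mul_le_of_le_one_left (norm_nonneg _) (wwt_le_one Λ hΛ ω)).trans b2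
  have b4 : 1 / Λ ≤ K ^ 2 * R * (1 / Λ) := by
    apply le_mul_of_one_le_left (by positivity)
    nlinarith [mul_nonneg (sub_nonneg.2 hR) (sq_nonneg K)]
  have b5 : 9 * K ^ 2 * R / Λ = 8 * K ^ 2 * R * (1 / Λ) + K ^ 2 * R * (1 / Λ) := by ring
  linarith

lemma lintegral_finset_superadd {α ι : Type*} [MeasurableSpace α] (μ : Measure α) (Y : Finset ι)
    (F : ι → α → ENNReal) : ∑ i ∈ Y, ∫⁻ a, F i a ∂μ ≤ ∫⁻ a, ∑ i ∈ Y, F i a ∂μ := by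
  classical
  induction Y using Finset.induction_on with
  | empty => simp
  | insert i s his ih =>
    simp only [Finset.sum_insert his]
    exact (add_le_add_right ih _).trans (le_lintegral_add _ _)

lemma Good.sumT (H : Good d m P ψ K) (Λ : ℝ) (hΛ : 1 ≤ Λ) {f : (Fin d → ℝ) → ℂ}
    (hf : Measurable f) (p : ℝ) (hp : 2 ≤ p) (Y : Finset (erX d m))
    (hgram : ∀ ξ : Fin d → ℝ, ∀ x ∈ Y, ∀ y ∈ Y, x ≠ y →
      ‖∫ ω, (ee P x ω * (wwt ψ Λ ω : ℂ)) * (starRingEnd ℂ) (ee P y ω * (wwt ψ Λ ω : ℂ))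
      ∂(avg Λ ξ)‖ * (Y.card : ℝ) ≤ 1) :
    ∑ x ∈ Y, ∫⁻ ξ, ‖locT P ψ Λ x f ξ‖ₑ ^ p ≤ 2 * ∫⁻ ω, ‖f ω‖ₑ ^ p := by
  refine (lintegral_finset_superadd _ _ _).trans ?_
  have hwc := H.continuous_wwt Λ hΛ
  have hkc := continuous_ker (d := d) Λ
  have h1 : ∀ ξ, ∑ x ∈ Y, ‖locT P ψ Λ x f ξ‖ₑ ^ p ≤
      2 * ∫⁻ ω, ENNReal.ofReal (ker Λ (ξ - ω)) * ‖f ω‖ₑ ^ p := by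
    intro ξ
    have := avg_prob Λ hΛ ξ
    have := bessel_p (avg Λ ξ) Y (fun x ω => ee P x ω * (wwt ψ Λ ω : ℂ))
      (fun x => by
        have := continuous_ee' (m := m) H.Pc x
        exact (by fun_prop : Continuous fun ω => ee P x ω * (wwt ψ Λ ω : ℂ)).aestronglyMeasurable)
      (fun x ω => by
        rw [norm_mul, norm_ee, one_mul, Complex.norm_real, Real.norm_eq_abs,
          abs_of_nonneg (wwt_nonneg Λ ω)]
        exact wwt_le_one Λ hΛ ω)
      (hgram ξ) f hf.aestronglyMeasurable p hp
    have e : ∫⁻ ω, ‖f ω‖ₑ ^ p ∂(avg Λ ξ) =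
        ∫⁻ ω, ENNReal.ofReal (ker Λ (ξ - ω)) * ‖f ω‖ₑ ^ p := by
      rw [avg, lintegral_withDensity_eq_lintegral_mul _ (measurable_kd Λ ξ)
        (by fun_prop)]
      rfl
    rw [e] at this
    refine le_trans (Finset.sum_le_sum fun x _ => ?_) this
    rw [locT, enorm_mul]
    have : ‖ee P (-x) ξ‖ₑ = 1 := by
      rw [← ofReal_norm, norm_ee, ENNReal.ofReal_one]
    rw [this, one_mul]
  refine (lintegral_mono h1).trans ?_
  have hm : Measurable fun z : (Fin d → ℝ) × (Fin d → ℝ) =>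
      ENNReal.ofReal (ker Λ (z.1 - z.2)) * ‖f z.2‖ₑ ^ p := by
    have : Measurable fun z : (Fin d → ℝ) × (Fin d → ℝ) => ker Λ (z.1 - z.2) :=
      (by fun_prop : Continuous _).measurable
    fun_prop
  rw [lintegral_const_mul _ hm.lintegral_prod_right', lintegral_lintegral_swap hm.aemeasurable]
  gcongr with ω
  dsimp only
  rw [lintegral_mul_const _ (by
    have : Measurable fun z : (Fin d → ℝ) => ker Λ (z - ω) :=
      (by fun_prop : Continuous _).measurable
    fun_prop)]
  have : ∫⁻ ξ, ENNReal.ofReal (ker Λ (ξ - ω)) = 1 := by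
    rw [← ofReal_integral_eq_lintegral_ofReal ((ker_int Λ hΛ).comp_sub_right ω)
      (Filter.Eventually.of_forall fun ω => ker_nonneg Λ hΛ _),
      integral_sub_right_eq_self (ker Λ), ker_integral Λ hΛ, ENNReal.ofReal_one]
  rw [this, one_mul]
end sparse

section sparse2
variable {d m : ℕ} {P : (Fin d → ℝ) → (Fin m → ℝ)} {ψ : (Fin d → ℝ) → ℝ} {K : ℝ}

lemma elp_eq {α : Type*} [MeasurableSpace α] {μ : Measure α} (g : α → ℂ) {q : ℝ} (hq : 0 < q) :
    eLpNorm g (ENNReal.ofReal q) μ = (∫⁻ a, ‖g a‖ₑ ^ q ∂μ) ^ (1 / q) := by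
  rw [eLpNorm_eq_lintegral_rpow_enorm_toReal (by simpa using hq) ENNReal.ofReal_ne_top,
    ENNReal.toReal_ofReal hq.le]

lemma elp_pow {α : Type*} [MeasurableSpace α] {μ : Measure α} (g : α → ℂ) {q : ℝ} (hq : 0 < q) :
    eLpNorm g (ENNReal.ofReal q) μ ^ q = ∫⁻ a, ‖g a‖ₑ ^ q ∂μ := by
  rw [elp_eq g hq, ← ENNReal.rpow_mul, one_div, inv_mul_cancel₀ hq.ne', ENNReal.rpow_one]

lemma sum_rpow_le {ι : Type*} (Y : Finset ι) (a : ι → ENNReal) (t : ℝ) (ht : 1 ≤ t) :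
    ∑ i ∈ Y, a i ^ t ≤ (∑ i ∈ Y, a i) ^ t := by
  classical
  induction Y using Finset.induction_on with
  | empty => simp
  | insert i s his ih =>
    simp only [Finset.sum_insert his]
    exact (add_le_add_right ih _).trans (ENNReal.add_rpow_le_rpow_add _ _ ht)

lemma Good.gram_small (H : Good d m P ψ K) {ρ C : ℝ} (hρ : 0 < ρ) (hC0 : 0 ≤ C)
    (hC : ∀ (b : (Fin d → ℝ) → ℝ) (A : ℝ), 0 ≤ A → (∀ ω, |b ω| ≤ A) →
      (∀ ω v, |b ω - b v| ≤ A * ‖ω - v‖) → (∀ ω ∉ erQ d, b ω = 0) →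
      ∀ ε : ℝ, 0 < ε → ε ≤ 1 → ∀ y : erX d m,
        ‖∫ ω, ee P y ω * (ψ ω : ℂ) * (b ω : ℂ)‖ ≤
          C * A * (ε + ε ^ (-(d + ρ)) * (1 + ‖y‖) ^ (-ρ)))
    (N σ : ℕ) (hσ : ((N * (d + 2) + 2 : ℕ) : ℝ) * (d + ρ + 1) ≤ σ * ρ)
    (L : ℝ) (hL : 2 ≤ L) (hLC : 8 * C * K ≤ L) (Y : Finset (erX d m)) (hY : (Y.card : ℝ) ≤ L)
    (x y : erX d m) (hxy : L ^ σ ≤ dist x y) (ξ : Fin d → ℝ) :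
    ‖∫ ω, (ee P x ω * (wwt ψ (L ^ N) ω : ℂ)) *
      (starRingEnd ℂ) (ee P y ω * (wwt ψ (L ^ N) ω : ℂ)) ∂(avg (L ^ N) ξ)‖ * (Y.card : ℝ) ≤ 1 := by
  have hK := H.hK
  have hL0 : 0 < L := by linarith
  set a := N * (d + 2) with ha
  have hLa : (L ^ N) ^ (d + 2) = L ^ a := by rw [← pow_mul]
  have hΛ : 1 ≤ L ^ N := one_le_pow₀ (by linarith)
  set ε : ℝ := 1 / L ^ (a + 2) with hε
  have hε0 : 0 < ε := by positivity
  have hε1 : ε ≤ 1 := by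
    rw [hε, div_le_one (by positivity)]; exact one_le_pow₀ (by linarith)
  have h1 := H.gram hC (L ^ N) hΛ ε hε0 hε1 x y ξ
  have hεr : ε = L ^ (-((a + 2 : ℕ) : ℝ)) := by
    rw [hε, Real.rpow_neg hL0.le, Real.rpow_natCast, one_div]
  have h2 : ε ^ (-(d + ρ)) * (1 + ‖x - y‖) ^ (-ρ) ≤ ε := by
    have h3 : (1 + ‖x - y‖) ^ (-ρ) ≤ L ^ (-(σ * ρ)) := by
      have : L ^ (-(σ * ρ)) = (L ^ σ) ^ (-ρ) := by
        rw [← Real.rpow_natCast, ← Real.rpow_mul hL0.le]; congr 1; ring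
      rw [this]
      apply Real.rpow_le_rpow_of_nonpos (by positivity) _ (by linarith)
      rw [dist_eq_norm] at hxy; linarith
    have h4 : ε ^ (-(d + ρ)) = L ^ (((a + 2 : ℕ) : ℝ) * (d + ρ)) := by
      rw [hεr, ← Real.rpow_mul hL0.le]; congr 1; ring
    rw [h4]
    refine (mul_le_mul_of_nonneg_left h3 (by positivity)).trans ?_
    rw [← Real.rpow_add hL0, hεr]
    apply Real.rpow_le_rpow_of_exponent_le (by linarith)
    nlinarith
  have h5 : C * (4 * K * (L ^ N) ^ (d + 2)) * (ε + ε ^ (-(d + ρ)) * (1 + ‖x - y‖) ^ (-ρ)) ≤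
      8 * C * K / L ^ 2 := by
    rw [hLa]
    calc _ ≤ C * (4 * K * L ^ a) * (ε + ε) := by gcongr
      _ = _ := by rw [hε, pow_add]; field_simp; ring
  calc _ ≤ (8 * C * K / L ^ 2) * L := by gcongr; exact h1.trans h5
    _ = 8 * C * K / L := by field_simp
    _ ≤ 1 := by rw [div_le_one hL0]; exact hLC

/-- `L¹` bound -/
lemma l1_bound (p : ℝ) (hp : 1 ≤ p) {f : (Fin d → ℝ) → ℂ} (hf : Measurable f)
    (hf0 : ∀ ω ∉ erQ d, f ω = 0) (hf1 : ∫⁻ ω, ‖f ω‖ₑ ^ p ≤ 1) :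
    Integrable f ∧ ∫ ω, ‖f ω‖ ≤ (volume (erQ d)).toReal + 1 := by
  have hQ : volume (erQ d) < ⊤ := isCompact_Icc.measure_lt_top
  have hQm : MeasurableSet (erQ d) := measurableSet_Icc
  have h1 : ∫⁻ ω, ‖f ω‖ₑ ≤ volume (erQ d) + 1 := by
    calc ∫⁻ ω, ‖f ω‖ₑ ≤ ∫⁻ ω, ((erQ d).indicator 1 ω + ‖f ω‖ₑ ^ p) := by
          refine lintegral_mono fun ω => ?_
          by_cases hω : ω ∈ erQ d
          · simp only [Set.indicator_of_mem hω, Pi.one_apply]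
            rcases le_total ‖f ω‖ₑ 1 with h | h
            · exact h.trans le_self_add
            · refine le_trans ?_ le_add_self
              simpa using ENNReal.rpow_le_rpow_of_exponent_le h hp
          · simp [hf0 ω hω]
      _ = volume (erQ d) + ∫⁻ ω, ‖f ω‖ₑ ^ p := by
          rw [lintegral_add_right _ (by fun_prop), lintegral_indicator_one hQm]
      _ ≤ _ := by gcongr
  have h2 : volume (erQ d) + 1 < ⊤ := by simp [hQ]
  refine ⟨⟨hf.aestronglyMeasurable, h1.trans_lt h2⟩, ?_⟩
  rw [integral_norm_eq_lintegral_enorm hf.aestronglyMeasurable]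
  refine (ENNReal.toReal_mono h2.ne h1).trans ?_
  rw [ENNReal.toReal_add hQ.ne (by simp)]; simp

lemma Good.sparse (H : Good d m P ψ K) {ρ C₀ : ℝ} (hρ : 0 < ρ)
    (hdecay : ∀ x : EuclideanSpace ℝ (Fin d ⊕ Fin m),
      ‖extGen d m P ψ (fun _ => 1) x‖ ≤ C₀ * (1 + ‖x‖) ^ (-ρ))
    (p q : ℝ) (hp : 2 ≤ p) (hpq : p ≤ q) :
    ∃ (σ : ℕ) (A C1 : ℝ), 2 ≤ A ∧ 0 ≤ C1 ∧ ∀ L, A ≤ L → ∀ Y : Finset (erX d m),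
      (Y.card : ℝ) ≤ L → (∀ x ∈ Y, ∀ y ∈ Y, x ≠ y → L ^ σ ≤ dist x y) →
      ∀ R, 1 ≤ R → R ≤ L → ∀ c, 0 ≤ c →
      (∀ x : erX d m, ∀ g : (Fin d → ℝ) → ℂ, eLpNorm (extGen d m P ψ g) (ENNReal.ofReal q)
        (volume.restrict (Metric.ball x R)) ≤
          ENNReal.ofReal c * eLpNorm g (ENNReal.ofReal p) volume) →
      ∀ f : (Fin d → ℝ) → ℂ, Measurable f → (∀ ω ∉ erQ d, f ω = 0) → ∫⁻ ω, ‖f ω‖ₑ ^ p ≤ 1 →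
      ∑ x ∈ Y, ∫⁻ z in Metric.ball x R, ‖extGen d m P ψ f z‖ₑ ^ q ≤
        ENNReal.ofReal (C1 * (1 + c ^ q)) := by
  obtain ⟨C, hC0, hC⟩ := H.decay_lip hρ hdecay
  have hK := H.hK
  set n := Module.finrank ℝ (erX d m) with hn
  set N := n + 2 with hN
  obtain ⟨σ, hσ⟩ := exists_nat_ge (((N * (d + 2) + 2 : ℕ) : ℝ) * (d + ρ + 1) / ρ)
  rw [div_le_iff₀ hρ] at hσ
  set D : ℝ := (volume (erQ d)).toReal + 1 with hD
  have hD0 : 0 ≤ D := by positivity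
  set v : ℝ := (volume (Metric.ball (0 : erX d m) 1)).toReal with hv
  have hv' : volume (Metric.ball (0 : erX d m) 1) = ENNReal.ofReal v :=
    (ENNReal.ofReal_toReal measure_ball_lt_top.ne).symm
  have hv0 : 0 ≤ v := ENNReal.toReal_nonneg
  set B : ℝ := 9 * K ^ 2 * D with hB
  have hB0 : 0 ≤ B := by positivity
  have hq0 : 0 < q := by linarith
  have hp0 : 0 < p := by linarith
  refine ⟨σ, max 2 (8 * C * K), 2 ^ (q - 1) * (2 ^ (q / p) + v * B ^ q), le_max_left _ _,
    by positivity, ?_⟩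
  intro L hL Y hYc hYs R hR1 hRL c hc hloc f hf hf0 hf1
  have hL2 : 2 ≤ L := (le_max_left _ _).trans hL
  have hLC : 8 * C * K ≤ L := (le_max_right _ _).trans hL
  have hL0 : 0 < L := by linarith
  have hΛ : 1 ≤ L ^ N := one_le_pow₀ (by linarith)
  obtain ⟨hfi, hfD⟩ := l1_bound p (by linarith) hf hf0 hf1
  have hsum := H.sumT (L ^ N) hΛ hf p hp Y (fun ξ x hx y hy hxy =>
    H.gram_small hρ hC0 hC N σ hσ L hL2 hLC Y hYc x y (hYs x hx y hy hxy) ξ)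
  set δ : ℝ := (B / L ^ (n + 1)) ^ q with hδ
  have hδ0 : 0 ≤ δ := by positivity
  have hδ1 : δ ≤ B ^ q / L ^ (n + 1) := by
    rw [hδ, Real.div_rpow hB0 (by positivity)]
    gcongr
    exact Real.self_le_rpow_of_one_le (one_le_pow₀ (by linarith)) (by linarith)
  have key : ∀ x ∈ Y, ∫⁻ z in Metric.ball x R, ‖extGen d m P ψ f z‖ₑ ^ q ≤
      2 ^ (q - 1) * (ENNReal.ofReal c ^ q * (∫⁻ ξ, ‖locT P ψ (L ^ N) x f ξ‖ₑ ^ p) ^ (q / p) +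
        ENNReal.ofReal δ * ENNReal.ofReal (L ^ n * v)) := by
    intro x _
    have h1 : ∀ z ∈ Metric.ball x R, ‖extGen d m P ψ f z‖ₑ ^ q ≤
        2 ^ (q - 1) * (‖extGen d m P ψ (locT P ψ (L ^ N) x f) z‖ₑ ^ q + ENNReal.ofReal δ) := by
      intro z hz
      have h2 := H.approx (L ^ N) hΛ hfi x z R hR1 (by
        rw [← dist_eq_norm]; exact (Metric.mem_ball.1 hz).le)
      have h3 : ‖extGen d m P ψ f z - extGen d m P ψ (locT P ψ (L ^ N) x f) z‖ₑ ≤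
          ENNReal.ofReal (B / L ^ (n + 1)) := by
        rw [← ofReal_norm]
        apply ENNReal.ofReal_le_ofReal
        refine h2.trans ?_
        calc _ ≤ 9 * K ^ 2 * L / L ^ N * D := by gcongr
          _ = B / L ^ (n + 1) := by
            rw [hB, hN, show n + 2 = (n + 1) + 1 from rfl, pow_succ L (n + 1)]; field_simp
      have h4 : ‖extGen d m P ψ f z‖ₑ ≤ ‖extGen d m P ψ (locT P ψ (L ^ N) x f) z‖ₑ +
          ENNReal.ofReal (B / L ^ (n + 1)) := by
        refine le_trans ?_ (add_le_add_right h3 _)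
        refine le_trans (le_of_eq ?_) (enorm_add_le _ _)
        congr 1; ring
      refine (ENNReal.rpow_le_rpow h4 hq0.le).trans ?_
      refine (ENNReal.rpow_add_le_mul_rpow_add_rpow _ _ (by linarith)).trans ?_
      rw [ENNReal.ofReal_rpow_of_nonneg (by positivity) hq0.le]
    refine (setLIntegral_mono' measurableSet_ball h1).trans ?_
    rw [lintegral_const_mul' _ _ (by
      apply ENNReal.rpow_ne_top_of_nonneg (by linarith) (by simp)),
      lintegral_add_right _ measurable_const]
    refine mul_le_mul_right (add_le_add ?_ ?_) _
    · have h5 := ENNReal.rpow_le_rpow (hloc x (locT P ψ (L ^ N) x f)) hq0.le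
      rw [elp_pow _ hq0, ENNReal.mul_rpow_of_nonneg _ _ hq0.le, elp_eq _ hp0,
        ← ENNReal.rpow_mul] at h5
      refine h5.trans (le_of_eq ?_)
      congr 2; ring
    · rw [setLIntegral_const, Measure.addHaar_ball_of_pos volume x (by linarith : 0 < R), hv',
        ← ENNReal.ofReal_mul (by positivity)]
      gcongr
  refine (Finset.sum_le_sum key).trans ?_
  rw [← Finset.mul_sum, Finset.sum_add_distrib, ← Finset.mul_sum, Finset.sum_const, nsmul_eq_mul]
  have k1 : ∑ x ∈ Y, (∫⁻ ξ, ‖locT P ψ (L ^ N) x f ξ‖ₑ ^ p) ^ (q / p) ≤ ENNReal.ofReal (2 ^ (q / p)) := by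
    refine (sum_rpow_le Y _ (q / p) (by rw [le_div_iff₀ hp0]; linarith)).trans ?_
    rw [← ENNReal.ofReal_rpow_of_nonneg (by norm_num) (by positivity)]
    apply ENNReal.rpow_le_rpow _ (by positivity)
    refine hsum.trans ?_
    calc _ ≤ 2 * (1 : ENNReal) := by gcongr
      _ = _ := by simp
  have k2 : (Y.card : ENNReal) * (ENNReal.ofReal δ * ENNReal.ofReal (L ^ n * v)) ≤
      ENNReal.ofReal (v * B ^ q) := by
    rw [← ENNReal.ofReal_natCast, ← ENNReal.ofReal_mul hδ0,
      ← ENNReal.ofReal_mul (Nat.cast_nonneg Y.card)]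
    apply ENNReal.ofReal_le_ofReal
    calc _ ≤ L * (B ^ q / L ^ (n + 1) * (L ^ n * v)) := by gcongr
      _ = _ := by rw [pow_succ]; field_simp
  have k3 : (2 : ENNReal) ^ (q - 1) = ENNReal.ofReal (2 ^ (q - 1)) := by
    rw [← ENNReal.ofReal_rpow_of_nonneg (by norm_num) (by linarith), ENNReal.ofReal_ofNat]
  rw [k3, ENNReal.ofReal_rpow_of_nonneg hc hq0.le]
  calc _ ≤ ENNReal.ofReal (2 ^ (q - 1)) * (ENNReal.ofReal (c ^ q) * ENNReal.ofReal (2 ^ (q / p)) +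
        ENNReal.ofReal (v * B ^ q)) := by gcongr
    _ = ENNReal.ofReal (2 ^ (q - 1) * (c ^ q * 2 ^ (q / p) + v * B ^ q)) := by
      rw [← ENNReal.ofReal_mul (by positivity), ← ENNReal.ofReal_add (by positivity) (by positivity),
        ← ENNReal.ofReal_mul (by positivity)]
    _ ≤ _ := by
      apply ENNReal.ofReal_le_ofReal
      rw [mul_assoc]
      gcongr
      have a1 : (0:ℝ) ≤ 2 ^ (q / p) := by positivity
      have a2 : 0 ≤ v * B ^ q := by positivity
      have a3 : 0 ≤ c ^ q := by positivity
      nlinarith [mul_nonneg a2 a3]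
end sparse2

section comb

lemma exists_sep {α : Type*} [PseudoMetricSpace α] (X : Finset α) (r : ℝ) (hr : 0 < r) :
    ∃ Y ⊆ X, (∀ x ∈ Y, ∀ y ∈ Y, x ≠ y → r ≤ dist x y) ∧ ∀ x ∈ X, ∃ y ∈ Y, dist x y < r := by
  classical
  induction X using Finset.induction_on with
  | empty => exact ⟨∅, by simp, by simp, by simp⟩
  | insert a s has ih =>
    obtain ⟨Y, hYs, hsep, hcov⟩ := ih
    by_cases h : ∃ y ∈ Y, dist a y < r
    · refine ⟨Y, hYs.trans (Finset.subset_insert _ _), hsep, ?_⟩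
      intro x hx
      rcases Finset.mem_insert.1 hx with rfl | hx
      · exact h
      · exact hcov x hx
    · push Not at h
      refine ⟨insert a Y, Finset.insert_subset_insert _ hYs, ?_, ?_⟩
      · intro x hx y hy hxy
        rcases Finset.mem_insert.1 hx with h1 | h1
        · rcases Finset.mem_insert.1 hy with h2 | h2
          · exact absurd (h1.trans h2.symm) hxy
          · rw [h1]; exact h y h2
        · rcases Finset.mem_insert.1 hy with h2 | h2
          · rw [dist_comm, h2]; exact h x h1
          · exact hsep x h1 y h2 hxy
      · intro x hx
        rcases Finset.mem_insert.1 hx with rfl | hx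
        · exact ⟨x, Finset.mem_insert_self _ _, by simpa using hr⟩
        · obtain ⟨y, hy, hxy⟩ := hcov x hx
          exact ⟨y, Finset.mem_insert_of_mem hy, hxy⟩

open Classical in
lemma scale_pigeon {α : Type*} [PseudoMetricSpace α] (X : Finset α) (r : ℕ → ℝ)
    (hr : ∀ k, 0 < r k) (J : ℕ) (hJ : 1 ≤ J) (t : ℝ) (ht : 0 < t) (htJ : t ^ J = X.card) :
    ∃ k < J, ∃ Y ⊆ X, (∀ x ∈ Y, ∀ y ∈ Y, x ≠ y → r (k + 1) ≤ dist x y) ∧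
      (X.card : ℝ) ≤ J * (t * ∑ y ∈ Y, ((X.filter fun z => dist z y < r k).card : ℝ)) := by
  set nn : ℕ → α → ℕ := fun k x => (X.filter fun z => dist z x < r k).card with hnn
  have hex : ∀ x ∈ X, ∃ k ∈ Finset.range J, (nn (k + 1) x : ℝ) ≤ t * nn k x := by
    intro x hx
    by_contra hcon
    push Not at hcon
    have h0 : 1 ≤ nn 0 x := Finset.card_pos.2 ⟨x, by simp [hx, hr 0]⟩
    have hind : ∀ k, k ≤ J → t ^ k ≤ nn k x ∧ (1 ≤ k → t ^ k < nn k x) := by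
      intro k
      induction k with
      | zero => intro _; simpa using h0
      | succ k ih =>
        intro hk
        have h1 := hcon k (Finset.mem_range.2 hk)
        have h2 := (ih (by omega)).1
        have : t ^ (k + 1) < nn (k + 1) x := by
          rw [pow_succ, mul_comm]
          exact (mul_le_mul_of_nonneg_left h2 ht.le).trans_lt h1
        exact ⟨this.le, fun _ => this⟩
    have h3 := (hind J le_rfl).2 hJ
    rw [htJ] at h3
    have h4 : nn J x ≤ X.card := Finset.card_filter_le _ _
    exact absurd h3 (not_lt.2 (by exact_mod_cast h4))
  choose! kk hkk hkn using hex
  have hfib := Finset.card_eq_sum_card_fiberwise (f := kk) (s := X) (t := Finset.range J)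
    (fun x hx => hkk x hx)
  obtain ⟨k, hk, hkc⟩ : ∃ k ∈ Finset.range J,
      (X.card : ℝ) ≤ J * ((X.filter fun x => kk x = k).card : ℝ) := by
    by_contra hcon
    push Not at hcon
    have hne : (Finset.range J).Nonempty := Finset.nonempty_range_iff.2 (by omega)
    have := Finset.sum_lt_sum_of_nonempty hne hcon
    rw [← Finset.mul_sum, Finset.sum_const, Finset.card_range, nsmul_eq_mul] at this
    have h2 : (X.card : ℝ) = ∑ b ∈ Finset.range J, ((X.filter fun x => kk x = b).card : ℝ) := by
      exact_mod_cast hfib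
    rw [← h2] at this
    exact lt_irrefl _ this
  obtain ⟨Y, hY, hsep, hcov⟩ := exists_sep (X.filter fun x => kk x = k) (r (k + 1)) (hr _)
  refine ⟨k, Finset.mem_range.1 hk, Y, hY.trans (Finset.filter_subset _ _), hsep, ?_⟩
  refine hkc.trans (mul_le_mul_of_nonneg_left ?_ (Nat.cast_nonneg _))
  have h1 : (X.filter fun x => kk x = k) ⊆ Y.biUnion fun y => X.filter fun z => dist z y < r (k + 1) := by
    intro x hx
    obtain ⟨y, hy, hxy⟩ := hcov x hx
    exact Finset.mem_biUnion.2 ⟨y, hy, Finset.mem_filter.2 ⟨(Finset.mem_filter.1 hx).1, hxy⟩⟩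
  have h2 : (X.filter fun x => kk x = k).card ≤ ∑ y ∈ Y, nn (k + 1) y :=
    (Finset.card_le_card h1).trans Finset.card_biUnion_le
  rw [Finset.mul_sum]
  calc ((X.filter fun x => kk x = k).card : ℝ) ≤ ∑ y ∈ Y, (nn (k + 1) y : ℝ) := by exact_mod_cast h2
    _ ≤ _ := by
      apply Finset.sum_le_sum
      intro y hy
      have hy' := Finset.mem_filter.1 (hY hy)
      have := hkn y hy'.1
      rw [hy'.2] at this
      exact this

end comb

section count
variable {d m : ℕ} {P : (Fin d → ℝ) → (Fin m → ℝ)} {ψ : (Fin d → ℝ) → ℝ} {K : ℝ}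

set_option maxHeartbeats 600000 in
lemma Good.count (H : Good d m P ψ K) {ρ C₀ : ℝ} (hρ : 0 < ρ)
    (hdecay : ∀ x : EuclideanSpace ℝ (Fin d ⊕ Fin m),
      ‖extGen d m P ψ (fun _ => 1) x‖ ≤ C₀ * (1 + ‖x‖) ^ (-ρ))
    (p q : ℝ) (hp : 2 ≤ p) (hpq : p ≤ q)
    (hlocal : ∀ α : ℝ, 0 < α → α ≤ 1 → ∃ Cα : ℝ, ∀ R : ℝ, 1 ≤ R →
      ∀ c : EuclideanSpace ℝ (Fin d ⊕ Fin m), ∀ f : (Fin d → ℝ) → ℂ,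
        eLpNorm (extGen d m P ψ f) (ENNReal.ofReal q) (volume.restrict (Metric.ball c R)) ≤
          ENNReal.ofReal (Cα * R ^ α) * eLpNorm f (ENNReal.ofReal p) volume)
    (θ : ℝ) (hθ0 : 0 < θ) (hθ1 : θ < 1) :
    ∃ C : ℝ, 0 ≤ C ∧ ∀ f : (Fin d → ℝ) → ℂ, Measurable f → (∀ ω ∉ erQ d, f ω = 0) →
      ∫⁻ ω, ‖f ω‖ₑ ^ p ≤ 1 → ∀ μ : ℝ, 0 ≤ μ → ∀ X : Finset (erX d m),
      (∀ x ∈ X, ∀ y ∈ X, x ≠ y → 2 ≤ dist x y) →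
      (∀ x ∈ X, ENNReal.ofReal μ ≤ ∫⁻ z in Metric.ball x 1, ‖extGen d m P ψ f z‖ₑ ^ q) →
      (X.card : ℝ) ^ θ * μ ≤ C := by
  classical
  obtain ⟨σ₀, A, C1, hA, hC1, hsp⟩ := H.sparse hρ hdecay p q hp hpq
  set σ := σ₀ + 1 with hσ
  set η := (1 - θ) / 2 with hη
  have hη0 : 0 < η := by rw [hη]; linarith
  obtain ⟨J, hJ⟩ := exists_nat_ge (1 / η + 1)
  have hJ1 : 1 ≤ J := by
    have : (1:ℝ) ≤ J := by have : 0 < 1 / η := by positivity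
                           linarith
    exact_mod_cast this
  have hJ0 : (0:ℝ) < J := by exact_mod_cast hJ1
  have hJη : 1 / (J:ℝ) ≤ η := by
    rw [div_le_iff₀ hJ0]
    have : 1 / η ≤ J := by linarith
    rw [div_le_iff₀ hη0] at this; linarith
  set e : ℕ := (2 * σ) ^ J with he
  have hq0 : 0 < q := by linarith
  have he0 : (0:ℝ) < e := by
    have : 0 < e := by positivity
    exact_mod_cast this
  set α := min 1 (η / (q * e)) with hα
  have hα0 : 0 < α := lt_min one_pos (by positivity)
  have hα1 : α ≤ 1 := min_le_left _ _
  have hαη : e * α * q ≤ η := by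
    have : α ≤ η / (q * e) := min_le_right _ _
    rw [le_div_iff₀ (by positivity)] at this
    linarith
  obtain ⟨Cα, hCα⟩ := hlocal α hα0 hα1
  refine ⟨J * (C1 * (1 + |Cα| ^ q)) * (A + 1) ^ η, by positivity, ?_⟩
  intro f hf hf0 hf1 μ hμ X hXs hXμ
  rcases X.eq_empty_or_nonempty with rfl | hXne
  · simp only [Finset.card_empty, Nat.cast_zero, Real.zero_rpow hθ0.ne', zero_mul]; positivity
  set M : ℝ := (X.card : ℝ) with hM
  have hM1 : 1 ≤ M := by
    have := Finset.card_pos.2 hXne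
    rw [hM]; exact_mod_cast this
  have hM0 : 0 < M := by linarith
  set L := A + M with hL
  have hL2 : 2 ≤ L := by linarith
  have hL0 : 0 ≤ L := by linarith
  set r : ℕ → ℝ := fun k => L ^ ((2 * σ) ^ k) with hr
  have hr1 : ∀ k, L ≤ r k := fun k => by
    rw [hr]; exact le_self_pow₀ (by linarith) (by positivity)
  have hr0 : ∀ k, 0 < r k := fun k => by linarith [hr1 k]
  obtain ⟨k, hkJ, Y, hYX, hYs, hcard⟩ := scale_pigeon X r hr0 J hJ1 (M ^ (1 / (J:ℝ)))
    (by positivity) (by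
      rw [← Real.rpow_natCast, ← Real.rpow_mul hM0.le, one_div, inv_mul_cancel₀ hJ0.ne',
        Real.rpow_one])
  have hrk := hr1 k
  set R := r k + 1 with hR
  have hR1 : 1 ≤ R := by linarith
  set Lk := r k ^ 2 with hLk
  have hRLk : R ≤ Lk := by nlinarith
  have hLLk : L ≤ Lk := by nlinarith
  have hloc : ∀ x : erX d m, ∀ g : (Fin d → ℝ) → ℂ, eLpNorm (extGen d m P ψ g) (ENNReal.ofReal q)
        (volume.restrict (Metric.ball x R)) ≤
          ENNReal.ofReal (|Cα| * R ^ α) * eLpNorm g (ENNReal.ofReal p) volume := by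
    intro x g
    refine (hCα R hR1 x g).trans ?_
    gcongr
    exact le_abs_self _
  have hYc : (Y.card : ℝ) ≤ Lk := by
    have : (Y.card : ℝ) ≤ M := by rw [hM]; exact_mod_cast Finset.card_le_card hYX
    linarith
  have hup := hsp Lk (by linarith) Y hYc (fun x hx y hy hxy => by
      refine le_trans ?_ (hYs x hx y hy hxy)
      have : r (k + 1) = Lk ^ σ := by
        simp only [hr, hLk]; rw [← pow_mul, ← pow_mul]; congr 1
      rw [this]
      exact pow_le_pow_right₀ (by linarith) (by omega)) R hR1 hRLk (|Cα| * R ^ α) (by positivity)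
      hloc f hf hf0 hf1
  have hlow : ∀ y ∈ Y, ENNReal.ofReal (((X.filter fun z => dist z y < r k).card : ℝ) * μ) ≤
      ∫⁻ z in Metric.ball y R, ‖extGen d m P ψ f z‖ₑ ^ q := by
    intro y hy
    set Z := X.filter fun z => dist z y < r k with hZ
    have hdis : Set.PairwiseDisjoint (Z : Set (erX d m)) (fun z => Metric.ball z 1) := by
      intro a ha b hb hab
      have := hXs a (Finset.mem_filter.1 ha).1 b (Finset.mem_filter.1 hb).1 hab
      exact Metric.ball_disjoint_ball (by linarith)
    have h1 : ⋃ z ∈ Z, Metric.ball z 1 ⊆ Metric.ball y R := by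
      intro w hw
      simp only [Set.mem_iUnion] at hw
      obtain ⟨z, hz, hw⟩ := hw
      have h2 := (Finset.mem_filter.1 hz).2
      rw [Metric.mem_ball] at hw ⊢
      linarith [dist_triangle w z y]
    refine le_trans ?_ (lintegral_mono_set h1)
    rw [lintegral_biUnion_finset hdis (fun _ _ => measurableSet_ball)]
    refine le_trans ?_ (Finset.sum_le_sum fun z hz => hXμ z (Finset.mem_filter.1 hz).1)
    rw [Finset.sum_const, nsmul_eq_mul, ENNReal.ofReal_mul (Nat.cast_nonneg _),
      ENNReal.ofReal_natCast]
  have hmain : ∑ y ∈ Y, (((X.filter fun z => dist z y < r k).card : ℝ) * μ) ≤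
      C1 * (1 + (|Cα| * R ^ α) ^ q) := by
    have := (Finset.sum_le_sum hlow).trans hup
    rw [← ENNReal.ofReal_sum_of_nonneg (fun y _ => by positivity)] at this
    exact (ENNReal.ofReal_le_ofReal_iff (by positivity)).1 this
  rw [← Finset.sum_mul] at hmain
  set S := ∑ y ∈ Y, ((X.filter fun z => dist z y < r k).card : ℝ) with hS
  have hS0 : 0 ≤ S := Finset.sum_nonneg fun _ _ => Nat.cast_nonneg _
  have hRe : R ≤ L ^ e := by
    refine hRLk.trans ?_
    rw [hLk, hr, ← pow_mul, he]
    apply pow_le_pow_right₀ (by linarith)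
    calc (2 * σ) ^ k * 2 ≤ (2 * σ) ^ k * (2 * σ) := by gcongr; omega
      _ = (2 * σ) ^ (k + 1) := (pow_succ _ _).symm
      _ ≤ _ := Nat.pow_le_pow_right (by omega) hkJ
  have hLη : 1 ≤ L ^ η := Real.one_le_rpow (by linarith) hη0.le
  have hRq : (|Cα| * R ^ α) ^ q ≤ |Cα| ^ q * L ^ η := by
    rw [Real.mul_rpow (abs_nonneg _) (by positivity)]
    gcongr
    calc (R ^ α) ^ q ≤ ((L ^ e) ^ α) ^ q := by gcongr
      _ = L ^ (e * α * q) := by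
        rw [← Real.rpow_natCast, ← Real.rpow_mul hL0, ← Real.rpow_mul hL0, mul_assoc]
      _ ≤ _ := Real.rpow_le_rpow_of_exponent_le (by linarith) hαη
  have hLM : L ^ η ≤ (A + 1) ^ η * M ^ η := by
    rw [← Real.mul_rpow (by linarith) hM0.le]
    apply Real.rpow_le_rpow (by linarith) _ hη0.le
    nlinarith
  have hmain2 : S * μ ≤ C1 * (1 + |Cα| ^ q) * ((A + 1) ^ η * M ^ η) := by
    refine hmain.trans ?_
    rw [mul_assoc]
    gcongr
    calc 1 + (|Cα| * R ^ α) ^ q ≤ L ^ η + |Cα| ^ q * L ^ η := add_le_add hLη hRq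
      _ = (1 + |Cα| ^ q) * L ^ η := by ring
      _ ≤ _ := by gcongr
  have ht : M ^ (1 / (J:ℝ)) ≤ M ^ η := Real.rpow_le_rpow_of_exponent_le hM1 hJη
  have hM3 : M * μ ≤ J * (M ^ η * (C1 * (1 + |Cα| ^ q) * ((A + 1) ^ η * M ^ η))) := by
    calc M * μ ≤ J * (M ^ (1 / (J:ℝ)) * S) * μ := by gcongr
      _ = J * (M ^ (1 / (J:ℝ)) * (S * μ)) := by ring
      _ ≤ _ := mul_le_mul_of_nonneg_left (mul_le_mul ht hmain2 (mul_nonneg hS0 hμ)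
          (Real.rpow_nonneg hM0.le _)) hJ0.le
  have hsplit : M = M ^ θ * (M ^ η * M ^ η) := by
    rw [← Real.rpow_add hM0, ← Real.rpow_add hM0]
    rw [show θ + (η + η) = 1 by rw [hη]; ring, Real.rpow_one]
  have hMη : 0 < M ^ η * M ^ η := by positivity
  refine le_of_mul_le_mul_right ?_ hMη
  calc M ^ θ * μ * (M ^ η * M ^ η) = M ^ θ * (M ^ η * M ^ η) * μ := by ring
    _ = M * μ := by rw [← hsplit]
    _ ≤ _ := hM3
    _ = _ := by ring
end count

section bern
variable {d m : ℕ} {P : (Fin d → ℝ) → (Fin m → ℝ)} {ψ : (Fin d → ℝ) → ℝ} {K : ℝ}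

lemma Good.bernstein (H : Good d m P ψ K) (p q : ℝ) (hp : 1 ≤ p) (hq : 1 ≤ q) :
    ∃ C : ℝ, 0 < C ∧ ∀ f : (Fin d → ℝ) → ℂ, Measurable f → (∀ ω ∉ erQ d, f ω = 0) →
      ∫⁻ ω, ‖f ω‖ₑ ^ p ≤ 1 → ∃ g : (Fin d → ℝ) → ℂ, Measurable g ∧ (∀ ω ∉ erQ d, g ω = 0) ∧
      ∫⁻ ω, ‖g ω‖ₑ ^ p ≤ 1 ∧ ∀ x : erX d m, ‖extGen d m P ψ f x‖ₑ ^ q ≤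
        ENNReal.ofReal C * ∫⁻ z in Metric.ball x 1, ‖extGen d m P ψ g z‖ₑ ^ q := by
  have hK := H.hK
  set r : ℝ := 1 / (16 * K) with hr
  have hr0 : 0 < r := by positivity
  have hr1 : r ≤ 1 := by rw [hr, div_le_one (by positivity)]; linarith
  set B := Metric.ball (0 : erX d m) r with hB
  have hBm : MeasurableSet B := measurableSet_ball
  have hB0 : volume B ≠ 0 := (Metric.measure_ball_pos volume _ hr0).ne'
  have hBt : volume B ≠ ⊤ := measure_ball_lt_top.ne
  set ν : Measure (erX d m) := (volume B)⁻¹ • volume.restrict B with hν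
  have hνp : IsProbabilityMeasure ν := ⟨by
    rw [hν, Measure.smul_apply, Measure.restrict_apply_univ, smul_eq_mul,
      ENNReal.inv_mul_cancel hB0 hBt]⟩
  have hνae : ∀ᵐ y ∂ν, y ∈ B := by
    rw [hν]
    exact Measure.ae_smul_measure (ae_restrict_mem hBm) _
  have hec := continuous_ee (m := m) H.Pc
  set mm : (Fin d → ℝ) → ℂ := fun ω => ∫ y, ee P y ω ∂ν with hmm
  have hee_int : ∀ ω, Integrable (fun y : erX d m => ee P y ω) ν := by
    intro ω
    refine (integrable_const (1:ℝ)).mono' ?_ (Filter.Eventually.of_forall fun y => by rw [norm_ee])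
    exact (hec.comp (by fun_prop : Continuous fun y : erX d m => (y, ω))).aestronglyMeasurable
  have hmm1 : ∀ ω ∈ erQ d, ‖mm ω - 1‖ ≤ 1 / 2 := by
    intro ω hω
    have e1 : mm ω - 1 = ∫ y, (ee P y ω - 1) ∂ν := by
      rw [integral_sub (hee_int ω) (integrable_const _)]; simp [hmm]
    rw [e1]
    refine (norm_integral_le_of_norm_le_const (C := 1 / 2) ?_).trans (by simp)
    filter_upwards [hνae] with y hy
    refine (ee_sub_one y ω).trans ?_
    have h1 := H.PB y ω hω
    have h2 : ‖y‖ ≤ r := by rw [hB, mem_ball_zero_iff] at hy; exact hy.le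
    have hpi := Real.pi_lt_d2
    calc 2 * Real.pi * |phs P y ω| ≤ 8 * (K * r) := by
          gcongr
          · linarith
          · exact h1.trans (by gcongr)
      _ = 1 / 2 := by rw [hr]; field_simp; norm_num
  have hmmh : ∀ ω ∈ erQ d, 1 / 2 ≤ ‖mm ω‖ := by
    intro ω hω
    have h1 := hmm1 ω hω
    have h2 : ‖(1:ℂ)‖ ≤ ‖mm ω‖ + ‖mm ω - 1‖ := by
      have := norm_sub_le (mm ω) (mm ω - 1)
      simpa using this
    rw [norm_one] at h2; linarith
  have hmmm : Measurable mm := by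
    have : StronglyMeasurable (Function.uncurry fun (ω : Fin d → ℝ) (y : erX d m) => ee P y ω) :=
      (hec.comp continuous_swap).stronglyMeasurable
    exact this.integral_prod_right.measurable
  refine ⟨2 ^ q * (volume B)⁻¹.toReal, by
    have : 0 < (volume B)⁻¹.toReal := ENNReal.toReal_pos (by simpa using hBt) (by simpa using hB0)
    positivity, ?_⟩
  intro f hf hf0 hf1
  refine ⟨fun ω => f ω / (2 * mm ω), by fun_prop, fun ω hω => by simp [hf0 ω hω], ?_, ?_⟩
  · refine le_trans (lintegral_mono fun ω => ?_) hf1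
    apply ENNReal.rpow_le_rpow _ (by linarith)
    by_cases hω : ω ∈ erQ d
    · rw [enorm_le_iff_norm_le, norm_div, norm_mul]
      have := hmmh ω hω
      apply div_le_self (norm_nonneg _)
      simp; linarith
    · simp [hf0 ω hω]
  intro x
  set g : (Fin d → ℝ) → ℂ := fun ω => f ω / (2 * mm ω) with hg
  have hgm : Measurable g := by fun_prop
  have hgf : ∀ ω, ‖g ω‖ ≤ ‖f ω‖ := by
    intro ω
    by_cases hω : ω ∈ erQ d
    · rw [hg]; simp only; rw [norm_div, norm_mul]
      have := hmmh ω hω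
      apply div_le_self (norm_nonneg _)
      simp; linarith
    · simp [hg, hf0 ω hω]
  have hfi := (l1_bound p hp hf hf0 hf1).1
  have hgi : Integrable g :=
    hfi.norm.mono' hgm.aestronglyMeasurable (Filter.Eventually.of_forall hgf)
  have hEc := H.extGen_continuous hgi
  have hψc := H.ψc
  have hgψ : Integrable fun ω => g ω * (ψ ω : ℂ) := by
    have := hgi.bdd_mul (c := K) (f := fun ω => (ψ ω : ℂ))
      (by fun_prop : Continuous fun ω => (ψ ω : ℂ)).aestronglyMeasurable
      (Filter.Eventually.of_forall fun z => by
        rw [Complex.norm_real, Real.norm_eq_abs]; exact H.ψB z)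
    exact this.congr (Filter.Eventually.of_forall fun z => by simp only; ring)
  have hF : Integrable (Function.uncurry fun (ω : Fin d → ℝ) (y : erX d m) =>
      ee P (x + y) ω * g ω * (ψ ω : ℂ)) (volume.prod ν) := by
    have h1 := (hgψ.mul_prod (integrable_const (1:ℂ) : Integrable (fun _ => (1:ℂ)) ν)).bdd_mul
      (c := 1) (f := fun z : (Fin d → ℝ) × erX d m => ee P (x + z.2) z.1)
      (hec.comp (by fun_prop : Continuous fun z : (Fin d → ℝ) × erX d m =>
        (x + z.2, z.1))).aestronglyMeasurable
      (Filter.Eventually.of_forall fun z => by rw [norm_ee])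
    refine h1.congr (Filter.Eventually.of_forall fun z => ?_)
    simp only [Function.uncurry]; ring
  have e1 : extGen d m P ψ f x = 2 * ∫ y, extGen d m P ψ g (x + y) ∂ν := by
    have e2 : ∀ y, extGen d m P ψ g (x + y) = ∫ ω, ee P (x + y) ω * g ω * (ψ ω : ℂ) :=
      fun y => extGen_eq H.ψ0 g (x + y)
    rw [integral_congr_ae (Filter.Eventually.of_forall e2), ← integral_integral_swap hF,
      extGen_eq H.ψ0, ← integral_const_mul]
    congr 1; funext ω
    have e3 : ∫ y, ee P (x + y) ω * g ω * (ψ ω : ℂ) ∂ν = ee P x ω * g ω * (ψ ω : ℂ) * mm ω := by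
      rw [hmm, ← integral_const_mul]
      congr 1; funext y; rw [ee_add]; ring
    rw [e3]
    by_cases hω : ω ∈ erQ d
    · have : mm ω ≠ 0 := by
        have := hmmh ω hω
        intro h0; rw [h0] at this; norm_num at this
      simp only [hg]; field_simp
    · simp [hg, hf0 ω hω]
  have hq0 : 0 < q := by linarith
  have hsm : AEStronglyMeasurable (fun y => extGen d m P ψ g (x + y)) ν :=
    (hEc.comp (by fun_prop : Continuous fun y => x + y)).aestronglyMeasurable
  have h2 : ‖∫ y, extGen d m P ψ g (x + y) ∂ν‖ₑ ^ q ≤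
      ∫⁻ y, ‖extGen d m P ψ g (x + y)‖ₑ ^ q ∂ν := by
    rw [← elp_pow _ hq0]
    apply ENNReal.rpow_le_rpow _ hq0.le
    refine (enorm_integral_le_lintegral_enorm _).trans ?_
    rw [← eLpNorm_one_eq_lintegral_enorm]
    exact eLpNorm_le_eLpNorm_of_exponent_le (by simpa using hq) hsm
  rw [e1, enorm_mul, ENNReal.mul_rpow_of_nonneg _ _ hq0.le, ENNReal.ofReal_mul (by positivity),
    ← ENNReal.ofReal_rpow_of_nonneg (by norm_num) hq0.le, ENNReal.ofReal_toReal (by simpa using hB0)]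
  have h3 : ‖(2:ℂ)‖ₑ = ENNReal.ofReal 2 := by rw [← ofReal_norm]; simp
  rw [h3, mul_assoc]
  refine mul_le_mul_right (h2.trans ?_) _
  rw [hν, lintegral_smul_measure, smul_eq_mul]
  refine mul_le_mul_right ?_ _
  rw [← lintegral_indicator hBm, ← lintegral_indicator measurableSet_ball,
    ← lintegral_add_left_eq_self ((Metric.ball x 1).indicator fun z => ‖extGen d m P ψ g z‖ₑ ^ q) x]
  refine lintegral_mono fun y => ?_
  by_cases hy : y ∈ B
  · have : x + y ∈ Metric.ball x 1 := by
      rw [hB, mem_ball_zero_iff] at hy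
      rw [Metric.mem_ball, dist_eq_norm]; simp; linarith
    rw [Set.indicator_of_mem hy, Set.indicator_of_mem this]
  · rw [Set.indicator_of_notMem hy]; exact zero_le
end bern

section weak
variable {d m : ℕ} {P : (Fin d → ℝ) → (Fin m → ℝ)} {ψ : (Fin d → ℝ) → ℝ} {K : ℝ}

lemma sep_cover {α : Type*} [PseudoMetricSpace α] (S : Set α) (r : ℝ) (hr : 0 < r) (N : ℝ)
    (hN : ∀ X : Finset α, (X : Set α) ⊆ S → (∀ x ∈ X, ∀ y ∈ X, x ≠ y → r ≤ dist x y) →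
      (X.card : ℝ) ≤ N) :
    ∃ X : Finset α, (X.card : ℝ) ≤ N ∧ ∀ x ∈ S, ∃ y ∈ X, dist x y < r := by
  classical
  set T : Set ℕ := {k | ∃ X : Finset α, (X : Set α) ⊆ S ∧
    (∀ x ∈ X, ∀ y ∈ X, x ≠ y → r ≤ dist x y) ∧ X.card = k} with hT
  have hne : T.Nonempty := ⟨0, ∅, by simp, by simp, by simp⟩
  have hbd : BddAbove T := by
    refine ⟨⌊N⌋₊, ?_⟩
    rintro k ⟨X, h1, h2, rfl⟩
    exact Nat.le_floor (hN X h1 h2)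
  obtain ⟨X, h1, h2, h3⟩ := Nat.sSup_mem hne hbd
  refine ⟨X, hN X h1 h2, ?_⟩
  intro x hx
  by_contra hcon
  push Not at hcon
  by_cases hxX : x ∈ X
  · have h0 := hcon x hxX
    rw [dist_self] at h0
    linarith
  have hmem : X.card + 1 ∈ T := by
    refine ⟨insert x X, ?_, ?_, Finset.card_insert_of_notMem hxX⟩
    · rw [Finset.coe_insert]; exact Set.insert_subset hx h1
    · intro a ha b hb hab
      rcases Finset.mem_insert.1 ha with h4 | h4
      · rcases Finset.mem_insert.1 hb with h5 | h5
        · exact absurd (h4.trans h5.symm) hab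
        · rw [h4]; exact hcon b h5
      · rcases Finset.mem_insert.1 hb with h5 | h5
        · rw [dist_comm, h5]; exact hcon a h4
        · exact h2 a h4 b h5 hab
  have := le_csSup hbd hmem
  omega

lemma Good.weak (H : Good d m P ψ K) {ρ C₀ : ℝ} (hρ : 0 < ρ)
    (hdecay : ∀ x : EuclideanSpace ℝ (Fin d ⊕ Fin m),
      ‖extGen d m P ψ (fun _ => 1) x‖ ≤ C₀ * (1 + ‖x‖) ^ (-ρ))
    (p q : ℝ) (hp : 2 ≤ p) (hpq : p ≤ q)
    (hlocal : ∀ α : ℝ, 0 < α → α ≤ 1 → ∃ Cα : ℝ, ∀ R : ℝ, 1 ≤ R →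
      ∀ c : EuclideanSpace ℝ (Fin d ⊕ Fin m), ∀ f : (Fin d → ℝ) → ℂ,
        eLpNorm (extGen d m P ψ f) (ENNReal.ofReal q) (volume.restrict (Metric.ball c R)) ≤
          ENNReal.ofReal (Cα * R ^ α) * eLpNorm f (ENNReal.ofReal p) volume)
    (s : ℝ) (hs : q < s) :
    ∃ C : ℝ, 0 ≤ C ∧ ∀ f : (Fin d → ℝ) → ℂ, Measurable f → (∀ ω ∉ erQ d, f ω = 0) →
      ∫⁻ ω, ‖f ω‖ₑ ^ p ≤ 1 → ∀ t : ℝ, 0 < t →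
      volume {x : erX d m | t < ‖extGen d m P ψ f x‖} ≤ ENNReal.ofReal (C * t ^ (-s)) := by
  have hq0 : 0 < q := by linarith
  have hs0 : 0 < s := by linarith
  obtain ⟨CB, hCB, hbern⟩ := H.bernstein p q (by linarith) (by linarith)
  obtain ⟨C1, hC1, hcount⟩ := H.count hρ hdecay p q hp hpq hlocal (q / s) (by positivity)
    (by rw [div_lt_one hs0]; exact hs)
  set v : ℝ := (volume (Metric.ball (0 : erX d m) 2)).toReal with hv
  refine ⟨(C1 * CB) ^ (s / q) * v, by positivity, ?_⟩
  intro f hf hf0 hf1 t ht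
  obtain ⟨g, hg, hg0, hg1, hfg⟩ := hbern f hf hf0 hf1
  have hX : ∀ X : Finset (erX d m), (X : Set (erX d m)) ⊆ {x | t < ‖extGen d m P ψ f x‖} →
      (∀ x ∈ X, ∀ y ∈ X, x ≠ y → (2:ℝ) ≤ dist x y) →
      (X.card : ℝ) ≤ (C1 * CB) ^ (s / q) * t ^ (-s) := by
    intro X hXS hXs
    have h1 := hcount g hg hg0 hg1 (t ^ q / CB) (by positivity) X hXs (fun x hx => by
      have h2 : t < ‖extGen d m P ψ f x‖ := hXS hx
      have h3 : ENNReal.ofReal (t ^ q) ≤ ‖extGen d m P ψ f x‖ₑ ^ q := by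
        rw [← ENNReal.ofReal_rpow_of_nonneg ht.le hq0.le, ← ofReal_norm]
        exact ENNReal.rpow_le_rpow (ENNReal.ofReal_le_ofReal h2.le) hq0.le
      rw [ENNReal.ofReal_div_of_pos hCB]
      refine ENNReal.div_le_of_le_mul' (h3.trans (hfg x)))
    have h4 : (X.card : ℝ) ^ (q / s) ≤ C1 * CB * t ^ (-q) := by
      rw [mul_div_assoc', div_le_iff₀ hCB] at h1
      rw [Real.rpow_neg ht.le, ← div_eq_mul_inv, le_div_iff₀ (by positivity)]
      exact h1
    have h5 := Real.rpow_le_rpow (by positivity) h4 (by positivity : 0 ≤ s / q)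
    rw [← Real.rpow_mul (Nat.cast_nonneg _), Real.mul_rpow (by positivity) (by positivity),
      ← Real.rpow_mul ht.le] at h5
    have e1 : q / s * (s / q) = 1 := by field_simp
    have e2 : -q * (s / q) = -s := by field_simp
    rwa [e1, e2, Real.rpow_one] at h5
  obtain ⟨X, hXc, hXcov⟩ := sep_cover _ 2 (by norm_num) _ hX
  have hsub : {x : erX d m | t < ‖extGen d m P ψ f x‖} ⊆ ⋃ y ∈ X, Metric.ball y 2 := by
    intro x hx
    obtain ⟨y, hy, hxy⟩ := hXcov x hx
    simp only [Set.mem_iUnion]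
    exact ⟨y, hy, hxy⟩
  refine (measure_mono hsub).trans ((measure_biUnion_finset_le _ _).trans ?_)
  have hvol : ∀ y : erX d m, volume (Metric.ball y 2) = ENNReal.ofReal v := by
    intro y
    rw [hv, ENNReal.ofReal_toReal measure_ball_lt_top.ne]
    exact Measure.addHaar_ball_center volume y 2
  simp only [hvol, Finset.sum_const, nsmul_eq_mul]
  rw [← ENNReal.ofReal_natCast, ← ENNReal.ofReal_mul (Nat.cast_nonneg X.card)]
  apply ENNReal.ofReal_le_ofReal
  calc _ ≤ (C1 * CB) ^ (s / q) * t ^ (-s) * v := by gcongr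
    _ = _ := by ring

lemma Good.strong (H : Good d m P ψ K) {ρ C₀ : ℝ} (hρ : 0 < ρ)
    (hdecay : ∀ x : EuclideanSpace ℝ (Fin d ⊕ Fin m),
      ‖extGen d m P ψ (fun _ => 1) x‖ ≤ C₀ * (1 + ‖x‖) ^ (-ρ))
    (p q : ℝ) (hp : 2 ≤ p) (hpq : p ≤ q)
    (hlocal : ∀ α : ℝ, 0 < α → α ≤ 1 → ∃ Cα : ℝ, ∀ R : ℝ, 1 ≤ R →
      ∀ c : EuclideanSpace ℝ (Fin d ⊕ Fin m), ∀ f : (Fin d → ℝ) → ℂ,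
        eLpNorm (extGen d m P ψ f) (ENNReal.ofReal q) (volume.restrict (Metric.ball c R)) ≤
          ENNReal.ofReal (Cα * R ^ α) * eLpNorm f (ENNReal.ofReal p) volume)
    (s : ℝ) (hs : q < s) :
    ∃ C : ENNReal, C ≠ ⊤ ∧ ∀ f : (Fin d → ℝ) → ℂ, Measurable f → (∀ ω ∉ erQ d, f ω = 0) →
      ∫⁻ ω, ‖f ω‖ₑ ^ p ≤ 1 → ∫⁻ x, ‖extGen d m P ψ f x‖ₑ ^ s ≤ C := by
  have hK := H.hK
  have hs0 : 0 < s := by linarith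
  obtain ⟨C, hC, hweak⟩ := H.weak hρ hdecay p q hp hpq hlocal ((q + s) / 2) (by linarith)
  set D : ℝ := K * ((volume (erQ d)).toReal + 1) with hD
  have hD0 : 0 ≤ D := by positivity
  set W := ∫⁻ t in Set.Ioc 0 D, ENNReal.ofReal (C * t ^ ((s - q) / 2 - 1)) with hW
  have hWt : W ≠ ⊤ := by
    have h1 : IntegrableOn (fun t : ℝ => C * t ^ ((s - q) / 2 - 1)) (Set.Ioc 0 D) := by
      apply Integrable.const_mul
      have := (intervalIntegral.intervalIntegrable_rpow' (a := 0) (b := D)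
        (r := (s - q) / 2 - 1) (by linarith))
      rwa [intervalIntegrable_iff_integrableOn_Ioc_of_le hD0] at this
    exact h1.lintegral_lt_top.ne
  refine ⟨ENNReal.ofReal s * W, ENNReal.mul_ne_top ENNReal.ofReal_ne_top hWt, ?_⟩
  intro f hf hf0 hf1
  obtain ⟨hfi, hfD⟩ := l1_bound p (by linarith) hf hf0 hf1
  have hbd : ∀ x, ‖extGen d m P ψ f x‖ ≤ D := fun x =>
    (H.extGen_bound hfi x).trans (by rw [hD]; gcongr)
  have hEc := H.extGen_continuous hfi
  have e1 : ∀ x, ‖extGen d m P ψ f x‖ₑ ^ s = ENNReal.ofReal (‖extGen d m P ψ f x‖ ^ s) := by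
    intro x
    rw [← ofReal_norm, ENNReal.ofReal_rpow_of_nonneg (norm_nonneg _) hs0.le]
  rw [lintegral_congr e1, lintegral_rpow_eq_lintegral_meas_lt_mul volume
    (Filter.Eventually.of_forall fun x => norm_nonneg _) hEc.norm.aemeasurable hs0]
  gcongr
  have hsplit : Set.Ioi (0:ℝ) = Set.Ioc 0 D ∪ Set.Ioi D := (Set.Ioc_union_Ioi_eq_Ioi hD0).symm
  rw [hsplit]
  refine (lintegral_union_le _ _ _).trans ?_
  have h0 : ∫⁻ t in Set.Ioi D, volume {x | t < ‖extGen d m P ψ f x‖} *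
      ENNReal.ofReal (t ^ (s - 1)) = 0 := by
    rw [setLIntegral_congr_fun measurableSet_Ioi (g := fun _ => 0)]
    · simp
    · intro t ht
      have : {x : erX d m | t < ‖extGen d m P ψ f x‖} = ∅ := by
        ext x; simp only [Set.mem_setOf_eq, Set.mem_empty_iff_false, iff_false, not_lt]
        exact (hbd x).trans (Set.mem_Ioi.1 ht).le
      simp only [this, measure_empty, zero_mul]
  rw [h0, add_zero]
  refine setLIntegral_mono' measurableSet_Ioc fun t ht => ?_
  have ht0 := ht.1
  calc _ ≤ ENNReal.ofReal (C * t ^ (-((q + s) / 2))) * ENNReal.ofReal (t ^ (s - 1)) := by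
        gcongr; exact hweak f hf hf0 hf1 t ht0
    _ = _ := by
      rw [← ENNReal.ofReal_mul (by positivity), mul_assoc, ← Real.rpow_add ht0]
      congr 3; ring
end weak

section fin
variable {d m : ℕ} {P : (Fin d → ℝ) → (Fin m → ℝ)} {ψ : (Fin d → ℝ) → ℝ} {K : ℝ}

lemma Good.repr (H : Good d m P ψ K) (f : (Fin d → ℝ) → ℂ) :
    (∀ x, extGen d m P ψ f x = 0) ∨ ∃ h : (Fin d → ℝ) → ℂ, Measurable h ∧
      (∀ ω ∉ erQ d, h ω = 0) ∧ (∀ᵐ ω, ‖h ω‖ ≤ ‖f ω‖) ∧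
      ∀ x, extGen d m P ψ f x = extGen d m P ψ h x := by
  by_cases hm : AEStronglyMeasurable (fun ξ => f ξ * (ψ ξ : ℂ)) volume
  · right
    refine ⟨fun ξ => hm.mk _ ξ / (ψ ξ : ℂ), ?_, ?_, ?_, ?_⟩
    · have h1 : Measurable (hm.mk _) := hm.stronglyMeasurable_mk.measurable
      have h2 : Measurable fun ξ => (ψ ξ : ℂ) := (Complex.continuous_ofReal.comp H.ψc).measurable
      exact h1.div h2
    · intro ω hω
      simp [H.ψ0 ω hω]
    · filter_upwards [hm.ae_eq_mk] with ω hω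
      rw [← hω]
      by_cases h0 : (ψ ω : ℂ) = 0
      · simp [h0]
      · rw [mul_div_cancel_right₀ _ h0]
    · intro x
      rw [extGen_eq H.ψ0, extGen_eq H.ψ0]
      apply integral_congr_ae
      filter_upwards [hm.ae_eq_mk] with ω hω
      rw [← hω]
      by_cases h0 : (ψ ω : ℂ) = 0
      · simp [h0]
      · rw [mul_div_cancel_right₀ _ h0]
  · left
    intro x
    rw [extGen_eq H.ψ0]
    apply integral_undef
    intro hi
    apply hm
    have := (continuous_ee' H.Pc (-x)).aestronglyMeasurable (μ := volume).mul hi.1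
    refine this.congr (Filter.Eventually.of_forall fun ξ => ?_)
    simp only [Pi.mul_apply]
    rw [← mul_assoc, ← mul_assoc, ee_neg_mul, one_mul]

lemma Good.final (H : Good d m P ψ K) {p s : ℝ} (hp : 2 ≤ p) (hs : 0 < s) {C : ENNReal}
    (hC : ∀ f : (Fin d → ℝ) → ℂ, Measurable f → (∀ ω ∉ erQ d, f ω = 0) →
      ∫⁻ ω, ‖f ω‖ₑ ^ p ≤ 1 → ∫⁻ x, ‖extGen d m P ψ f x‖ₑ ^ s ≤ C)
    (h : (Fin d → ℝ) → ℂ) (hh : Measurable h) (h0 : ∀ ω ∉ erQ d, h ω = 0)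
    (ht : eLpNorm h (ENNReal.ofReal p) volume ≠ ⊤) :
    eLpNorm (extGen d m P ψ h) (ENNReal.ofReal s) volume ≤
      C ^ (1 / s) * eLpNorm h (ENNReal.ofReal p) volume := by
  have hp0 : 0 < p := by linarith
  by_cases hz : eLpNorm h (ENNReal.ofReal p) volume = 0
  · have h1 : h =ᵐ[volume] 0 :=
      (eLpNorm_eq_zero_iff hh.aestronglyMeasurable (by simpa using hp0)).1 hz
    have h2 : extGen d m P ψ h = 0 := by
      funext x
      rw [extGen_eq H.ψ0]
      have : (fun ξ => ee P x ξ * h ξ * (ψ ξ : ℂ)) =ᵐ[volume] 0 := by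
        filter_upwards [h1] with ξ hξ
        simp [hξ]
      rw [integral_congr_ae this]
      simp
    rw [h2]
    simp
  · set A := eLpNorm h (ENNReal.ofReal p) volume with hA
    have ha : 0 < A.toReal := ENNReal.toReal_pos hz ht
    set c : ℂ := ((A.toReal : ℝ) : ℂ) with hc
    have hc0 : c ≠ 0 := by rw [hc]; exact_mod_cast ha.ne'
    have hce : ‖c‖ₑ = A := by
      rw [hc, ← ofReal_norm, Complex.norm_real, Real.norm_of_nonneg ha.le,
        ENNReal.ofReal_toReal ht]
    let g : (Fin d → ℝ) → ℂ := c⁻¹ • h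
    have hg : h = c • g := by simp [g, smul_smul, hc0]
    have hgA : eLpNorm g (ENNReal.ofReal p) volume = 1 := by
      have h3 : A = ‖c‖ₑ * eLpNorm g (ENNReal.ofReal p) volume := by
        rw [← eLpNorm_const_smul, ← hg]
      rw [hce] at h3
      have h4 : A * 1 = A * eLpNorm g (ENNReal.ofReal p) volume := by rw [mul_one]; exact h3
      exact ((ENNReal.mul_right_inj hz ht).1 h4).symm
    have hE : extGen d m P ψ h = c • extGen d m P ψ g := by
      funext x
      rw [Pi.smul_apply, extGen_eq H.ψ0, extGen_eq H.ψ0, smul_eq_mul, ← integral_const_mul]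
      congr 1
      funext ξ
      rw [hg]
      simp only [Pi.smul_apply, smul_eq_mul]
      ring
    have hint : ∫⁻ ω, ‖g ω‖ₑ ^ p ≤ 1 := by
      rw [elp_eq g hp0] at hgA
      have := congrArg (· ^ p) hgA
      simp only [← ENNReal.rpow_mul, one_div, inv_mul_cancel₀ hp0.ne', ENNReal.rpow_one,
        ENNReal.one_rpow] at this
      exact this.le
    have hfin := hC g (hh.const_smul _) (by intro ω hω; simp [g, h0 ω hω]) hint
    rw [hE, eLpNorm_const_smul, hce, mul_comm, elp_eq _ hs]
    gcongr

end fin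

theorem epsilon_removal (d m : ℕ) (hd : 1 ≤ d) (hm : 1 ≤ m)
    (P : (Fin d → ℝ) → (Fin m → ℝ)) (hP : ContDiff ℝ (⊤ : ℕ∞) P)
    (ψ : (Fin d → ℝ) → ℝ) (hψ : ContDiff ℝ (⊤ : ℕ∞) ψ) (hψc : HasCompactSupport ψ)
    (hψ1 : ∀ ξ ∈ Set.Icc (fun _ => (0:ℝ)) (fun _ => 1), ψ ξ = 1)
    (hψ0 : ∀ ξ ∉ Set.Icc (fun _ => (-1:ℝ)) (fun _ => 2), ψ ξ = 0)
    (p q : ℝ) (hp2 : 2 ≤ p) (hpq : p ≤ q)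
    (ρ C₀ : ℝ) (hρ : 0 < ρ)
    (hdecay : ∀ x : EuclideanSpace ℝ (Fin d ⊕ Fin m),
      ‖extGen d m P ψ (fun _ => 1) x‖ ≤ C₀ * (1 + ‖x‖) ^ (-ρ))
    (hlocal : ∀ α : ℝ, 0 < α → α ≤ 1 → ∃ Cα : ℝ, ∀ R : ℝ, 1 ≤ R →
      ∀ c : EuclideanSpace ℝ (Fin d ⊕ Fin m), ∀ f : (Fin d → ℝ) → ℂ,
        eLpNorm (extGen d m P ψ f) (ENNReal.ofReal q) (volume.restrict (Metric.ball c R)) ≤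
          ENNReal.ofReal (Cα * R ^ α) * eLpNorm f (ENNReal.ofReal p) volume)
    (s : ℝ) (hs : q < s) :
    ∃ C : ℝ, ∀ f : (Fin d → ℝ) → ℂ,
      eLpNorm (extGen d m P ψ f) (ENNReal.ofReal s) volume ≤
        ENNReal.ofReal C * eLpNorm f (ENNReal.ofReal p) volume := by
  obtain ⟨K, H⟩ := exists_good (d := d) (m := m) hP hψ hψc hψ0
  obtain ⟨C, hCt, hC⟩ := H.strong hρ hdecay p q hp2 hpq hlocal s hs
  have hs0 : 0 < s := by linarith
  have hCs : C ^ (1 / s) ≠ ⊤ := ENNReal.rpow_ne_top_of_nonneg (by positivity) hCt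
  refine ⟨(C ^ (1 / s)).toReal + 1, fun f => ?_⟩
  have hle : C ^ (1 / s) ≤ ENNReal.ofReal ((C ^ (1 / s)).toReal + 1) := by
    rw [ENNReal.le_ofReal_iff_toReal_le hCs (by positivity)]
    linarith
  have hpos : ENNReal.ofReal ((C ^ (1 / s)).toReal + 1) ≠ 0 := by
    have : 0 < (C ^ (1 / s)).toReal + 1 := by positivity
    simpa using this
  by_cases ht : eLpNorm f (ENNReal.ofReal p) volume = ⊤
  · rw [ht, ENNReal.mul_top hpos]
    exact le_top
  rcases H.repr f with h | ⟨h, hh, h0, hhf, hE⟩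
  · have : extGen d m P ψ f = 0 := funext h
    rw [this]
    simp
  · have hmono : eLpNorm h (ENNReal.ofReal p) volume ≤ eLpNorm f (ENNReal.ofReal p) volume :=
      eLpNorm_mono_ae hhf
    have hE' : extGen d m P ψ f = extGen d m P ψ h := funext hE
    rw [hE']
    exact (H.final hp2 hs0 hC h hh h0 (ne_top_of_le_ne_top ht hmono)).trans
      (mul_le_mul' hle hmono)
end
end

section
/- Let (P, Q) be an irreducible pair of real quadratic forms on ℝ³ satisfying the (CM) condition, let S = {(ξ, P(ξ), Q(ξ)) : ξ ∈ ℝ³}, and let ψ₀ be a smooth compactly supported function with ψ₀ = 1 on [0,1]³ and ψ₀ = 0 outside [−1,2]³. Then there is a constant C (depending on P, Q, ψ₀) such that |∫_{ℝ³} e^{2πi(x'·ξ + x₄P(ξ) + x₅Q(ξ))} ψ₀(ξ) dξ| ≤ C (1 + |x|)^{−1/2} for every x = (x', x₄, x₅) ∈ ℝ⁵. -/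
open MeasureTheory Matrix

noncomputable section

abbrev Mat3 := Matrix (Fin 3) (Fin 3) ℝ

def qf (A : Mat3) (ξ : Fin 3 → ℝ) : ℝ := ξ ⬝ᵥ A *ᵥ ξ

def hess (A : Mat3) : Mat3 := (2:ℝ) • A

def OmitsVar (A M : Mat3) (j : Fin 3) : Prop :=
  ∀ ξ η : Fin 3 → ℝ, (∀ i, i ≠ j → ξ i = η i) → qf A (M *ᵥ ξ) = qf A (M *ᵥ η)

def IrreduciblePair (A B : Mat3) : Prop :=
  LinearIndependent ℝ ![hess A, hess B] ∧
  ¬ ∃ (M : Mat3) (j : Fin 3), IsUnit M.det ∧ OmitsVar A M j ∧ OmitsVar B M j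

/-- The Christ–Mockenhaupt condition. -/
def CMCond (A B : Mat3) : Prop :=
  ∀ γ : ℝ, 0 < γ → γ < 2/3 →
    (∫⁻ θ in Set.Icc (0:ℝ) (2 * Real.pi),
      (ENNReal.ofReal |(Real.cos θ • hess A + Real.sin θ • hess B).det|) ^ (-γ)) < ⊤


def ph (a b c s : ℝ) : ℂ := Complex.exp (Complex.I * ((a*s^2+b*s+c : ℝ) : ℂ))

lemma ph_norm (a b c s : ℝ) : ‖ph a b c s‖ = 1 := by
  unfold ph; rw [mul_comm]; exact Complex.norm_exp_ofReal_mul_I _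

lemma ph_cont (a b c : ℝ) : Continuous (ph a b c) := by
  unfold ph; fun_prop

lemma ph_deriv (a b c s : ℝ) :
    HasDerivAt (ph a b c) (Complex.I * ((2*a*s+b : ℝ):ℂ) * ph a b c s) s := by
  have h1 : HasDerivAt (fun s : ℝ => a*s^2+b*s+c) (2*a*s+b) s := by
    have := (((hasDerivAt_id s).pow 2).const_mul a).add ((hasDerivAt_id s).const_mul b)
    have := this.add_const c
    refine this.congr_deriv ?_
    simp; ring
  have h2 := (h1.ofReal_comp.const_mul Complex.I).cexp
  refine h2.congr_deriv ?_
  unfold ph; ring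

lemma nonstat (a b c p q μ : ℝ) (hpq : p ≤ q) (hμ : 0 < μ)
    (h : ∀ s ∈ Set.Icc p q, μ ≤ |2*a*s+b|) :
    ‖∫ s in p..q, ph a b c s‖ ≤ 4/μ := by
  have hne : ∀ s ∈ Set.Icc p q, (2*a*s+b) ≠ 0 := fun s hs h0 => by
    have := h s hs; rw [h0, abs_zero] at this; linarith
  have hu : ∀ s : ℝ, HasDerivAt (fun s : ℝ => 2*a*s+b) (2*a) s := fun s => by
    simpa using ((hasDerivAt_id s).const_mul (2*a)).add_const b
  have hinv : ∀ s ∈ Set.Icc p q, HasDerivAt (fun s : ℝ => (2*a*s+b)⁻¹) (-(2*a)/(2*a*s+b)^2) s :=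
    fun s hs => (hu s).inv (hne s hs)
  have hc : ContinuousOn (fun s : ℝ => -(2*a)/(2*a*s+b)^2) (Set.uIcc p q) := by
    rw [Set.uIcc_of_le hpq]
    refine ContinuousOn.div (by fun_prop) (by fun_prop) fun s hs => pow_ne_zero _ (hne s hs)
  have hint := hc.intervalIntegrable (μ := volume)
  have key := intervalIntegral.integral_mul_deriv_eq_deriv_mul
    (a := p) (b := q) (u := fun s : ℝ => (((2*a*s+b)⁻¹ : ℝ) : ℂ))
    (u' := fun s : ℝ => ((-(2*a)/(2*a*s+b)^2 : ℝ) : ℂ))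
    (v := ph a b c) (v' := fun s => Complex.I * ((2*a*s+b : ℝ):ℂ) * ph a b c s)
    (fun s hs => (hinv s (by rwa [Set.uIcc_of_le hpq] at hs)).ofReal_comp)
    (fun s hs => ph_deriv a b c s)
    ((Complex.continuous_ofReal.comp_continuousOn hc).intervalIntegrable)
    (by
      apply Continuous.intervalIntegrable
      have := ph_cont a b c
      fun_prop)
  have e1 : (∫ s in p..q, (((2*a*s+b)⁻¹ : ℝ) : ℂ) * (Complex.I * ((2*a*s+b : ℝ):ℂ) * ph a b c s))
      = Complex.I * ∫ s in p..q, ph a b c s := by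
    rw [← intervalIntegral.integral_const_mul]
    apply intervalIntegral.integral_congr
    intro s hs
    rw [Set.uIcc_of_le hpq] at hs
    have : ((2*a*s+b : ℝ):ℂ) ≠ 0 := by exact_mod_cast hne s hs
    simp only [Complex.ofReal_inv]
    field_simp
  rw [e1] at key
  have e2 : ‖∫ s in p..q, ph a b c s‖ = ‖Complex.I * ∫ s in p..q, ph a b c s‖ := by simp
  have bnd : ∀ s ∈ Set.Icc p q, |(2*a*s+b)⁻¹| ≤ 1/μ := fun s hs => by
    rw [abs_inv, one_div]; exact inv_anti₀ hμ (h s hs)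
  have ftc := intervalIntegral.integral_eq_sub_of_hasDerivAt
    (fun s hs => hinv s (by rwa [Set.uIcc_of_le hpq] at hs)) hint
  have bp := bnd p ⟨le_rfl, hpq⟩
  have bq := bnd q ⟨hpq, le_rfl⟩
  have e3 : ‖∫ s in p..q, ((-(2*a)/(2*a*s+b)^2 : ℝ) : ℂ) * ph a b c s‖ ≤ 2/μ := by
    have i1 := intervalIntegral.norm_integral_le_integral_norm (μ := volume) (f := fun s => ((-(2*a)/(2*a*s+b)^2 : ℝ) : ℂ) * ph a b c s) hpq
    refine i1.trans ?_
    simp only [norm_mul, ph_norm, mul_one, Complex.norm_real, Real.norm_eq_abs, abs_div, abs_neg, abs_pow, sq_abs]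
    have : ∃ ε : ℝ, |ε| = 1 ∧ |2 * a| = ε * (-(2*a)) := by
      rcases abs_cases (2*a) with h | h
      · exact ⟨-1, by simp, by rw [h.1]; ring⟩
      · exact ⟨1, by simp, by rw [h.1]; ring⟩
    obtain ⟨ε, h1, h2⟩ := this
    have h2' : |2| * |a| = ε * (-(2*a)) := by rw [← abs_mul, h2]
    have h3 : (∫ s in p..q, |2| * |a| / (2*a*s+b)^2) = ε * ((2*a*q+b)⁻¹ - (2*a*p+b)⁻¹) := by
      rw [← ftc, ← intervalIntegral.integral_const_mul]
      congr 1; ext s; rw [h2']; ring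
    rw [abs_mul, h3]
    calc _ ≤ |ε * ((2*a*q+b)⁻¹ - (2*a*p+b)⁻¹)| := le_abs_self _
      _ = |((2*a*q+b)⁻¹ - (2*a*p+b)⁻¹)| := by rw [abs_mul, h1, one_mul]
      _ ≤ |(2*a*q+b)⁻¹| + |(2*a*p+b)⁻¹| := abs_sub _ _
      _ ≤ 1/μ + 1/μ := add_le_add bq bp
      _ = 2/μ := by ring
  rw [e2, key]
  have n1 : ∀ s, ‖(((2*a*s+b)⁻¹ : ℝ) : ℂ) * ph a b c s‖ = |(2*a*s+b)⁻¹| := fun s => by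
    rw [norm_mul, ph_norm, mul_one, Complex.norm_real, Real.norm_eq_abs]
  calc _ ≤ ‖(((2*a*q+b)⁻¹ : ℝ) : ℂ) * ph a b c q‖ + ‖(((2*a*p+b)⁻¹ : ℝ) : ℂ) * ph a b c p‖ + 2/μ :=
        (norm_sub_le _ _).trans (add_le_add (norm_sub_le _ _) e3)
    _ ≤ 1/μ + 1/μ + 2/μ := by rw [n1, n1]; gcongr
    _ = 4/μ := by ring

lemma stat (a b c p q : ℝ) (hpq : p ≤ q) (ha : a ≠ 0) :
    ‖∫ s in p..q, ph a b c s‖ ≤ 6/√|a| := by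
  set r := √|a| with hr
  have hrp : 0 < r := Real.sqrt_pos.2 (abs_pos.2 ha)
  have hrr : r * r = |a| := Real.mul_self_sqrt (abs_nonneg a)
  set s0 := -b/(2*a) with hs0
  have hu : ∀ s, |2*a*s+b| = 2*(r*r)*|s-s0| := fun s => by
    rw [hrr, show 2*a*s+b = 2*a*(s-s0) by rw [hs0]; field_simp; ring, abs_mul, abs_mul]; simp
  set p' := max p (min q (s0-1/r)) with hp'
  set q' := max p (min q (s0+1/r)) with hq'
  have hd : 0 < 1/r := by positivity
  have h1 : p ≤ p' := le_max_left _ _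
  have h2 : p' ≤ q := max_le hpq (min_le_left _ _)
  have h3 : q' ≤ q := max_le hpq (min_le_left _ _)
  have h3' : p ≤ q' := le_max_left _ _
  have h4 : p' ≤ q' := max_le_max le_rfl (min_le_min le_rfl (by linarith))
  have ii : ∀ x y, IntervalIntegrable (ph a b c) volume x y := fun x y =>
    (ph_cont a b c).intervalIntegrable x y
  have split : (∫ s in p..q, ph a b c s) = (∫ s in p..p', ph a b c s) + (∫ s in p'..q', ph a b c s)
      + (∫ s in q'..q, ph a b c s) := by
    rw [intervalIntegral.integral_add_adjacent_intervals (ii _ _) (ii _ _),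
      intervalIntegral.integral_add_adjacent_intervals (ii _ _) (ii _ _)]
  have far : ∀ s, 1/r ≤ |s - s0| → 2*r ≤ |2*a*s+b| := fun s hs => by
    rw [hu]
    calc 2*r = 2*(r*r)*(1/r) := by field_simp
      _ ≤ _ := by gcongr
  have b1 : ‖∫ s in p..p', ph a b c s‖ ≤ 2/r := by
    by_cases h : p' = p
    · rw [h]; simp; positivity
    · have : p' ≤ s0 - 1/r := by
        rcases max_choice p (min q (s0-1/r)) with e | e
        · exact absurd e h
        · rw [hp', e]; exact min_le_right _ _
      refine (nonstat a b c p p' (2*r) h1 (by positivity) fun s hs => far s ?_).trans (le_of_eq (by field_simp; norm_num))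
      rw [abs_sub_comm]; exact le_trans (by linarith [hs.2]) (le_abs_self _)
  have b3 : ‖∫ s in q'..q, ph a b c s‖ ≤ 2/r := by
    by_cases h : q' = q
    · rw [h]; simp; positivity
    · have : s0 + 1/r ≤ q' := by
        rcases min_choice q (s0+1/r) with e | e
        · exact absurd (by rw [hq', e]; exact max_eq_right hpq) h
        · rw [hq', e]; exact le_max_right _ _
      refine (nonstat a b c q' q (2*r) h3 (by positivity) fun s hs => far s ?_).trans (le_of_eq (by field_simp; norm_num))
      exact le_trans (by linarith [hs.1]) (le_abs_self _)
  have b2 : ‖∫ s in p'..q', ph a b c s‖ ≤ 2/r := by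
    have := intervalIntegral.norm_integral_le_of_norm_le_const (a := p') (b := q') (f := ph a b c) (C := 1)
      (fun s _ => (ph_norm a b c s).le)
    refine this.trans ?_
    rw [one_mul, abs_of_nonneg (by linarith)]
    have : 2/r = 1/r+1/r := by ring
    rw [this]
    have : q' ≤ p' + (1/r+1/r) := by
      refine max_le (by linarith) ?_
      have : min q (s0-1/r) ≤ p' := le_max_right _ _
      rcases min_choice q (s0-1/r) with e | e
      · rw [e] at this; linarith [min_le_left q (s0+1/r)]
      · rw [e] at this; linarith [min_le_right q (s0+1/r)]
    linarith
  rw [split]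
  calc _ ≤ 2/r + 2/r + 2/r := (norm_add_le _ _).trans (add_le_add ((norm_add_le _ _).trans (add_le_add b1 b2)) b3)
    _ = 6/r := by ring

lemma vdc (a b c t R : ℝ) (ht0 : 0 ≤ t) (ht1 : t ≤ 1) (hR : 1 ≤ R) (h : R ≤ |a|+|b|) :
    ‖∫ s in (0:ℝ)..t, ph a b c s‖ ≤ 20/√R := by
  have hs : 0 < √R := Real.sqrt_pos.2 (by linarith)
  by_cases hab : 4*|a| ≤ |b|
  · have hb : 4*R/5 ≤ |b| := by linarith
    refine (nonstat a b c 0 t (|b|/2) ht0 (by linarith) fun s hs => ?_).trans ?_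
    · have : |2*a*s| ≤ 2*|a| := by
        rw [abs_mul, abs_mul, abs_two, abs_of_nonneg hs.1]
        have := abs_nonneg a
        nlinarith [hs.2]
      have h2 : |b| ≤ |2*a*s+b| + |2*a*s| := by
        have := abs_sub (2*a*s+b) (2*a*s)
        rwa [add_sub_cancel_left] at this
      linarith
    · rw [div_le_div_iff₀ (by linarith) hs]
      have : √R ≤ R := by
        rw [Real.sqrt_le_left (by linarith)]; nlinarith
      linarith
  · push Not at hab
    have ha : R/9 ≤ |a| := by linarith
    have ha0 : a ≠ 0 := by rintro rfl; simp at hab; linarith [abs_nonneg b]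
    refine (stat a b c 0 t ht0 ha0).trans ?_
    have h3 : √R ≤ 3 * √|a| := by
      rw [Real.sqrt_le_left (by positivity), mul_pow, Real.sq_sqrt (abs_nonneg _)]; linarith
    rw [div_le_div_iff₀ (Real.sqrt_pos.2 (abs_pos.2 ha0)) hs]
    linarith [Real.sqrt_nonneg |a|]

lemma vdc_amp (a b c R B : ℝ) (hR : 1 ≤ R) (h : R ≤ |a|+|b|) (g g' : ℝ → ℝ)
    (hg : ∀ t, HasDerivAt g (g' t) t) (hg' : Continuous g') (hB : ∀ t, |g t| ≤ B)
    (hB' : ∀ t, |g' t| ≤ B) :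
    ‖∫ s in (0:ℝ)..1, ph a b c s * (g s : ℂ)‖ ≤ 40*B/√R := by
  have hs : 0 < √R := Real.sqrt_pos.2 (by linarith)
  have hB0 : 0 ≤ B := (abs_nonneg _).trans (hB 0)
  have key := intervalIntegral.integral_deriv_mul_eq_sub_of_hasDeriv_right (a := 0) (b := 1)
    (u := fun t => ∫ s in (0:ℝ)..t, ph a b c s) (u' := ph a b c)
    (v := fun t => (g t : ℂ)) (v' := fun t => (g' t : ℂ))
  have hF : ∀ t, HasDerivAt (fun t => ∫ s in (0:ℝ)..t, ph a b c s) (ph a b c t) t := fun t =>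
    (ph_cont a b c).integral_hasStrictDerivAt 0 t |>.hasDerivAt
  have hgc : Continuous g := continuous_iff_continuousAt.2 fun t => (hg t).continuousAt
  have hFc : Continuous (fun t => ∫ s in (0:ℝ)..t, ph a b c s) :=
    continuous_iff_continuousAt.2 fun t => (hF t).continuousAt
  have key := intervalIntegral.integral_mul_deriv_eq_deriv_mul (a := 0) (b := 1)
    (v := fun t => ∫ s in (0:ℝ)..t, ph a b c s) (v' := ph a b c)
    (u := fun t => (g t : ℂ)) (u' := fun t => (g' t : ℂ))
    (fun t _ => (hg t).ofReal_comp) (fun t _ => hF t)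
    (Continuous.intervalIntegrable (by fun_prop) _ _) ((ph_cont a b c).intervalIntegrable _ _)
  have e : (∫ s in (0:ℝ)..1, ph a b c s * (g s : ℂ)) = ∫ s in (0:ℝ)..1, (g s : ℂ) * ph a b c s := by
    congr 1; ext s; ring
  rw [e, key]
  simp only [intervalIntegral.integral_same, mul_zero, sub_zero]
  have b1 : ‖(g 1 : ℂ) * ∫ s in (0:ℝ)..1, ph a b c s‖ ≤ B * (20/√R) := by
    rw [norm_mul, Complex.norm_real]
    exact mul_le_mul (hB 1) (vdc a b c 1 R (by norm_num) le_rfl hR h) (norm_nonneg _) hB0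
  have b2 : ‖∫ t in (0:ℝ)..1, (g' t : ℂ) * ∫ s in (0:ℝ)..t, ph a b c s‖ ≤ B * (20/√R) := by
    have := intervalIntegral.norm_integral_le_of_norm_le_const (a := 0) (b := 1)
      (f := fun t => (g' t : ℂ) * ∫ s in (0:ℝ)..t, ph a b c s) (C := B * (20/√R)) (fun t ht => by
        rw [Set.uIoc_of_le zero_le_one] at ht
        rw [norm_mul, Complex.norm_real]
        exact mul_le_mul (hB' t) (vdc a b c t R ht.1.le ht.2 hR h) (norm_nonneg _) hB0)
    simpa using this
  calc _ ≤ _ := norm_sub_le _ _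
    _ ≤ B * (20/√R) + B * (20/√R) := add_le_add b1 b2
    _ = 40*B/√R := by ring

lemma avg_s7 (G : (Fin 3 → ℝ) → ℂ) (hG : Continuous G) (hGi : Integrable G) (v : Fin 3 → ℝ) :
    ∫ ξ, G ξ = ∫ ξ, ∫ t in (0:ℝ)..1, G (ξ + t • v) := by
  have hi : Integrable (Function.uncurry fun (ξ : Fin 3 → ℝ) (t : ℝ) => G (ξ + t • v))
      (volume.prod (volume.restrict (Set.Ioc (0:ℝ) 1))) := by
    rw [integrable_prod_iff']
    · constructor
      · exact Filter.Eventually.of_forall fun t => hGi.comp_add_right (t • v)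
      · have : (fun t : ℝ => ∫ ξ, ‖Function.uncurry (fun (ξ : Fin 3 → ℝ) (t : ℝ) => G (ξ + t • v)) (ξ, t)‖)
            = fun _ => ∫ ξ, ‖G ξ‖ := by
          ext t
          exact integral_add_right_eq_self (fun ξ => ‖G ξ‖) (t • v)
        rw [this]
        exact integrable_const _
    · apply Continuous.aestronglyMeasurable
      unfold Function.uncurry
      fun_prop
  simp only [intervalIntegral.integral_of_le zero_le_one]
  rw [integral_integral_swap hi]
  have : ∀ t : ℝ, ∫ ξ, G (ξ + t • v) = ∫ ξ, G ξ := fun t => integral_add_right_eq_self G (t • v)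
  simp [this]

def dv (i j : Fin 3) : Fin 3 → ℝ := Pi.single i 1 + Pi.single j 1

lemma exists_norm_le {ι : Type*} [Fintype ι] [Nonempty ι] (f : ι → ℝ) : ∃ i, ‖f‖ ≤ |f i| := by
  obtain ⟨i, hi⟩ := Finite.exists_max fun i => |f i|
  exact ⟨i, (pi_norm_le_iff_of_nonneg (abs_nonneg _)).2 hi⟩

lemma dv_bounds (i j k : Fin 3) : 0 ≤ dv i j k ∧ dv i j k ≤ 2 := by
  unfold dv
  simp only [Pi.add_apply, Pi.single_apply]
  split_ifs <;> norm_num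

lemma dv_norm (i j : Fin 3) : ‖dv i j‖ ≤ 2 := by
  refine (pi_norm_le_iff_of_nonneg (by norm_num)).2 fun k => ?_
  have := dv_bounds i j k
  rw [Real.norm_eq_abs, abs_of_nonneg this.1]; exact this.2

lemma qf_shift (A : Mat3) (hA : A.IsSymm) (ξ v : Fin 3 → ℝ) (t : ℝ) :
    qf A (ξ + t • v) = qf A ξ + 2 * t * (v ⬝ᵥ A *ᵥ ξ) + t^2 * qf A v := by
  have h01 := hA.apply 0 1
  have h02 := hA.apply 0 2
  have h12 := hA.apply 1 2
  simp only [qf, dotProduct, mulVec, Fin.sum_univ_three, Pi.add_apply, Pi.smul_apply, smul_eq_mul]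
  rw [h01, h02, h12]
  ring

lemma bil_bound (A : Mat3) : ∃ D : ℝ, ∀ v ξ : Fin 3 → ℝ, ‖v‖ ≤ 2 → ‖ξ‖ ≤ 3 → |v ⬝ᵥ A *ᵥ ξ| ≤ D := by
  have hc : Continuous fun p : (Fin 3 → ℝ) × (Fin 3 → ℝ) => p.1 ⬝ᵥ A *ᵥ p.2 := by
    simp only [dotProduct, mulVec, Fin.sum_univ_three]
    fun_prop
  obtain ⟨D, hD⟩ := ((isCompact_closedBall (0 : Fin 3 → ℝ) 2).prod
    (isCompact_closedBall (0 : Fin 3 → ℝ) 3)).exists_bound_of_continuousOn hc.continuousOn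
  refine ⟨D, fun v ξ hv hξ => hD (v, ξ) ⟨?_, ?_⟩⟩ <;> simpa using by assumption

lemma qf_inj (A B : Mat3) (hAs : A.IsSymm) (hBs : B.IsSymm)
    (h : LinearIndependent ℝ ![hess A, hess B]) :
    ∃ K : ℝ, 0 < K ∧ ∀ y0 y1 : ℝ, ∃ i j, max |y0| |y1| ≤ K * |y0 * qf A (dv i j) + y1 * qf B (dv i j)| := by
  let L : (Fin 2 → ℝ) →ₗ[ℝ] (Fin 3 × Fin 3 → ℝ) :=
    { toFun := fun y p => y 0 * qf A (dv p.1 p.2) + y 1 * qf B (dv p.1 p.2)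
      map_add' := fun y z => by ext p; simp; ring
      map_smul' := fun r y => by ext p; simp; ring }
  have hker : LinearMap.ker L = ⊥ := by
    rw [LinearMap.ker_eq_bot']
    intro y hy
    have hp : ∀ i j, y 0 * qf A (dv i j) + y 1 * qf B (dv i j) = 0 := fun i j => congrFun hy (i, j)
    have a01 := hAs.apply 0 1
    have a02 := hAs.apply 0 2
    have a12 := hAs.apply 1 2
    have b01 := hBs.apply 0 1
    have b02 := hBs.apply 0 2
    have b12 := hBs.apply 1 2
    have p00 := hp 0 0
    have p11 := hp 1 1
    have p22 := hp 2 2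
    have p01 := hp 0 1
    have p02 := hp 0 2
    have p12 := hp 1 2
    simp [qf, dv, dotProduct, mulVec, Fin.sum_univ_three, Pi.single_apply] at p00 p11 p22 p01 p02 p12
    rw [a01, b01] at p01
    rw [a02, b02] at p02
    rw [a12, b12] at p12
    rw [LinearIndependent.pair_iff] at h
    have := h (y 0) (y 1) (by
      ext i j
      fin_cases i <;> fin_cases j <;> simp [hess, a01, a02, a12, b01, b02, b12] <;> linarith)
    ext i
    fin_cases i
    · exact this.1
    · exact this.2
  obtain ⟨K, hK, hL⟩ := L.exists_antilipschitzWith hker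
  refine ⟨K, hK, fun y0 y1 => ?_⟩
  obtain ⟨p, hp⟩ := exists_norm_le (L ![y0, y1])
  refine ⟨p.1, p.2, ?_⟩
  have h1 := hL.le_mul_norm (f := L) (map_zero L) ![y0, y1]
  have h2 : max |y0| |y1| ≤ ‖![y0, y1]‖ :=
    max_le (norm_le_pi_norm ![y0, y1] 0) (norm_le_pi_norm ![y0, y1] 1)
  refine h2.trans (h1.trans ?_)
  gcongr
  exact hp

lemma eucl_le (x : EuclideanSpace ℝ (Fin 5)) :
    ‖x‖ ≤ |x 0| + |x 1| + |x 2| + |x 3| + |x 4| := by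
  rw [EuclideanSpace.norm_eq, Real.sqrt_le_left (by positivity)]
  simp only [Fin.sum_univ_five, Real.norm_eq_abs]
  have h0 := abs_nonneg (x 0)
  have h1 := abs_nonneg (x 1)
  have h2 := abs_nonneg (x 2)
  have h3 := abs_nonneg (x 3)
  have h4 := abs_nonneg (x 4)
  generalize |x 0| = a at *
  generalize |x 1| = b at *
  generalize |x 2| = c at *
  generalize |x 3| = d at *
  generalize |x 4| = e at *
  have : (a+b+c+d+e)^2 = a^2+b^2+c^2+d^2+e^2 + 2*(a*b+a*c+a*d+a*e+b*c+b*d+b*e+c*d+c*e+d*e) := by ring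
  rw [this]
  have : 0 ≤ a*b+a*c+a*d+a*e+b*c+b*d+b*e+c*d+c*e+d*e := by positivity
  linarith

lemma dir (A B : Mat3) (hAs : A.IsSymm) (hBs : B.IsSymm)
    (h : LinearIndependent ℝ ![hess A, hess B]) :
    ∃ c : ℝ, 0 < c ∧ ∀ x : EuclideanSpace ℝ (Fin 5), ∃ i j, ∀ ξ : Fin 3 → ℝ, ‖ξ‖ ≤ 3 →
      c * ‖x‖ ≤ |x 3 * qf A (dv i j) + x 4 * qf B (dv i j)| +
        |(dv i j 0 * x 0 + dv i j 1 * x 1 + dv i j 2 * x 2) +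
          2 * (x 3 * (dv i j ⬝ᵥ A *ᵥ ξ) + x 4 * (dv i j ⬝ᵥ B *ᵥ ξ))| := by
  obtain ⟨K, hK, hL⟩ := qf_inj A B hAs hBs h
  obtain ⟨DA, hDA⟩ := bil_bound A
  obtain ⟨DB, hDB⟩ := bil_bound B
  set D := max 1 (max DA DB) with hD
  have hD1 : 1 ≤ D := le_max_left _ _
  have hDA' : DA ≤ D := (le_max_left _ _).trans (le_max_right _ _)
  have hDB' : DB ≤ D := (le_max_right _ _).trans (le_max_right _ _)
  refine ⟨min (1/4) (1/((12*D+2)*K)), by positivity, fun x => ?_⟩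
  set l := max |x 3| |x 4| with hl
  have hl3 : |x 3| ≤ l := le_max_left _ _
  have hl4 : |x 4| ≤ l := le_max_right _ _
  have hl0 : 0 ≤ l := (abs_nonneg _).trans hl3
  obtain ⟨k, hk⟩ := exists_norm_le ![x 0, x 1, x 2]
  set s := |![x 0, x 1, x 2] k| with hs
  have hs0 : |x 0| ≤ s := (norm_le_pi_norm ![x 0, x 1, x 2] 0).trans hk
  have hs1 : |x 1| ≤ s := (norm_le_pi_norm ![x 0, x 1, x 2] 1).trans hk
  have hs2 : |x 2| ≤ s := (norm_le_pi_norm ![x 0, x 1, x 2] 2).trans hk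
  have hx := eucl_le x
  have hx' : ‖x‖ ≤ 3*s+2*l := by linarith
  have hx0 := norm_nonneg x
  by_cases hc : 4*D*l ≤ s
  · refine ⟨k, k, fun ξ hξ => ?_⟩
    have e1 : |dv k k 0 * x 0 + dv k k 1 * x 1 + dv k k 2 * x 2| = 2 * s := by
      rw [hs]
      have : dv k k 0 * x 0 + dv k k 1 * x 1 + dv k k 2 * x 2 = 2 * ![x 0, x 1, x 2] k := by
        fin_cases k <;> simp [dv] <;> left <;> norm_num
      rw [this, abs_mul, abs_two]
    have e2 : |2 * (x 3 * (dv k k ⬝ᵥ A *ᵥ ξ) + x 4 * (dv k k ⬝ᵥ B *ᵥ ξ))| ≤ 4*D*l := by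
      rw [abs_mul, abs_two]
      have f1 := (hDA (dv k k) ξ (dv_norm k k) hξ).trans hDA'
      have f2 := (hDB (dv k k) ξ (dv_norm k k) hξ).trans hDB'
      have g1 : |x 3 * (dv k k ⬝ᵥ A *ᵥ ξ)| ≤ l * D := by
        rw [abs_mul]; exact mul_le_mul hl3 f1 (abs_nonneg _) hl0
      have g2 : |x 4 * (dv k k ⬝ᵥ B *ᵥ ξ)| ≤ l * D := by
        rw [abs_mul]; exact mul_le_mul hl4 f2 (abs_nonneg _) hl0
      linarith [abs_add_le (x 3 * (dv k k ⬝ᵥ A *ᵥ ξ)) (x 4 * (dv k k ⬝ᵥ B *ᵥ ξ))]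
    have e3 := abs_sub_abs_le_abs_add (dv k k 0 * x 0 + dv k k 1 * x 1 + dv k k 2 * x 2)
      (2 * (x 3 * (dv k k ⬝ᵥ A *ᵥ ξ) + x 4 * (dv k k ⬝ᵥ B *ᵥ ξ)))
    have e4 : min (1/4) (1/((12*D+2)*K)) * ‖x‖ ≤ 1/4 * ‖x‖ :=
      mul_le_mul_of_nonneg_right (min_le_left _ _) hx0
    have e5 : l ≤ D * l := by nlinarith
    have e6 := abs_nonneg (x 3 * qf A (dv k k) + x 4 * qf B (dv k k))
    linarith
  · push Not at hc
    obtain ⟨i, j, hij⟩ := hL (x 3) (x 4)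
    refine ⟨i, j, fun ξ hξ => ?_⟩
    refine le_trans ?_ (le_add_of_nonneg_right (abs_nonneg _))
    have e4 : min (1/4) (1/((12*D+2)*K)) * ‖x‖ ≤ 1/((12*D+2)*K) * ‖x‖ :=
      mul_le_mul_of_nonneg_right (min_le_right _ _) hx0
    refine e4.trans ?_
    rw [one_div_mul_eq_div, div_le_iff₀ (by positivity)]
    have : ‖x‖ ≤ (12*D+2)*l := by linarith
    refine this.trans ?_
    calc (12*D+2)*l ≤ (12*D+2)*(K * |x 3 * qf A (dv i j) + x 4 * qf B (dv i j)|) := by gcongr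
      _ = _ := by ring

theorem fourier_decay_CM (A B : Mat3) (hAs : A.IsSymm) (hBs : B.IsSymm)
    (hirr : IrreduciblePair A B) (hCM : CMCond A B)
    (ψ : (Fin 3 → ℝ) → ℝ) (hψ : ContDiff ℝ (⊤ : ℕ∞) ψ) (hψc : HasCompactSupport ψ)
    (hψ1 : ∀ ξ ∈ Set.Icc (fun _ => (0:ℝ)) (fun _ => 1), ψ ξ = 1)
    (hψ0 : ∀ ξ ∉ Set.Icc (fun _ => (-1:ℝ)) (fun _ => 2), ψ ξ = 0) :
    ∃ C : ℝ, ∀ x : EuclideanSpace ℝ (Fin 5),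
      ‖∫ ξ : Fin 3 → ℝ, Complex.exp (2 * (Real.pi : ℂ) * Complex.I *
          ((ξ 0 * x 0 + ξ 1 * x 1 + ξ 2 * x 2 + qf A ξ * x 3 + qf B ξ * x 4 : ℝ) : ℂ)) *
        (ψ ξ : ℂ)‖ ≤ C * (1 + ‖x‖) ^ (-(1/2) : ℝ) := by
  
  obtain ⟨c, hc, hdir⟩ := dir A B hAs hBs hirr.1
  have hψcont : Continuous ψ := hψ.continuous
  have hψd : Differentiable ℝ ψ := hψ.differentiable (by simp)
  have hψfc : Continuous (fderiv ℝ ψ) := hψ.continuous_fderiv (by simp)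
  obtain ⟨B0, hB0⟩ := hψcont.bounded_above_of_compact_support hψc
  obtain ⟨B1, hB1⟩ := hψfc.bounded_above_of_compact_support (hψc.fderiv (𝕜 := ℝ))
  have hB0n : 0 ≤ B0 := (norm_nonneg _).trans (hB0 0)
  have hB1n : 0 ≤ B1 := (norm_nonneg _).trans (hB1 0)
  set Bd := B0 + B1 * 2 with hBd
  have hBdn : 0 ≤ Bd := by positivity
  set V := (volume : Measure (Fin 3 → ℝ)).real (Metric.closedBall 0 3) with hV
  have hVn : 0 ≤ V := measureReal_nonneg
  set T := ∫ ξ, ‖ψ ξ‖ with hT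
  have hTn : 0 ≤ T := integral_nonneg fun _ => norm_nonneg _
  refine ⟨(T + 40 * Bd * V) * √(1/c + 1), fun x => ?_⟩
  set G : (Fin 3 → ℝ) → ℂ := fun ξ => Complex.exp (2 * (Real.pi : ℂ) * Complex.I *
          ((ξ 0 * x 0 + ξ 1 * x 1 + ξ 2 * x 2 + qf A ξ * x 3 + qf B ξ * x 4 : ℝ) : ℂ)) *
        (ψ ξ : ℂ) with hGdef
  have hqc : ∀ A : Mat3, Continuous (qf A) := fun A => by
    unfold qf
    simp only [dotProduct, mulVec, Fin.sum_univ_three]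
    fun_prop
  have hqA := hqc A
  have hqB := hqc B
  have hGc : Continuous G := by
    rw [hGdef]; fun_prop
  have hGn : ∀ ξ, ‖G ξ‖ = ‖ψ ξ‖ := fun ξ => by
    rw [hGdef]
    simp only [norm_mul, Complex.norm_real]
    rw [show ∀ r : ℝ, 2 * (Real.pi : ℂ) * Complex.I * (r : ℂ) = ((2 * Real.pi * r : ℝ) : ℂ) * Complex.I
      from fun r => by push_cast; ring, Complex.norm_exp_ofReal_mul_I, one_mul]
  have hψi : Integrable ψ := hψcont.integrable_of_hasCompactSupport hψc
  have hGi : Integrable G :=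
    hψi.norm.mono' hGc.aestronglyMeasurable (Filter.Eventually.of_forall fun ξ => (hGn ξ).le)
  have hx0 := norm_nonneg x
  have hrp : (1 + ‖x‖) ^ (-(1/2) : ℝ) = 1 / √(1 + ‖x‖) := by
    rw [Real.rpow_neg (by positivity), ← Real.sqrt_eq_rpow, one_div]
  have hsp : 0 < √(1 + ‖x‖) := Real.sqrt_pos.2 (by positivity)
  rw [hrp]
  by_cases hcx : c * ‖x‖ < 1
  · have h1 : ‖∫ ξ, G ξ‖ ≤ T := by
      refine (norm_integral_le_integral_norm _).trans (le_of_eq ?_)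
      simp only [hGn, hT]
    have h2 : √(1 + ‖x‖) ≤ √(1/c+1) := by
      apply Real.sqrt_le_sqrt
      have : ‖x‖ ≤ 1/c := by rw [le_div_iff₀ hc]; linarith
      linarith
    rw [mul_one_div, le_div_iff₀ hsp]
    have : 0 ≤ 40 * Bd * V := by positivity
    exact mul_le_mul (by linarith) h2 hsp.le (by linarith)
  · push Not at hcx
    obtain ⟨i, j, hij⟩ := hdir x
    set v := dv i j with hv
    have hin : ∀ ξ : Fin 3 → ℝ, ‖ξ‖ ≤ 3 →
        ‖∫ t in (0:ℝ)..1, G (ξ + t • v)‖ ≤ 40 * Bd / √(c * ‖x‖) := by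
      intro ξ hξ
      have hG : ∀ t : ℝ, G (ξ + t • v) = ph (2 * Real.pi * (x 3 * qf A v + x 4 * qf B v))
          (2 * Real.pi * ((v 0 * x 0 + v 1 * x 1 + v 2 * x 2) +
            2 * (x 3 * (v ⬝ᵥ A *ᵥ ξ) + x 4 * (v ⬝ᵥ B *ᵥ ξ))))
          (2 * Real.pi * (ξ 0 * x 0 + ξ 1 * x 1 + ξ 2 * x 2 + qf A ξ * x 3 + qf B ξ * x 4)) t
          * ((ψ (ξ + t • v) : ℝ) : ℂ) := by
        intro t
        simp only [hGdef, ph, qf_shift A hAs, qf_shift B hBs, Pi.add_apply, Pi.smul_apply, smul_eq_mul]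
        congr 2
        push_cast
        ring
      simp only [hG]
      refine vdc_amp _ _ _ (c * ‖x‖) Bd hcx ?_ (fun t => ψ (ξ + t • v))
        (fun t => fderiv ℝ ψ (ξ + t • v) v) ?_ ?_ ?_ ?_
      · refine (hij ξ hξ).trans ?_
        rw [abs_mul, abs_mul (2 * Real.pi)]
        have : 1 ≤ |2 * Real.pi| := by
          rw [abs_of_pos (by positivity)]; linarith [Real.pi_gt_three]
        exact add_le_add (le_mul_of_one_le_left (abs_nonneg _) this)
          (le_mul_of_one_le_left (abs_nonneg _) this)
      · intro t
        have h1 : HasDerivAt (fun t : ℝ => ξ + t • v) v t := by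
          simpa using ((hasDerivAt_id t).smul_const v).const_add ξ
        exact (hψd (ξ + t • v)).hasFDerivAt.comp_hasDerivAt t h1
      · fun_prop
      · intro t
        have := hB0 (ξ + t • v)
        rw [Real.norm_eq_abs] at this
        linarith [mul_nonneg hB1n zero_le_two]
      · intro t
        have h1 := (fderiv ℝ ψ (ξ + t • v)).le_opNorm v
        rw [Real.norm_eq_abs] at h1
        have h2 : ‖fderiv ℝ ψ (ξ + t • v)‖ * ‖v‖ ≤ B1 * 2 :=
          mul_le_mul (hB1 _) (dv_norm i j) (norm_nonneg _) hB1n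
        linarith
    have hout : ∀ ξ : Fin 3 → ℝ, ξ ∉ Metric.closedBall (0 : Fin 3 → ℝ) 3 →
        ∫ t in (0:ℝ)..1, G (ξ + t • v) = 0 := by
      intro ξ hξ
      have : ∀ t ∈ Set.uIcc (0:ℝ) 1, G (ξ + t • v) = (fun _ => (0:ℂ)) t := by
        intro t ht
        rw [Set.uIcc_of_le zero_le_one] at ht
        have : ψ (ξ + t • v) = 0 := by
          apply hψ0
          intro hm
          apply hξ
          rw [mem_closedBall_zero_iff]
          refine (pi_norm_le_iff_of_nonneg (by norm_num)).2 fun k => ?_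
          have m1 := hm.1 k
          have m2 := hm.2 k
          simp only [Pi.add_apply, Pi.smul_apply, smul_eq_mul] at m1 m2
          obtain ⟨d1, d2⟩ := dv_bounds i j k
          have d3 : 0 ≤ t * v k := mul_nonneg ht.1 d1
          have d4 : t * v k ≤ 1 * 2 := mul_le_mul ht.2 d2 d1 zero_le_one
          rw [Real.norm_eq_abs, abs_le]
          constructor <;> linarith
        simp [hGdef, this]
      rw [intervalIntegral.integral_congr this]
      simp
    have hmain : ‖∫ ξ, G ξ‖ ≤ 40 * Bd / √(c * ‖x‖) * V := by
      rw [avg_s7 G hGc hGi v, ← setIntegral_eq_integral_of_forall_compl_eq_zero hout]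
      exact norm_setIntegral_le_of_norm_le_const
        (isCompact_closedBall (0 : Fin 3 → ℝ) 3).measure_lt_top
        fun ξ hξ => hin ξ (mem_closedBall_zero_iff.1 hξ)
    refine hmain.trans ?_
    have hcs : 0 < √(c * ‖x‖) := Real.sqrt_pos.2 (by linarith)
    have h2 : √(1 + ‖x‖) ≤ √(1/c+1) * √(c * ‖x‖) := by
      rw [← Real.sqrt_mul (by positivity)]
      apply Real.sqrt_le_sqrt
      have : (1/c+1) * (c*‖x‖) = ‖x‖ + c * ‖x‖ := by field_simp
      linarith
    rw [mul_one_div, div_mul_eq_mul_div, div_le_div_iff₀ hcs hsp]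
    calc 40 * Bd * V * √(1 + ‖x‖) ≤ (T + 40 * Bd * V) * (√(1/c+1) * √(c * ‖x‖)) :=
          mul_le_mul (by linarith) h2 hsp.le (by positivity)
      _ = _ := by ring
end
end
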